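/- Let κ be the successor cardinal of a regular infinite cardinal. Then there exists a torsion-free Jónsson group of cardinality κ. -/

import Mathlib

namespace JG

/-- integer valued tree metric in four point form -/
structure TreeMetric (V : Type*) where
  d : V → V → ℤ
  self : ∀ x, d x x = 0
  eq_of : ∀ x y, d x y = 0 → x = y
  nonneg : ∀ x y, 0 ≤ d x y
  symm : ∀ x y, d x y = d y x
  four : ∀ x y z w, d x y + d z w ≤ max (d x z + d y w) (d x w + d y z)
  parity : ∀ x y z, (d x y + d y z + d x z) % 2 = 0
  interp : ∀ x y (k : ℤ), 0 ≤ k → k ≤ d x y → ∃ z, d x z = k ∧ d z y = d x y - k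

namespace TreeMetric
variable {V : Type*} (t : TreeMetric V)

theorem tri (x y z : V) : t.d x z ≤ t.d x y + t.d y z := by
  have := t.four x z y y
  have := t.self y
  have := t.symm y z
  omega

/-- `z` lies on the segment `[x,y]` -/
def Btw (x z y : V) : Prop := t.d x z + t.d z y = t.d x y

theorem Btw.symm {t : TreeMetric V} {x y z : V} (h : t.Btw x z y) : t.Btw y z x := by
  unfold Btw at *
  have := t.symm x z
  have := t.symm y z
  have := t.symm x y
  omega

theorem btw_left (x y : V) : t.Btw x x y := by
  unfold Btw; have := t.self x; omega

theorem btw_right (x y : V) : t.Btw x y y := by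
  unfold Btw; have := t.self y; omega

theorem btw_self {x z : V} (h : t.Btw x z x) : z = x := by
  unfold Btw at *
  have := t.self x
  have := t.symm x z
  have := t.nonneg x z
  exact (t.eq_of _ _ (by omega)).symm

/-- segments split through any third point -/
theorem Btw.split {t : TreeMetric V} {x y z : V} (w : V) (h : t.Btw x z y) : t.Btw x z w ∨ t.Btw w z y := by
  unfold Btw at *
  have := t.four x y z w
  have := t.tri x z w
  have := t.tri w z y
  have := t.symm w z
  have := t.symm y z
  have := t.symm w y
  have := t.symm w x
  omega

theorem btw_unique {x y z w : V} (h : t.Btw x z y) (h' : t.Btw x w y) (he : t.d x z = t.d x w) :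
    z = w := by
  unfold Btw at *
  have := t.four x y z w
  have := t.symm w y
  have := t.symm y z
  have := t.nonneg z w
  exact t.eq_of _ _ (by omega)

theorem Btw.trans {t : TreeMetric V} {x y z w : V} (h : t.Btw x z y) (h' : t.Btw x w z) : t.Btw x w y ∧ t.Btw w z y := by
  unfold Btw at *
  have := t.tri x w y
  have := t.tri w z y
  omega

/-- medians -/
theorem median (x y z : V) : ∃ m, t.Btw x m y ∧ t.Btw y m z ∧ t.Btw x m z := by
  have hp := t.parity x y z
  have h1 := t.tri x y z
  have h2 := t.tri x z y
  have h3 := t.tri y x z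
  have e1 := t.symm x y
  have e2 := t.symm z y
  obtain ⟨m, hm, hm'⟩ := t.interp x y ((t.d x y + t.d x z - t.d y z) / 2) (by omega) (by omega)
  have h4 := t.four x y m z
  have h5 := t.tri x m z
  have h6 := t.tri y m z
  have e3 := t.symm m y
  have e4 := t.symm m z
  refine ⟨m, ?_, ?_, ?_⟩ <;> unfold Btw <;> omega

def Convex (W : Set V) : Prop := ∀ x ∈ W, ∀ y ∈ W, ∀ z, t.Btw x z y → z ∈ W

/-- star-shaped implies convex -/
theorem convex_of_star {W : Set V} (v : V) (h : ∀ x ∈ W, ∀ z, t.Btw v z x → z ∈ W) : t.Convex W := by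
  intro x hx y hy z hz
  rcases hz.split v with h1 | h1
  · exact h x hx z h1.symm
  · exact h y hy z h1

/-- isometric parametrized line -/
def IsLine (l : ℤ → V) : Prop := ∀ i j, t.d (l i) (l j) = max (i - j) (j - i)

theorem IsLine.exists_proj {t : TreeMetric V} {l : ℤ → V} (hl : t.IsLine l) (x : V) :
    ∃ (c h : ℤ), 0 ≤ h ∧ ∀ i, t.d x (l i) = h + max (i - c) (c - i) := by
  -- minimise
  obtain ⟨c, hc⟩ : ∃ c, ∀ i, t.d x (l c) ≤ t.d x (l i) := by
    obtain ⟨c, hc⟩ := exists_minimal_of_wellFoundedLT (fun n : ℕ => ∃ i, t.d x (l i) = n)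
      ⟨(t.d x (l 0)).toNat, 0, by have := t.nonneg x (l 0); omega⟩
    obtain ⟨⟨i, hi⟩, hmin⟩ := hc
    refine ⟨i, fun j => ?_⟩
    have h1 := t.nonneg x (l j)
    by_contra hlt
    have := hmin (y := (t.d x (l j)).toNat) ⟨j, by omega⟩ (by omega)
    omega
  refine ⟨c, t.d x (l c), t.nonneg _ _, fun i => ?_⟩
  have h1 := hc i
  have hci := hl c i
  have htri := t.tri x (l c) (l i)
  -- median point of x, l c, l i
  have hp := t.parity x (l c) (l i)
  have h2 := t.tri (l c) x (l i)
  have h3 := t.symm x (l c)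
  -- position
  by_contra hne
  obtain ⟨k, hk⟩ : ∃ k : ℤ, 2 * k = t.d x (l c) + max (i - c) (c - i) - t.d x (l i) := ⟨_, (by omega : 2 * ((t.d x (l c) + max (i - c) (c - i) - t.d x (l i))/2) = _)⟩
  rcases le_total c i with hci' | hci'
  · have h4 := hc (c + k)
    have h5 := t.four x (l (c+k)) (l c) (l i)
    have h6 := hl (c+k) i
    have h7 := hl (c+k) c
    omega
  · have h4 := hc (c - k)
    have h5 := t.four x (l (c-k)) (l c) (l i)
    have h6 := hl (c-k) i
    have h7 := hl (c-k) c
    omega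

end TreeMetric

end JG

namespace JG


/-- Small cancellation data: a group acting on a tree with a family of translated lines. -/
structure SC (P V ι : Type*) [Group P] [MulAction P V] [MulAction P ι] where
  t : TreeMetric V
  isom : ∀ (p : P) x y, t.d (p • x) (p • y) = t.d x y
  r : ι → P
  l : ι → ℤ → V
  line : ∀ a, t.IsLine (l a)
  R : ℤ
  E : ℤ
  trans : ∀ a i, r a • l a i = l a (i + R)
  conj : ∀ (p : P) a, r (p • a) = p * r a * p⁻¹
  mv : ∀ (p : P) a i, p • l a i ∈ Set.range (l (p • a))
  ov : ∀ a b, a ≠ b → ∀ x y, x ∈ Set.range (l a) → x ∈ Set.range (l b) →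
    y ∈ Set.range (l a) → y ∈ Set.range (l b) → t.d x y ≤ E
  hE : 0 ≤ E
  hR : 20 * E + 20 ≤ R

namespace SC
variable {P V ι : Type*} [Group P] [MulAction P V] [MulAction P ι] (s : SC P V ι)

noncomputable def pr (a : ι) (x : V) : ℤ := ((s.line a).exists_proj x).choose
noncomputable def ht (a : ι) (x : V) : ℤ := ((s.line a).exists_proj x).choose_spec.choose

theorem ht_nonneg (a : ι) (x : V) : 0 ≤ s.ht a x :=
  ((s.line a).exists_proj x).choose_spec.choose_spec.1

theorem pr_spec (a : ι) (x : V) (i : ℤ) :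
    s.t.d x (s.l a i) = s.ht a x + max (i - s.pr a x) (s.pr a x - i) :=
  ((s.line a).exists_proj x).choose_spec.choose_spec.2 i

theorem pr_unique (a : ι) (x : V) (c h : ℤ) (H : ∀ i, s.t.d x (s.l a i) = h + max (i - c) (c - i)) :
    s.pr a x = c ∧ s.ht a x = h := by
  have h1 := s.pr_spec a x c
  have h2 := s.pr_spec a x (s.pr a x)
  have h3 := H c
  have h4 := H (s.pr a x)
  omega

theorem pr_dist (a : ι) (x y : V) (h : s.pr a x ≠ s.pr a y) :
    s.t.d x y = s.ht a x + s.ht a y + max (s.pr a x - s.pr a y) (s.pr a y - s.pr a x) := by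
  have h1 := s.pr_spec a x (s.pr a x)
  have h2 := s.pr_spec a x (s.pr a y)
  have h3 := s.pr_spec a y (s.pr a x)
  have h4 := s.pr_spec a y (s.pr a y)
  have h5 := s.line a (s.pr a x) (s.pr a y)
  have h6 := s.t.four x y (s.l a (s.pr a x)) (s.l a (s.pr a y))
  have h7 := s.t.four x (s.l a (s.pr a y)) y (s.l a (s.pr a x))
  have h8 := s.t.symm (s.l a (s.pr a y)) y
  have h9 := s.t.symm (s.l a (s.pr a y)) (s.l a (s.pr a x))
  omega

theorem pr_line (a : ι) (i : ℤ) : s.pr a (s.l a i) = i ∧ s.ht a (s.l a i) = 0 :=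
  s.pr_unique a _ _ _ fun j => by rw [s.line a]; omega

theorem eq_of_ht (a : ι) (x : V) (h : s.ht a x = 0) : x = s.l a (s.pr a x) :=
  s.t.eq_of _ _ (by rw [s.pr_spec]; omega)

theorem mem_of_ht (a : ι) (x : V) (h : s.ht a x = 0) : x ∈ Set.range (s.l a) :=
  ⟨_, (s.eq_of_ht a x h).symm⟩

theorem ht_of_mem {a : ι} {x : V} (h : x ∈ Set.range (s.l a)) : s.ht a x = 0 := by
  obtain ⟨i, rfl⟩ := h
  exact (s.pr_line a i).2

theorem line_convex (a : ι) : s.t.Convex (Set.range (s.l a)) := by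
  rintro _ ⟨i, rfl⟩ _ ⟨j, rfl⟩ z hz
  apply s.mem_of_ht
  unfold TreeMetric.Btw at hz
  have h1 := s.pr_spec a z i
  have h2 := s.pr_spec a z j
  have h3 := s.t.symm (s.l a i) z
  have h4 := s.line a i j
  have := s.ht_nonneg a z
  omega

theorem btw_pr (a : ι) (x : V) (i : ℤ) : s.t.Btw x (s.l a (s.pr a x)) (s.l a i) := by
  unfold TreeMetric.Btw
  rw [s.line, s.pr_spec, s.pr_spec]
  omega

theorem btw_pr2 (a : ι) (x y : V) (h : s.pr a x ≠ s.pr a y) : s.t.Btw x (s.l a (s.pr a x)) y := by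
  unfold TreeMetric.Btw
  rw [s.t.symm _ y, s.pr_spec, s.pr_spec, s.pr_dist a x y h]
  omega

theorem zpow_trans (a : ι) (k i : ℤ) : (s.r a) ^ k • s.l a i = s.l a (i + k * s.R) := by
  induction k using Int.induction_on generalizing i with
  | zero => simp
  | succ k ih => rw [zpow_add_one, mul_smul, s.trans, ih]; congr 1; ring
  | pred k ih =>
    rw [zpow_sub_one, mul_smul]
    have : (s.r a)⁻¹ • s.l a i = s.l a (i - s.R) := by
      rw [inv_smul_eq_iff, s.trans]; congr 1; ring
    rw [this, ih]; congr 1; ring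

theorem isom' (p : P) (x y : V) : s.t.d (p • x) y = s.t.d x (p⁻¹ • y) := by
  rw [← s.isom p x, smul_inv_smul]

theorem pr_zpow (a : ι) (k : ℤ) (x : V) :
    s.pr a ((s.r a) ^ k • x) = s.pr a x + k * s.R ∧ s.ht a ((s.r a) ^ k • x) = s.ht a x :=
  s.pr_unique a _ _ _ fun i => by
    rw [s.isom', ← zpow_neg, s.zpow_trans, s.pr_spec, neg_mul]; omega

theorem btw_smul (p : P) {x y z : V} (h : s.t.Btw x z y) : s.t.Btw (p • x) (p • z) (p • y) := by
  unfold TreeMetric.Btw at *; rw [s.isom, s.isom, s.isom]; exact h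

theorem mem_smul (p : P) {a : ι} {x : V} (h : x ∈ Set.range (s.l a)) :
    p • x ∈ Set.range (s.l (p • a)) := by
  obtain ⟨i, rfl⟩ := h; exact s.mv p a i

theorem pr_mem {W : Set V} (hW : s.t.Convex W) {a : ι} {x w : V} (hx : x ∈ W) (hw : w ∈ W)
    (hwa : w ∈ Set.range (s.l a)) : s.l a (s.pr a x) ∈ W := by
  obtain ⟨i, rfl⟩ := hwa
  exact hW _ hx _ hw _ (s.btw_pr a x i)

def D (s : SC P V ι) : ℤ := 2 * s.E + 2

/-- displacement along line `a` -/
noncomputable def disp (a : ι) (x y : V) : ℤ := max (s.pr a x - s.pr a y) (s.pr a y - s.pr a x)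

structure Windmill (v : V) where
  W : Set V
  M : Subgroup P
  conv : s.t.Convex W
  base : v ∈ W
  inv : ∀ m ∈ M, ∀ x ∈ W, m • x ∈ W
  lines : ∀ a, (Set.range (s.l a) ⊆ W ∧ s.r a ∈ M) ∨
    (∀ x y, x ∈ Set.range (s.l a) → y ∈ Set.range (s.l a) → x ∈ W → y ∈ W → s.t.d x y ≤ s.D)
  green : ∀ m ∈ M, m ≠ 1 → ∃ a, s.R - s.E - s.D ≤ s.disp a v (m • v)

namespace Windmill
variable {s} {v : V} (w : s.Windmill v)

def Done (a : ι) : Prop := Set.range (s.l a) ⊆ w.W ∧ s.r a ∈ w.M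

def 𝓑 : Set ι := {a | ¬ w.Done a ∧ ∃ x ∈ w.W, x ∈ Set.range (s.l a)}

theorem done_smul {m : P} (hm : m ∈ w.M) {a : ι} (h : w.Done a) : w.Done (m • a) := by
  refine ⟨?_, ?_⟩
  · intro x hx
    have := s.mem_smul m⁻¹ hx
    rw [inv_smul_smul] at this
    have := w.inv m hm _ (h.1 this)
    rwa [smul_inv_smul] at this
  · rw [s.conj]; exact mul_mem (mul_mem hm h.2) (inv_mem hm)

theorem 𝓑_smul {m : P} (hm : m ∈ w.M) {a : ι} (h : a ∈ w.𝓑) : m • a ∈ w.𝓑 := by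
  refine ⟨fun hd => h.1 ?_, ?_⟩
  · have := w.done_smul (inv_mem hm) hd
    rwa [inv_smul_smul] at this
  · obtain ⟨x, hx, hx'⟩ := h.2
    exact ⟨m • x, w.inv m hm x hx, s.mem_smul m hx'⟩

theorem 𝓑_diam {a : ι} (h : a ∈ w.𝓑) {x y : V} (hx : x ∈ Set.range (s.l a))
    (hy : y ∈ Set.range (s.l a)) (hxW : x ∈ w.W) (hyW : y ∈ w.W) : s.t.d x y ≤ s.D :=
  (w.lines a).resolve_left h.1 x y hx hy hxW hyW

/-- two points of `W` have nearby projections -/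
theorem pr_W {b : ι} (hb : b ∈ w.𝓑) {x y : V} (hx : x ∈ w.W) (hy : y ∈ w.W) :
    s.disp b x y ≤ s.D := by
  obtain ⟨z, hz, hzb⟩ := hb.2
  have h1 := s.pr_mem w.conv hx hz hzb
  have h2 := s.pr_mem w.conv hy hz hzb
  have := w.𝓑_diam hb ⟨_, rfl⟩ ⟨_, rfl⟩ h1 h2
  rw [s.line] at this
  exact this

/-- points on other lines of `𝓑` -/
theorem pr_other {b b' : ι} (hb : b ∈ w.𝓑) (hb' : b' ∈ w.𝓑) (hne : b ≠ b') {z : V}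
    (hz : z ∈ Set.range (s.l b')) : s.disp b z v ≤ s.E + s.D := by
  obtain ⟨x, hx, hxb⟩ := hb'.2
  have h1 := w.pr_W hb hx w.base
  by_cases h : s.pr b z = s.pr b x
  · unfold disp at *; rw [h]; have := s.hE; omega
  · have h2 := s.line_convex b' z hz x hxb _ (s.btw_pr2 b z x h)
    have h3 := s.line_convex b' x hxb z hz _ (s.btw_pr2 b x z (Ne.symm h))
    have := s.ov b b' hne _ _ ⟨_, rfl⟩ h2 ⟨_, rfl⟩ h3
    rw [s.line] at this
    unfold disp at *
    omega

/-- ping pong -/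
theorem pr_far {b b' : ι} (hb : b ∈ w.𝓑) (hb' : b' ∈ w.𝓑) (hne : b ≠ b') {z : V}
    (hz : s.E + s.D < s.disp b' z v) : s.disp b z v ≤ s.E + s.D := by
  obtain ⟨x, hx, hxb⟩ := hb'.2
  have hE := s.hE
  set q := s.l b' (s.pr b' v) with hq
  set p := s.l b' (s.pr b' z) with hp
  have hqW : q ∈ w.W := s.pr_mem w.conv w.base hx hxb
  have hqp : s.t.d q p = s.disp b' z v := by rw [hq, hp, s.line]; unfold disp; omega
  have hD : 0 ≤ s.D := by unfold D; omega
  have hbt : s.t.Btw q p z := (s.btw_pr b' z _).symm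
  have h1 := w.pr_W hb hqW w.base
  by_cases h : s.pr b z = s.pr b q
  · unfold disp at *; rw [h]; omega
  -- the interval on b
  set u := s.l b (s.pr b q) with hu
  set u' := s.l b (s.pr b z) with hu'
  have huu' : s.t.d u u' = s.disp b z q := by rw [hu, hu', s.line]; unfold disp; omega
  have huW : u ∈ w.W := by
    obtain ⟨y, hy, hyb⟩ := hb.2
    exact s.pr_mem w.conv hqW hy hyb
  have hbu : s.t.Btw q u z := s.btw_pr2 b q z (Ne.symm h)
  have hbu' : s.t.Btw z u' q := s.btw_pr2 b z q h
  have hpb' : p ∈ Set.range (s.l b') := ⟨_, rfl⟩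
  have hqb' : q ∈ Set.range (s.l b') := ⟨_, rfl⟩
  have hquu' : s.t.d q u' = s.t.d q u + s.t.d u u' := by
    rw [hu, hu', s.line]
    have e1 := s.pr_spec b q (s.pr b q)
    have e2 := s.pr_spec b q (s.pr b z)
    omega
  suffices s.t.d u u' ≤ s.E by unfold disp at *; omega
  have order : ∀ x y, s.t.Btw q x z → s.t.Btw q y z → s.t.d q x ≤ s.t.d q y → s.t.Btw q x y := by
    intro x y hx hy hxy
    unfold TreeMetric.Btw at *
    have := s.t.four q z x y
    have := s.t.tri q x y
    have := s.t.symm z y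
    have := s.t.symm z x
    omega
  by_cases hs : s.t.d q p ≤ s.t.d q u
  · have hpW : p ∈ w.W := w.conv q hqW u huW p (order p u hbt hbu hs)
    have := w.𝓑_diam hb' hqb' hpb' hqW hpW
    omega
  · have hub' : u ∈ Set.range (s.l b') := s.line_convex b' q hqb' p hpb' u (order u p hbu hbt (by omega))
    have h3 := w.𝓑_diam hb' hqb' hub' hqW huW
    by_cases hs2 : s.t.d q u' ≤ s.t.d q p
    · have hub'' : u' ∈ Set.range (s.l b') := s.line_convex b' q hqb' p hpb' u' (order u' p hbu'.symm hbt hs2)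
      exact s.ov b b' hne _ _ ⟨_, rfl⟩ hub' ⟨_, rfl⟩ hub''
    · -- p lies on [u,u'], hence on b
      have e1 := order p u' hbt hbu'.symm (by omega)
      have e2 := order u p hbu hbt (by omega)
      have e3 : s.t.Btw u p u' := by unfold TreeMetric.Btw at *; omega
      have hpb := s.line_convex b u ⟨_, rfl⟩ u' ⟨_, rfl⟩ p e3
      have : s.t.d u p ≤ s.E := s.ov b b' hne _ _ ⟨_, rfl⟩ hub' hpb hpb'
      unfold TreeMetric.Btw at e2
      omega

inductive NF : Option ι → P → Prop
  | base (m : P) (hm : m ∈ w.M) : NF none m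
  | step (o : Option ι) (g : P) (b : ι) (k : ℤ) (h : NF o g) (ho : o ≠ some b) (hb : b ∈ w.𝓑)
      (hk : k ≠ 0) : NF (some b) (s.r b ^ k * g)

theorem NF.mul_left {w : s.Windmill v} {o : Option ι} {g : P} (h : w.NF o g) {m : P} (hm : m ∈ w.M) :
    w.NF (o.map (m • ·)) (m * g) := by
  induction h with
  | base m' hm' => exact NF.base _ (mul_mem hm hm')
  | step o g b k h ho hb hk ih =>
    have : m * (s.r b ^ k * g) = s.r (m • b) ^ k * (m * g) := by
      rw [s.conj, conj_zpow]; group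
    rw [this]
    refine NF.step _ _ _ _ ih ?_ (w.𝓑_smul hm hb) hk
    cases o with
    | none => simp
    | some c =>
      simp only [Option.map_some, ne_eq, Option.some.injEq, smul_left_cancel_iff]
      simpa using ho

theorem NF.mul_zpow {w : s.Windmill v} {o : Option ι} {g : P} (h : w.NF o g) {b : ι} (hb : b ∈ w.𝓑) (k : ℤ) :
    ∃ o', w.NF o' (s.r b ^ k * g) := by
  by_cases hk : k = 0
  · subst hk; exact ⟨o, by simpa using h⟩
  by_cases ho : o = some b
  · subst ho
    cases h with
    | step o g _ k' h ho hb' hk' =>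
      rw [← mul_assoc, ← zpow_add]
      by_cases hkk : k + k' = 0
      · rw [hkk]; exact ⟨o, by simpa using h⟩
      · exact ⟨_, NF.step _ _ _ _ h ho hb hkk⟩
  · exact ⟨_, NF.step _ _ _ _ h ho hb hk⟩

def M' : Subgroup P := w.M ⊔ Subgroup.closure (s.r '' w.𝓑)

theorem M_le : w.M ≤ w.M' := le_sup_left
theorem r_mem {b : ι} (hb : b ∈ w.𝓑) : s.r b ∈ w.M' :=
  (le_sup_right : _ ≤ w.M') (Subgroup.subset_closure ⟨b, hb, rfl⟩)

theorem M'_induction {p : P → Prop} (hM : ∀ m ∈ w.M, p m) (hr : ∀ b ∈ w.𝓑, ∀ k : ℤ, p (s.r b ^ k))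
    (hmul : ∀ x y, p x → p y → p (x * y)) {g : P} (hg : g ∈ w.M') : p g := by
  have : w.M' = Subgroup.closure (w.M ∪ s.r '' w.𝓑) := by
    rw [M', Subgroup.closure_union, Subgroup.closure_eq]
  rw [this] at hg
  induction hg using Subgroup.closure_induction'' with
  | mem x hx =>
    rcases hx with hx | ⟨b, hb, rfl⟩
    · exact hM _ hx
    · simpa using hr b hb 1
  | inv_mem x hx =>
    rcases hx with hx | ⟨b, hb, rfl⟩
    · exact hM _ (inv_mem hx)
    · simpa using hr b hb (-1)
  | one => exact hM 1 (one_mem _)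
  | mul x y _ _ hx hy => exact hmul x y hx hy

theorem exists_NF {g : P} (hg : g ∈ w.M') : ∃ o, w.NF o g := by
  suffices ∀ g', (∃ o, w.NF o g') → ∃ o, w.NF o (g * g') by
    simpa using this 1 ⟨_, NF.base 1 (one_mem _)⟩
  refine w.M'_induction (p := fun g => ∀ g', (∃ o, w.NF o g') → ∃ o, w.NF o (g * g')) ?_ ?_ ?_ hg
  · rintro m hm g' ⟨o, h⟩; exact ⟨_, h.mul_left hm⟩
  · rintro b hb k g' ⟨o, h⟩; exact h.mul_zpow hb k
  · intro x y hx hy g' h; rw [mul_assoc]; exact hx _ (hy _ h)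

theorem NF.mem {w : s.Windmill v} {o : Option ι} {g : P} (h : w.NF o g) : g ∈ w.M' := by
  induction h with
  | base m hm => exact w.M_le hm
  | step o g b k h ho hb hk ih => exact mul_mem (zpow_mem (w.r_mem hb) _) ih

/-- abstract ping-pong statement: `z` is near `v` for all lines -/
theorem NF.far {w : s.Windmill v} {o : Option ι} {g : P} (h : w.NF o g) {z : V}
    (hz : ∀ m ∈ w.M, ∀ b ∈ w.𝓑, s.disp b (m • z) v ≤ s.E + s.D) :
    (∀ b ∈ w.𝓑, o ≠ some b → s.disp b (g • z) v ≤ s.E + s.D) ∧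
    (∀ b ∈ w.𝓑, o = some b → s.R - s.E - s.D ≤ s.disp b (g • z) v) := by
  have hE := s.hE
  have hR := s.hR
  have hD : s.D = 2 * s.E + 2 := rfl
  induction h with
  | base m hm => exact ⟨fun b hb _ => hz m hm b hb, by simp⟩
  | step o g b k h ho hb hk ih =>
    have key : s.R - s.E - s.D ≤ s.disp b ((s.r b ^ k * g) • z) v := by
      have h1 := ih.1 b hb ho
      have h2 := (s.pr_zpow b k (g • z)).1
      rw [mul_smul]
      unfold disp at *
      rw [h2]
      have : s.R ≤ k * s.R ∨ k * s.R ≤ - s.R := by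
        rcases lt_or_gt_of_ne hk with h | h
        · right; nlinarith
        · left; nlinarith
      omega
    refine ⟨fun c hc hne => ?_, ?_⟩
    · refine w.pr_far hc hb (fun h => hne (by rw [h])) ?_
      omega
    · rintro c hc h; cases h; exact key

end Windmill
end SC
end JG

namespace JG
namespace SC
namespace Windmill
variable {P V ι : Type*} [Group P] [MulAction P V] [MulAction P ι] {s : SC P V ι}
variable {v : V} (w : s.Windmill v)

def U : Set V := w.W ∪ {x | ∃ b ∈ w.𝓑, x ∈ Set.range (s.l b)}

def W' : Set V := {x | ∃ g ∈ w.M', ∃ z ∈ w.U, x = g • z}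

theorem W'_smul {g : P} (hg : g ∈ w.M') {x : V} (hx : x ∈ w.W') : g • x ∈ w.W' := by
  obtain ⟨g', hg', z, hz, rfl⟩ := hx
  exact ⟨g * g', mul_mem hg hg', z, hz, by rw [mul_smul]⟩

theorem U_sub : w.U ⊆ w.W' := fun z hz => ⟨1, one_mem _, z, hz, by simp⟩

theorem W_sub : w.W ⊆ w.W' := fun _ hz => w.U_sub (Or.inl hz)

theorem line_sub {b : ι} (hb : b ∈ w.𝓑) {x : V} (hx : x ∈ Set.range (s.l b)) : x ∈ w.W' :=
  w.U_sub (Or.inr ⟨b, hb, hx⟩)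

/-- star-shapedness is preserved when moving through a segment inside `W'` -/
theorem W'_conv : s.t.Convex w.W' := by
  apply s.t.convex_of_star v
  rintro _ ⟨g, hg, z, hz, rfl⟩
  have key : ∀ x, (∀ y, s.t.Btw v y x → y ∈ w.W') → (∀ y, s.t.Btw v y (g • x) → y ∈ w.W') := by
    refine w.M'_induction (p := fun g => ∀ x, (∀ y, s.t.Btw v y x → y ∈ w.W') →
      (∀ y, s.t.Btw v y (g • x) → y ∈ w.W')) ?_ ?_ ?_ hg
    · intro m hm x hx y hy
      have h1 := s.btw_smul m⁻¹ hy
      rw [inv_smul_smul] at h1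
      rw [← smul_inv_smul m y]
      apply w.W'_smul (w.M_le hm)
      rcases h1.split v with h2 | h2
      · exact w.W_sub (w.conv _ (w.inv _ (inv_mem hm) _ w.base) _ w.base _ h2)
      · exact hx _ h2
    · intro b hb k x hx y hy
      obtain ⟨q, hq, i, rfl⟩ := hb.2
      have hmem : s.r b ^ k ∈ w.M' := zpow_mem (w.r_mem hb) _
      have h1 := s.btw_smul (s.r b ^ k)⁻¹ hy
      rw [inv_smul_smul] at h1
      rw [← smul_inv_smul (s.r b ^ k) y]
      apply w.W'_smul hmem
      rcases h1.split v with h2 | h2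
      · rcases h2.split (s.l b i) with h3 | h3
        · have h4 := s.btw_smul (s.r b ^ k) h3
          rw [smul_inv_smul, smul_inv_smul] at h4
          rw [← inv_smul_smul (s.r b ^ k) ((s.r b ^ k)⁻¹ • y), smul_inv_smul]
          apply w.W'_smul (inv_mem hmem)
          rcases h4.split (s.l b i) with h5 | h5
          · exact w.W_sub (w.conv _ w.base _ hq _ h5)
          · refine w.line_sub hb (s.line_convex b _ ⟨_, rfl⟩ _ ?_ _ h5)
            rw [s.zpow_trans]; exact ⟨_, rfl⟩
        · exact w.W_sub (w.conv _ hq _ w.base _ h3)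
      · exact hx _ h2
    · intro g g' hg hg' x hx
      rw [mul_smul]
      exact hg _ (hg' _ hx)
  apply key
  intro y hy
  rcases hz with hz | ⟨b, hb, hz⟩
  · exact w.W_sub (w.conv _ w.base _ hz _ hy)
  · obtain ⟨q, hq, hqb⟩ := hb.2
    rcases hy.split q with h | h
    · exact w.W_sub (w.conv _ w.base _ hq _ h)
    · exact w.line_sub hb (s.line_convex b _ hqb _ hz _ h)

def Done' (a : ι) : Prop := Set.range (s.l a) ⊆ w.W' ∧ s.r a ∈ w.M'

theorem Done'_smul {g : P} (hg : g ∈ w.M') {a : ι} (h : w.Done' a) : w.Done' (g • a) := by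
  refine ⟨?_, ?_⟩
  · intro x hx
    have := s.mem_smul g⁻¹ hx
    rw [inv_smul_smul] at this
    have := w.W'_smul hg (h.1 this)
    rwa [smul_inv_smul] at this
  · rw [s.conj]; exact mul_mem (mul_mem hg h.2) (inv_mem hg)

theorem done'_of_meets {a : ι} {g : P} (hg : g ∈ w.M') {x : V} (hx : x ∈ Set.range (s.l a))
    (hxW : g⁻¹ • x ∈ w.W) : w.Done' a := by
  rw [← smul_inv_smul g a]
  apply w.Done'_smul hg
  by_cases hd : w.Done (g⁻¹ • a)
  · exact ⟨hd.1.trans w.W_sub, w.M_le hd.2⟩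
  · have hb : g⁻¹ • a ∈ w.𝓑 := ⟨hd, _, hxW, s.mem_smul _ hx⟩
    exact ⟨fun y hy => w.line_sub hb hy, w.r_mem hb⟩

theorem done'_of_𝓑 {b : ι} (hb : b ∈ w.𝓑) : w.Done' b :=
  ⟨fun _ hy => w.line_sub hb hy, w.r_mem hb⟩

/-- main estimate: closest translate is `W` itself -/
theorem overlap_aux {a : ι} (ha : ¬ w.Done' a) {x y q p : V} (hx : x ∈ Set.range (s.l a))
    (hy : y ∈ Set.range (s.l a)) (hxW : x ∈ w.W') (hq : s.t.Btw x q y) (hp : p ∈ w.W)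
    (hmin : ∀ q' p' g, g ∈ w.M' → s.t.Btw x q' y → p' ∈ w.W → s.t.d q p ≤ s.t.d q' (g • p')) :
    s.t.d q x ≤ s.E := by
  have hE := s.hE
  have hR := s.hR
  have hD : s.D = 2 * s.E + 2 := rfl
  have hqa : q ∈ Set.range (s.l a) := s.line_convex a x hx y hy q hq
  have havoid : ∀ z ∈ w.W, z ∉ Set.range (s.l a) := fun z hz hza =>
    ha (w.done'_of_meets (one_mem _) hza (by simpa using hz))
  -- q lies on [p,x]
  have hpqx : s.t.Btw p q x := by
    obtain ⟨m, hm1, hm2, hm3⟩ := s.t.median p q x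
    have hmy : s.t.Btw x m y := (hq.trans hm2.symm).1
    have := hmin m p 1 (one_mem _) hmy hp
    rw [one_smul] at this
    have e : m = q := by
      unfold TreeMetric.Btw at hm1
      have := s.t.symm p q
      have := s.t.symm m p
      have := s.t.nonneg m q
      exact s.t.eq_of _ _ (by omega)
    rwa [← e]
  -- it suffices to find a line of 𝓑 through p and x
  suffices h : ∃ c ∈ w.𝓑, p ∈ Set.range (s.l c) ∧ x ∈ Set.range (s.l c) by
    obtain ⟨c, hc, hpc, hxc⟩ := h
    have hqc := s.line_convex c p hpc x hxc q hpqx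
    exact s.ov a c (fun h => ha (h ▸ w.done'_of_𝓑 hc)) q x hqa hqc hx hxc
  -- if x is on a line of 𝓑 then p is as well
  have hfin : ∀ m0 ∈ w.W, s.t.Btw p m0 x → m0 = p := by
    intro m0 hm0 hb
    rcases hb.split q with h1 | h1
    · have := hmin q m0 1 (one_mem _) hq hm0
      rw [one_smul] at this
      unfold TreeMetric.Btw at h1
      have := s.t.symm p q
      have := s.t.symm m0 q
      have := s.t.nonneg p m0
      exact (s.t.eq_of _ _ (by omega)).symm
    · exact absurd (s.line_convex a q hqa x hx m0 h1) (havoid m0 hm0)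
  have hline : ∀ c ∈ w.𝓑, x ∈ Set.range (s.l c) → p ∈ Set.range (s.l c) := by
    intro c hc hxc
    obtain ⟨w0, hw0, hw0c⟩ := hc.2
    obtain ⟨m0, h1, h2, h3⟩ := s.t.median p w0 x
    have := hfin m0 (w.conv _ hp _ hw0 _ h1) h3
    rw [← this]
    exact s.line_convex c _ hw0c _ hxc _ h2
  by_contra hno
  have hno' : ∀ c ∈ w.𝓑, x ∉ Set.range (s.l c) := fun c hc hxc => hno ⟨c, hc, hline c hc hxc, hxc⟩
  obtain ⟨g, hg, z, hz, hxz⟩ := hxW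
  obtain ⟨o, hnf⟩ := w.exists_NF hg
  -- reduce to a final letter `b`
  obtain ⟨b, k, hb, hk, hfar, hnear⟩ : ∃ b, ∃ k : ℤ, b ∈ w.𝓑 ∧ k ≠ 0 ∧
      s.R - s.E - s.D ≤ s.disp b x v ∧ s.disp b (s.r b ^ (-k) • x) v ≤ s.E + s.D := by
    -- general claim by cases on the form
    have claim : ∀ o g, w.NF o g → x = g • z → ∃ b, ∃ k : ℤ, b ∈ w.𝓑 ∧ k ≠ 0 ∧
      s.R - s.E - s.D ≤ s.disp b x v ∧ s.disp b (s.r b ^ (-k) • x) v ≤ s.E + s.D := by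
      intro o g hnf hxz
      have claim2 : ∀ o g b (k : ℤ), w.NF o g → o ≠ some b → b ∈ w.𝓑 → k ≠ 0 →
          s.disp b (g • z) v ≤ s.E + s.D → x = (s.r b ^ k * g) • z → 
          ∃ b, ∃ k : ℤ, b ∈ w.𝓑 ∧ k ≠ 0 ∧
      s.R - s.E - s.D ≤ s.disp b x v ∧ s.disp b (s.r b ^ (-k) • x) v ≤ s.E + s.D := by
        intro o g b k hnf ho hb hk hd hx
        rw [mul_smul] at hx
        refine ⟨b, k, hb, hk, ?_, ?_⟩
        · have h2 := (s.pr_zpow b k (g • z)).1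
          rw [hx]
          unfold disp at *
          rw [h2]
          have : s.R ≤ k * s.R ∨ k * s.R ≤ - s.R := by
            rcases lt_or_gt_of_ne hk with h | h
            · right; nlinarith
            · left; nlinarith
          omega
        · rw [hx, zpow_neg, inv_smul_smul]; exact hd
      rcases hz with hz | ⟨c, hc, hz⟩
      · cases hnf with
        | base m hm => 
          have : x ∈ w.W := by rw [hxz]; exact w.inv _ hm z hz
          exact absurd hx (havoid x this)
        | step o g b k h ho hb hk => 
          have hz' : ∀ m ∈ w.M, ∀ b ∈ w.𝓑, s.disp b (m • z) v ≤ s.E + s.D := fun m hm b hb => by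
            have := w.pr_W hb (w.inv m hm z hz) w.base; omega
          exact claim2 o g b k h ho hb hk ((h.far hz').1 b hb ho) hxz
      · -- z on a line; peel
        have hpeel : ∀ o g, w.NF o g → (∃ c ∈ w.𝓑, g • z ∈ Set.range (s.l c)) ∨ 
            ∃ b ∈ w.𝓑, o = some b ∧ ∃ o' g', ∃ k : ℤ, w.NF o' g' ∧ o' ≠ some b ∧ k ≠ 0 ∧
              g = s.r b ^ k * g' ∧ s.disp b (g' • z) v ≤ s.E + s.D := by
          intro o g h
          induction h with
          | base m hm => exact Or.inl ⟨m • c, w.𝓑_smul hm hc, s.mem_smul m hz⟩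
          | step o g b k h ho hb hk ih =>
            rcases ih with ⟨c', hc', hz'⟩ | ⟨b', hb', ho', o', g', k', h', hne, hk', hgg', hd⟩
            · by_cases hbc : b = c'
              · left
                refine ⟨b, hb, ?_⟩
                rw [← hbc] at hz'
                obtain ⟨i, hi⟩ := hz'
                rw [mul_smul, ← hi, s.zpow_trans]
                exact ⟨_, rfl⟩
              · right
                exact ⟨b, hb, rfl, o, g, k, h, ho, hk, rfl, w.pr_other hb hc' hbc hz'⟩
            · right
              refine ⟨b, hb, rfl, o, g, k, h, ho, hk, rfl, w.pr_far hb hb' ?_ ?_⟩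
              · rintro rfl; exact ho ho'
              · have h2 := (s.pr_zpow b' k' (g' • z)).1
                rw [hgg', mul_smul]
                unfold disp at *
                rw [h2]
                have : s.R ≤ k' * s.R ∨ k' * s.R ≤ - s.R := by
                  rcases lt_or_gt_of_ne hk' with h | h
                  · right; nlinarith
                  · left; nlinarith
                omega
        rcases hpeel o g hnf with ⟨c', hc', hz'⟩ | ⟨b, hb, ho, o', g', k, h', hne, hk, hgg, hd⟩
        · exact absurd (hxz ▸ hz') (hno' c' hc')
        · exact claim2 o' g' b k h' hne hb hk hd (by rw [hxz, hgg])
    exact claim o g hnf hxz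
  -- now compare distances
  set u := s.l b (s.pr b x) with hu
  obtain ⟨w0, hw0, hw0b⟩ := hb.2
  -- p projects near v
  have hpv := w.pr_W hb hp w.base
  have hne : s.pr b p ≠ s.pr b x := by
    intro h; unfold disp at *; rw [h] at hpv; omega
  have hpb : p = s.l b (s.pr b p) := by
    have h1 := s.pr_mem w.conv hp hw0 hw0b
    exact (hfin _ h1 (s.btw_pr2 b p x hne)).symm
  -- point of r^k W near u
  set w1 := s.l b (s.pr b v) with hw1
  have hw1W : w1 ∈ w.W := s.pr_mem w.conv w.base hw0 hw0b
  have hw1u : s.t.d u (s.r b ^ k • w1) ≤ s.E + s.D := by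
    rw [hw1, s.zpow_trans, hu, s.line]
    have h2 := (s.pr_zpow b (-k) x).1
    unfold disp at hnear
    rw [h2] at hnear
    have : -k * s.R = -(k * s.R) := by ring
    rw [this] at hnear
    omega
  have hpu : s.R - s.E - 2 * s.D ≤ s.t.d p u := by
    have := s.line b (s.pr b p) (s.pr b x)
    rw [← hpb, ← hu] at this; unfold disp at hfar hpv; omega
  have hpux : s.t.Btw p u x := (s.btw_pr2 b x p (Ne.symm hne)).symm
  have hmem : s.r b ^ k ∈ w.M' := zpow_mem (w.r_mem hb) _
  rcases hpux.split q with h1 | h1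
  · have e1 := hmin q w1 _ hmem hq hw1W
    have e2 := s.t.tri q u (s.r b ^ k • w1)
    unfold TreeMetric.Btw at h1
    have := s.t.symm p q
    have := s.t.symm u q
    omega
  · have e1 := hmin u w1 _ hmem (hq.trans h1.symm).1 hw1W
    have hqb : q ∈ Set.range (s.l b) := by
      apply s.line_convex b p (by rw [hpb]; exact ⟨_, rfl⟩) u ⟨_, rfl⟩
      unfold TreeMetric.Btw at *
      have := s.t.tri p q u
      omega
    have hua : u ∈ Set.range (s.l a) := s.line_convex a _ hqa _ hx _ h1
    have e3 := s.ov a b (fun h => ha (h ▸ w.done'_of_𝓑 hb)) q u hqa hqb hua ⟨_, rfl⟩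
    have e4 := s.t.tri p q u
    have := s.t.symm p q
    omega

theorem overlap' {a : ι} (ha : ¬ w.Done' a) {x y : V} (hx : x ∈ Set.range (s.l a))
    (hy : y ∈ Set.range (s.l a)) (hxW : x ∈ w.W') (hyW : y ∈ w.W') : s.t.d x y ≤ 2 * s.E := by
  -- choose the minimal pair
  obtain ⟨n, ⟨⟨q, p, g, hg, hq, hp, hn⟩, hmin⟩⟩ := exists_minimal_of_wellFoundedLT
    (fun n : ℕ => ∃ q p g, g ∈ w.M' ∧ s.t.Btw x q y ∧ p ∈ w.W ∧ s.t.d q (g • p) = n)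
    ⟨(s.t.d x v).toNat, x, v, 1, one_mem _, s.t.btw_left x y, w.base, by
      have := s.t.nonneg x v; rw [one_smul]; omega⟩
  have hmin' : ∀ q' p' g', g' ∈ w.M' → s.t.Btw x q' y → p' ∈ w.W →
      s.t.d q (g • p) ≤ s.t.d q' (g' • p') := by
    intro q' p' g' hg' hq' hp'
    have h0 := s.t.nonneg q' (g' • p')
    by_contra hlt
    have := hmin (y := (s.t.d q' (g' • p')).toNat) ⟨q', p', g', hg', hq', hp', by omega⟩ (by omega)
    omega
  have hgi := inv_mem hg
  have ha' : ¬ w.Done' (g⁻¹ • a) := fun h => ha (by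
    have := w.Done'_smul hg h; rwa [smul_inv_smul] at this)
  have hx' := s.mem_smul g⁻¹ hx
  have hy' := s.mem_smul g⁻¹ hy
  have hxW' := w.W'_smul hgi hxW
  have hyW' := w.W'_smul hgi hyW
  have hq' := s.btw_smul g⁻¹ hq
  have hm : ∀ q' p' g', g' ∈ w.M' → s.t.Btw (g⁻¹ • x) q' (g⁻¹ • y) → p' ∈ w.W →
      s.t.d (g⁻¹ • q) p ≤ s.t.d q' (g' • p') := by
    intro q' p' g' hg' hq' hp'
    have h1 := hmin' (g • q') p' (g * g') (mul_mem hg hg') (by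
      have := s.btw_smul g hq'; rwa [smul_inv_smul, smul_inv_smul] at this) hp'
    rw [mul_smul, s.isom] at h1
    have := s.isom' g⁻¹ q p
    rw [inv_inv] at this
    omega
  have h1 := w.overlap_aux ha' hx' hy' hxW' hq' hp hm
  have h2 := w.overlap_aux ha' hy' hx' hyW' hq'.symm hp
    (fun q' p' g' hg' hq' hp' => hm q' p' g' hg' hq'.symm hp')
  rw [s.isom] at h1 h2
  have := s.t.tri x q y
  have := s.t.symm x q
  omega

def W1 : Set V := {x | ∃ y ∈ w.W', s.t.d x y ≤ 1}

theorem sub_W1 : w.W' ⊆ w.W1 := fun x hx => ⟨x, hx, by rw [s.t.self]; omega⟩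

theorem W1_conv : s.t.Convex w.W1 := by
  apply s.t.convex_of_star v
  rintro x ⟨y, hy, hxy⟩ z hz
  rcases hz.split y with h | h
  · exact w.sub_W1 (w.W'_conv _ (w.W_sub w.base) _ hy _ h)
  · refine ⟨y, hy, ?_⟩
    unfold TreeMetric.Btw at h
    have := s.t.nonneg z x
    have := s.t.symm x y
    have := s.t.symm z y
    omega

/-- the next windmill -/
def next : s.Windmill v where
  W := w.W1
  M := w.M'
  conv := w.W1_conv
  base := w.sub_W1 (w.W_sub w.base)
  inv := by
    rintro m hm x ⟨y, hy, hxy⟩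
    exact ⟨m • y, w.W'_smul hm hy, by rw [s.isom]; exact hxy⟩
  lines := by
    intro a
    by_cases ha : w.Done' a
    · exact Or.inl ⟨ha.1.trans w.sub_W1, ha.2⟩
    · right
      rintro x y hx hy ⟨x', hx', hxx'⟩ ⟨y', hy', hyy'⟩
      have hE := s.hE
      by_contra hlt
      unfold D at hlt
      obtain ⟨x1, h1, h2⟩ := s.t.interp x y 1 (by omega) (by omega)
      obtain ⟨y1, h3, h4⟩ := s.t.interp x y (s.t.d x y - 1) (by omega) (by omega)
      have bx : s.t.Btw x x1 y := by unfold TreeMetric.Btw; omega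
      have by' : s.t.Btw x y1 y := by unfold TreeMetric.Btw; omega
      have key : ∀ z, s.t.Btw x z y → 1 ≤ s.t.d x z → 1 ≤ s.t.d z y → z ∈ w.W' := by
        intro z hz hz1 hz2
        apply w.W'_conv x' hx' y' hy'
        rcases hz.split x' with h5 | h5
        · -- z on [x,x'], then z = x'
          have : z = x' := by
            unfold TreeMetric.Btw at h5
            have := s.t.nonneg z x'
            exact s.t.eq_of _ _ (by omega)
          rw [this]; exact s.t.btw_left _ _
        · rcases h5.split y' with h6 | h6
          · exact h6
          · have : z = y' := by
              unfold TreeMetric.Btw at h6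
              have := s.t.nonneg y' z
              have := s.t.symm y y'
              exact (s.t.eq_of _ _ (by omega)).symm
            rw [this]; exact s.t.btw_right _ _
      have hx1 := key x1 bx (by omega) (by omega)
      have hy1 := key y1 by' (by omega) (by omega)
      have := w.overlap' ha (s.line_convex a x hx y hy _ bx) (s.line_convex a x hx y hy _ by') hx1 hy1
      have := s.t.tri x x1 y
      have := s.t.tri x1 y1 y
      omega
  green := by
    intro m hm hm1
    obtain ⟨o, h⟩ := w.exists_NF hm
    have hE := s.hE
    have h0 : ∀ m ∈ w.M, ∀ b ∈ w.𝓑, s.disp b (m • v) v ≤ s.E + s.D := fun m hm b hb => by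
      have := w.pr_W hb (w.inv m hm v w.base) w.base; omega
    have hf := h.far h0
    cases h with
    | base m hm => exact w.green m hm hm1
    | step o g b k h ho hb hk =>
      refine ⟨b, ?_⟩
      have := hf.2 b hb rfl
      unfold disp at *
      omega

end Windmill

variable {P V ι : Type*} [Group P] [MulAction P V] [MulAction P ι] {s : SC P V ι}

def start (v : V) : s.Windmill v where
  W := {v}
  M := ⊥
  conv := by
    rintro x hx y hy z hz
    rw [Set.mem_singleton_iff] at *
    subst hx; subst hy
    exact s.t.btw_self hz
  base := rfl
  inv := by
    intro m hm x hx
    rw [Subgroup.mem_bot] at hm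
    simpa [hm] using hx
  lines := by
    intro a
    right
    intro x y _ _ hx hy
    rw [Set.mem_singleton_iff] at *
    subst hx; subst hy
    rw [s.t.self]
    have := s.hE
    unfold D; omega
  green := by
    intro m hm h
    exact absurd (Subgroup.mem_bot.1 hm) h

variable (s)
def stage (v : V) : ℕ → s.Windmill v
  | 0 => start v
  | n + 1 => (stage v n).next

theorem ball_stage (v : V) (n : ℕ) : ∀ x, s.t.d v x ≤ n → x ∈ (s.stage v n).W := by
  induction n with
  | zero =>
    intro x hx
    have := s.t.nonneg v x
    exact (s.t.eq_of _ _ (by push_cast at hx; omega)).symm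
  | succ n ih =>
    intro x hx
    by_cases h : s.t.d v x ≤ n
    · exact Windmill.sub_W1 _ (Windmill.W_sub _ (ih x h))
    · obtain ⟨z, h1, h2⟩ := s.t.interp v x n (by omega) (by omega)
      refine ⟨z, Windmill.W_sub _ (ih z h1.le), ?_⟩
      rw [s.t.symm]; push_cast at hx; omega

theorem stage_mono (v : V) : Monotone fun n => (s.stage v n).M :=
  monotone_nat_of_le_succ fun n => Windmill.M_le _

theorem r_mem_stage (v : V) (a : ι) : ∃ n, s.r a ∈ (s.stage v n).M := by
  set n := (s.t.d v (s.l a 0)).toNat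
  have h : s.l a 0 ∈ (s.stage v n).W := s.ball_stage v n _ (by omega)
  refine ⟨n + 1, ?_⟩
  have := (s.stage v n).done'_of_meets (a := a) (one_mem _) ⟨0, rfl⟩ (by simpa using h)
  exact this.2

/-- the subgroup generated by relators -/
def N : Subgroup P := Subgroup.closure (Set.range s.r)

instance N_normal : s.N.Normal := by
  constructor
  intro n hn g
  induction hn using Subgroup.closure_induction with
  | mem x hx =>
    obtain ⟨a, rfl⟩ := hx
    rw [← s.conj]
    exact Subgroup.subset_closure ⟨_, rfl⟩
  | one => simp
  | mul x y _ _ hx hy =>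
    have : g * (x * y) * g⁻¹ = (g * x * g⁻¹) * (g * y * g⁻¹) := by group
    rw [this]; exact mul_mem hx hy
  | inv x _ hx =>
    have : g * x⁻¹ * g⁻¹ = (g * x * g⁻¹)⁻¹ := by group
    rw [this]; exact inv_mem hx

theorem greendlinger (v : V) {n : P} (hn : n ∈ s.N) (h1 : n ≠ 1) :
    ∃ a, s.R - 3 * s.E - 2 ≤ s.disp a v (n • v) := by
  have : ∃ k, n ∈ (s.stage v k).M := by
    have : s.N ≤ ⨆ k, (s.stage v k).M := by
      rw [N, Subgroup.closure_le]
      rintro _ ⟨a, rfl⟩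
      obtain ⟨k, hk⟩ := s.r_mem_stage v a
      exact Subgroup.mem_iSup_of_mem k hk
    exact (Subgroup.mem_iSup_of_directed (s.stage_mono v).directed_le).1 (this hn)
  obtain ⟨k, hk⟩ := this
  obtain ⟨a, ha⟩ := (s.stage v k).green n hk h1
  exact ⟨a, by unfold D at ha; omega⟩

end SC
end JG

namespace JG
namespace SC
variable {P V ι : Type*} [Group P] [MulAction P V] [MulAction P ι] (s : SC P V ι)

theorem disp_le (a : ι) (x y : V) : s.disp a x y ≤ s.t.d x y := by
  unfold disp
  by_cases h : s.pr a x = s.pr a y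
  · have := s.t.nonneg x y; omega
  · have := s.pr_dist a x y h
    have := s.ht_nonneg a x
    have := s.ht_nonneg a y
    omega

theorem eq_one_of_small {v : V} {n : P} (hn : n ∈ s.N) (h : s.t.d v (n • v) < s.R - 3 * s.E - 2) :
    n = 1 := by
  by_contra h1
  obtain ⟨a, ha⟩ := s.greendlinger v hn h1
  have := s.disp_le a v (n • v)
  omega

theorem eq_one_of_fix {v : V} {n : P} (hn : n ∈ s.N) (h : n • v = v) : n = 1 := by
  apply s.eq_one_of_small (v := v) hn
  rw [h, s.t.self]
  have := s.hE
  have := s.hR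
  omega

theorem r_mem_N (a : ι) : s.r a ∈ s.N := Subgroup.subset_closure ⟨a, rfl⟩

/-- shortening by a relator -/
theorem shorten (a : ι) {p x y u : V} (hx : x ∈ Set.range (s.l a)) (hy : y ∈ Set.range (s.l a))
    (hd : s.t.d p u = s.t.d p x + s.t.d x y + s.t.d y u) (h1 : s.R < 2 * s.t.d x y)
    (h2 : s.t.d x y ≤ s.R) : ∃ k : ℤ, s.t.d p (s.r a ^ k • u) < s.t.d p u := by
  obtain ⟨i, rfl⟩ := hx
  obtain ⟨j, rfl⟩ := hy
  have key : ∀ k : ℤ, s.t.d p (s.r a ^ k • u) ≤ s.t.d p (s.l a i) +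
      s.t.d (s.l a i) (s.l a (j + k * s.R)) + s.t.d (s.l a j) u := by
    intro k
    have e1 := s.t.tri p (s.l a i) (s.r a ^ k • u)
    have e2 := s.t.tri (s.l a i) (s.l a (j + k * s.R)) (s.r a ^ k • u)
    rw [← s.zpow_trans, s.isom, s.zpow_trans] at e2
    omega
  rw [s.line] at *
  rcases le_total i j with h | h
  · refine ⟨-1, ?_⟩
    have := key (-1)
    rw [s.line] at this
    omega
  · refine ⟨1, ?_⟩
    have := key 1
    rw [s.line] at this
    omega

/-- positions on a geodesic -/
theorem pos_eq {v u x y : V} (hx : s.t.Btw v x u) (hy : s.t.Btw v y u) (h : s.t.d v x ≤ s.t.d v y) :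
    s.t.d x y = s.t.d v y - s.t.d v x := by
  unfold TreeMetric.Btw at *
  have := s.t.four v u x y
  have := s.t.tri v x y
  have := s.t.symm u y
  have := s.t.symm u x
  omega

theorem exists_pos (v u : V) (k : ℤ) (h0 : 0 ≤ k) (h1 : k ≤ s.t.d v u) :
    ∃ x, s.t.Btw v x u ∧ s.t.d v x = k := by
  obtain ⟨x, h2, h3⟩ := s.t.interp v u k h0 h1
  exact ⟨x, by unfold TreeMetric.Btw; omega, h2⟩

/-- a long line along a segment, with endpoints -/
theorem long_seg {v u : V} {a : ι} (h : s.R - 3 * s.E - 2 ≤ s.disp a v u) :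
    ∃ x y, x ∈ Set.range (s.l a) ∧ y ∈ Set.range (s.l a) ∧ s.t.Btw v x u ∧ s.t.Btw v y u ∧
      s.t.d v x + (s.R - 3 * s.E - 2) ≤ s.t.d v y := by
  have hR := s.hR
  have hE := s.hE
  have hne : s.pr a v ≠ s.pr a u := by
    intro h'; unfold disp at h; rw [h'] at h; omega
  refine ⟨_, _, ⟨s.pr a v, rfl⟩, ⟨s.pr a u, rfl⟩, s.btw_pr2 a v u hne, (s.btw_pr2 a u v hne.symm).symm, ?_⟩
  rw [s.pr_spec, s.pr_spec]
  unfold disp at h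
  omega

/-- segments between points on a line are on the line -/
theorem mem_seg {v u x y z : V} {a : ι} (hx : x ∈ Set.range (s.l a)) (hy : y ∈ Set.range (s.l a))
    (hxv : s.t.Btw v x u) (hyv : s.t.Btw v y u) (hzv : s.t.Btw v z u)
    (h1 : s.t.d v x ≤ s.t.d v z) (h2 : s.t.d v z ≤ s.t.d v y) : z ∈ Set.range (s.l a) := by
  apply s.line_convex a x hx y hy
  have e1 := s.pos_eq hxv hzv h1
  have e2 := s.pos_eq hzv hyv h2
  have e3 := s.pos_eq hxv hyv (h1.trans h2)
  unfold TreeMetric.Btw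
  omega

theorem axis_dist {y : P} {v : V} {τ : ℤ} (h1 : s.t.d v (y • v) = τ) (hτ : 0 < τ)
    (h2 : s.t.d v (y • y • v) = 2 * τ) (k : ℕ) : s.t.d v (y ^ k • v) = k * τ ∧
      s.t.d v (y ^ (k+1) • v) = (k + 1) * τ := by
  induction k with
  | zero => simp [s.t.self, h1]
  | succ k ih =>
    refine ⟨by push_cast; exact ih.2, ?_⟩
    have e1 : y ^ (k + 1) • v = y ^ k • y • v := by rw [pow_succ, mul_smul]
    have e2 : y ^ (k + 1 + 1) • v = y ^ k • y • y • v := by rw [pow_succ, pow_succ, mul_smul, mul_smul]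
    have f1 := s.isom (y ^ k) v (y • v)
    have f2 := s.isom (y ^ k) (y • v) (y • y • v)
    have f3 := s.isom (y ^ k) v (y • y • v)
    rw [s.isom y] at f2
    rw [← e1] at f1 f2
    rw [← e2] at f2 f3
    have g1 := s.t.four v (y ^ (k + 1) • v) (y ^ k • v) (y ^ (k + 1 + 1) • v)
    have g2 := s.t.tri v (y ^ (k+1) • v) (y ^ (k + 1 + 1) • v)
    have g3 := s.t.symm (y ^ (k+1) • v) (y ^ k • v)
    have i1 := ih.1
    have i2 := ih.2
    push_cast
    have : (k + 1 + 1 : ℤ) * τ = k * τ + 2 * τ := by ring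
    have : (k + 1 : ℤ) * τ = k * τ + τ := by ring
    omega

theorem torsionfree [Nonempty V] (even : ∀ (p : P) v, s.t.d v (p • v) % 2 = 0)
    (stab : ∀ (p : P) a, p • a = a → p ∈ Subgroup.zpowers (s.r a))
    (tf : ∀ (p : P) (v : V), p • v = v → ∀ m : ℕ, 0 < m → p ^ m = 1 → p = 1)
    (x : P) (m : ℕ) (hm : 0 < m) (hx : x ^ m ∈ s.N) : x ∈ s.N := by
  have hE := s.hE
  have hR := s.hR
  obtain ⟨n, ⟨⟨y, v, hy, hn⟩, hmin⟩⟩ := exists_minimal_of_wellFoundedLT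
    (fun n : ℕ => ∃ (y : P) (v : V), x⁻¹ * y ∈ s.N ∧ s.t.d v (y • v) = n)
    ⟨(s.t.d (Classical.arbitrary V) (x • Classical.arbitrary V)).toNat, x, Classical.arbitrary V,
      by simp, by have := s.t.nonneg (Classical.arbitrary V) (x • Classical.arbitrary V); omega⟩
  have hmin' : ∀ (y' : P) (v' : V), x⁻¹ * y' ∈ s.N → s.t.d v (y • v) ≤ s.t.d v' (y' • v') := by
    intro y' v' hy'
    have h0 := s.t.nonneg v' (y' • v')
    by_contra hlt
    have := hmin (y := (s.t.d v' (y' • v')).toNat) ⟨y', v', hy', by omega⟩ (by omega)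
    omega
  have hym : y ^ m ∈ s.N := by
    rw [← QuotientGroup.eq_one_iff] at hx ⊢
    have : (x : P ⧸ s.N) = y := QuotientGroup.eq.2 hy
    rw [QuotientGroup.mk_pow, ← this, ← QuotientGroup.mk_pow, hx]
  suffices hyN : y ∈ s.N by
    have := mul_mem hyN (inv_mem hy)
    simpa using this
  by_cases hτ0 : s.t.d v (y • v) = 0
  · have hv := (s.t.eq_of _ _ hτ0).symm
    have h1 : y ^ m • v = v := by
      clear hym hx hm
      induction m with
      | zero => simp
      | succ m ih => rw [pow_succ, mul_smul, hv, ih]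
    have := tf y v hv m hm (s.eq_one_of_fix hym h1)
    rw [this]; exact one_mem _
  have hτn := s.t.nonneg v (y • v)
  set τ := s.t.d v (y • v) with hτ
  have heven := even y v
  -- d(v,y²v) = 2τ
  have h2 : s.t.d v (y • y • v) = 2 * τ := by
    by_contra hne
    have t1 := s.t.tri v (y • v) (y • y • v)
    have i1 := s.isom y v (y • v)
    have hp := s.t.parity v (y • v) (y • y • v)
    obtain ⟨z', hz1, hz2⟩ := s.t.interp v (y • v) 1 (by omega) (by omega)
    obtain ⟨z, hz3, hz4⟩ := s.t.interp (y • v) v 1 (by omega) (by rw [s.t.symm]; omega)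
    have i2 := s.isom y v z'
    have i3 := s.isom y z' (y • v)
    have e : z = y • z' := by
      obtain ⟨w, hw1, hw2, hw3⟩ := s.t.median (y • v) v (y • y • v)
      have b1 : s.t.Btw (y • v) z v := by
        unfold TreeMetric.Btw; have := s.t.symm (y • v) v; omega
      have b2 : s.t.Btw (y • v) (y • z') (y • y • v) := by
        unfold TreeMetric.Btw; omega
      have hw : 1 ≤ s.t.d (y • v) w := by
        unfold TreeMetric.Btw at hw1 hw2 hw3
        have := s.t.symm (y • v) v
        have := s.t.symm v w
        omega
      have q1 := s.pos_eq b1 hw1 (by omega)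
      have q2 := s.pos_eq b2 hw3 (by omega)
      have g1 : s.t.Btw (y • v) z w := by unfold TreeMetric.Btw; omega
      have g2 : s.t.Btw (y • v) (y • z') w := by unfold TreeMetric.Btw; omega
      exact s.t.btw_unique g1 g2 (by omega)
    have h3 := hmin' y z' hy
    rw [← e] at h3
    have hc : s.t.d z' z = τ - 2 := by
      have b1 : s.t.Btw v z' (y • v) := by unfold TreeMetric.Btw; omega
      have b2 : s.t.Btw v z (y • v) := by
        unfold TreeMetric.Btw
        have := s.t.symm v z
        have := s.t.symm z (y • v)
        have := s.t.symm v (y • v)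
        omega
      have := s.t.symm v z
      have := s.t.symm v (y • v)
      have := s.pos_eq b1 b2 (by omega)
      omega
    omega
  have hax := s.axis_dist (y := y) (v := v) (τ := τ) hτ.symm (by omega) h2 m
  have hmτ : τ ≤ m * τ := by
    have : (1 : ℤ) ≤ m := by exact_mod_cast hm
    nlinarith
  have hne1 : y ^ m ≠ 1 := by
    intro h
    have := hax.1
    rw [h, one_smul, s.t.self] at this
    omega
  obtain ⟨a, ha⟩ := s.greendlinger v hym hne1
  obtain ⟨p, q, hpa, hqa, hpb, hqb, hpq⟩ := s.long_seg ha
  set Γ := y ^ (m + 1) • v with hΓ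
  have hΓ2 : Γ = y ^ m • y • v := by rw [hΓ, pow_succ, mul_smul]
  have hΓ3 : Γ = y • y ^ m • v := by rw [hΓ, pow_succ', mul_smul]
  have hmid : s.t.Btw v (y ^ m • v) Γ := by
    unfold TreeMetric.Btw
    rw [hΓ2, s.isom, ← hΓ2, hax.1, hax.2]; ring
  have hmid' : s.t.Btw v (y • v) Γ := by
    unfold TreeMetric.Btw
    have := s.isom y v (y ^ m • v)
    rw [← hΓ3, hax.1] at this
    have h' := hax.2
    have : (m + 1 : ℤ) * τ = m * τ + τ := by ring
    omega
  have lift : ∀ z, s.t.Btw v z (y ^ m • v) → s.t.Btw v z Γ ∧ s.t.Btw v (y • z) Γ ∧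
      s.t.d v (y • z) = s.t.d v z + τ := by
    intro z hz
    refine ⟨(hmid.trans hz).1, ?_⟩
    have h1 := s.btw_smul y hz
    rw [← hΓ3] at h1
    have h3 := s.t.tri v (y • v) (y • z)
    have h4 := s.t.tri v (y • z) Γ
    have h5 := s.isom y v z
    unfold TreeMetric.Btw at *
    omega
  obtain ⟨lp1, lp2, lp3⟩ := lift p hpb
  obtain ⟨lq1, lq2, lq3⟩ := lift q hqb
  have hpn := s.t.nonneg v p
  by_cases hc : τ < s.R - 4 * s.E - 2
  · -- y a = a
    obtain ⟨q', hq'1, hq'2⟩ := s.exists_pos v (y ^ m • v) (s.t.d v q - τ) (by omega) (by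
      unfold TreeMetric.Btw at hqb
      have := s.t.nonneg q (y ^ m • v)
      omega)
    obtain ⟨l1, l2, l3⟩ := lift q' hq'1
    have e : y • q' = q := s.t.btw_unique l2 lq1 (by omega)
    have hq'a : q' ∈ Set.range (s.l a) := s.mem_seg hpa hqa lp1 lq1 l1 (by omega) (by omega)
    have hypa : y • p ∈ Set.range (s.l a) := s.mem_seg hpa hqa lp1 lq1 lp2 (by omega) (by omega)
    have hya : y • a = a := by
      by_contra hne
      have := s.ov _ _ hne (y • p) q (s.mem_smul y hpa) hypa (e ▸ s.mem_smul y hq'a) hqa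
      have := s.pos_eq lp2 lq1 (by omega)
      omega
    obtain ⟨k, hk⟩ := Subgroup.mem_zpowers_iff.1 (stab y a hya)
    rw [← hk]
    exact zpow_mem (s.r_mem_N a) k
  · exfalso
    obtain ⟨q', hq'1, hq'2⟩ := s.exists_pos v Γ (s.t.d v p + (s.R - 4 * s.E - 2)) (by omega) (by
      unfold TreeMetric.Btw at lq1
      have := s.t.nonneg q Γ
      omega)
    have hq'a : q' ∈ Set.range (s.l a) := s.mem_seg hpa hqa lp1 lq1 hq'1 (by omega) (by omega)
    have d1 := s.pos_eq lp1 hq'1 (by omega)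
    have d2 := s.pos_eq hq'1 lp2 (by omega)
    have d3 := s.pos_eq lp1 lp2 (by omega)
    have d4 := s.t.self p
    obtain ⟨k, hk⟩ := s.shorten a (p := p) (u := y • p) hpa hq'a (by omega) (by omega) (by omega)
    rw [← mul_smul] at hk
    have := hmin' (s.r a ^ k * y) p (by
      have h1 : x⁻¹ * (s.r a ^ k * y) = (x⁻¹ * s.r a ^ k * x⁻¹⁻¹) * (x⁻¹ * y) := by group
      rw [h1]
      exact mul_mem (s.N_normal.conj_mem _ (zpow_mem (s.r_mem_N a) k) _) hy)
    omega

theorem malnormal (v₀ : V)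
    (stab : ∀ (p : P) a, p • a = a → p ∈ Subgroup.zpowers (s.r a))
    (mal : ∀ p x : P, p • v₀ = v₀ → p • x • v₀ = x • v₀ → x • v₀ ≠ v₀ → p = 1)
    (x b b' : P) (hb : b • v₀ = v₀) (hb' : b' • v₀ = v₀) (hb1 : b ≠ 1)
    (hx : x * b * x⁻¹ * b'⁻¹ ∈ s.N) : ∃ n ∈ s.N, (x * n) • v₀ = v₀ := by
  have hE := s.hE
  have hR := s.hR
  obtain ⟨k, ⟨⟨n, hn, hk⟩, hmin⟩⟩ := exists_minimal_of_wellFoundedLT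
    (fun k : ℕ => ∃ n ∈ s.N, s.t.d v₀ ((x * n) • v₀) = k)
    ⟨(s.t.d v₀ (x • v₀)).toNat, 1, one_mem _, by
      have := s.t.nonneg v₀ (x • v₀); rw [mul_one]; omega⟩
  refine ⟨n, hn, ?_⟩
  have hmin' : ∀ n' ∈ s.N, s.t.d v₀ ((x * n) • v₀) ≤ s.t.d v₀ ((x * n') • v₀) := by
    intro n' hn'
    have h0 := s.t.nonneg v₀ ((x * n') • v₀)
    by_contra hlt
    have := hmin (y := (s.t.d v₀ ((x * n') • v₀)).toNat) ⟨n', hn', by omega⟩ (by omega)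
    omega
  by_contra hne
  set X := x * n with hX
  set u := X • v₀ with hu
  set y := X * b * X⁻¹ with hy
  have hyu : y • u = u := by rw [hy, hu, ← mul_smul]; simp [mul_smul, hb]
  have hyN : y * b'⁻¹ ∈ s.N := by
    have : y * b'⁻¹ = (x * (n * (b * n⁻¹ * b⁻¹)) * x⁻¹) * (x * b * x⁻¹ * b'⁻¹) := by
      rw [hy, hX]; group
    rw [this]
    exact mul_mem (s.N_normal.conj_mem _ (mul_mem hn (s.N_normal.conj_mem _ (inv_mem hn) _)) _) hx
  have hyv : (y * b'⁻¹) • v₀ = y • v₀ := by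
    rw [mul_smul, inv_smul_eq_iff.2 hb'.symm]
  have hy1 : y ≠ 1 := by
    intro h
    apply hb1
    rw [hy] at h
    have := congrArg (fun g => X⁻¹ * g * X) h
    simpa [mul_assoc] using this
  have hne1 : y * b'⁻¹ ≠ 1 := by
    intro h
    have h' : y = b' := mul_inv_eq_one.1 h
    exact hy1 (mal y X (h' ▸ hb') hyu hne)
  obtain ⟨a, ha⟩ := s.greendlinger v₀ hyN hne1
  rw [hyv] at ha
  obtain ⟨p, q, hpa, hqa, hpb, hqb, hpq⟩ := s.long_seg ha
  obtain ⟨z, hz1, hz2, hz3⟩ := s.t.median u v₀ (y • v₀)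
  -- hz1 : Btw u z v₀ ; hz2 : Btw v₀ z (y v₀); hz3 : Btw u z (y v₀)
  have hyz : y • z = z := by
    have h1 := s.btw_smul y hz1
    rw [hyu] at h1
    have h2 := s.isom y u z
    rw [hyu] at h2
    exact s.t.btw_unique h1 hz3 h2
  have hze : s.t.d z (y • v₀) = s.t.d v₀ z := by
    have := s.isom y z v₀
    rw [hyz] at this
    have := s.t.symm v₀ z
    omega
  have huv : s.t.d u (y • v₀) = s.t.d u v₀ := by
    have := s.isom y u v₀; rwa [hyu] at this
  have htot : s.t.d v₀ (y • v₀) = 2 * s.t.d v₀ z := by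
    unfold TreeMetric.Btw at hz2; omega
  have hp0 := s.t.nonneg v₀ p
  have hq0 : s.t.d v₀ q ≤ s.t.d v₀ (y • v₀) := by
    unfold TreeMetric.Btw at hqb; have := s.t.nonneg q (y • v₀); omega
  have hsuv := s.t.symm u v₀
  have hszu := s.t.symm u z
  have hszv := s.t.symm v₀ z
  by_cases c2 : s.t.d v₀ q - s.t.d v₀ z ≤ s.E
  · -- shorten on the v₀ side
    obtain ⟨q', hq'1, hq'2⟩ := s.exists_pos v₀ (y • v₀) (s.t.d v₀ p + (s.R - 4 * s.E - 2)) (by omega) (by omega)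
    have hq'a : q' ∈ Set.range (s.l a) := s.mem_seg hpa hqa hpb hqb hq'1 (by omega) (by omega)
    have d1 := s.pos_eq hpb hq'1 (by omega)
    have d2 := s.pos_eq hq'1 hz2 (by omega)
    have d3 := s.pos_eq hpb hz2 (by omega)
    have d4 : s.t.d q' u = s.t.d q' z + s.t.d z u := by
      have := s.t.tri q' z u
      have := s.t.tri v₀ q' u
      unfold TreeMetric.Btw at hz1
      omega
    unfold TreeMetric.Btw at hz1
    obtain ⟨k, hk⟩ := s.shorten a (p := v₀) (u := u) hpa hq'a (by omega) (by omega) (by omega)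
    have := hmin' (n * (X⁻¹ * s.r a ^ k * X⁻¹⁻¹))
      (mul_mem hn (s.N_normal.conj_mem _ (zpow_mem (s.r_mem_N a) k) _))
    have e : x * (n * (X⁻¹ * s.r a ^ k * X⁻¹⁻¹)) = s.r a ^ k * X := by rw [hX]; group
    rw [e, mul_smul, ← hu] at this
    omega
  by_cases c1 : s.t.d v₀ z - s.t.d v₀ p ≤ s.E
  · obtain ⟨p', hp'1, hp'2⟩ := s.exists_pos v₀ (y • v₀) (s.t.d v₀ q - (s.R - 4 * s.E - 2)) (by omega) (by omega)
    have hp'a : p' ∈ Set.range (s.l a) := s.mem_seg hpa hqa hpb hqb hp'1 (by omega) (by omega)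
    have d1 := s.pos_eq hp'1 hqb (by omega)
    have d2 := s.pos_eq hz2 hp'1 (by omega)
    have d3 := s.pos_eq hz2 hqb (by omega)
    have d5 : s.t.d q (y • v₀) = s.t.d v₀ (y • v₀) - s.t.d v₀ q := by
      unfold TreeMetric.Btw at hqb; omega
    have s1 := s.t.symm p' q
    have s2 := s.t.symm (y • v₀) q
    have s3 := s.t.symm p' z
    have s4 := s.t.symm p' u
    have s5 := s.t.symm (y • v₀) u
    have s6 := s.t.symm (y • v₀) p'
    have d4 : s.t.d p' u = s.t.d p' z + s.t.d z u := by
      have := s.t.tri p' z u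
      have := s.t.tri u p' (y • v₀)
      unfold TreeMetric.Btw at hz3 hp'1
      omega
    unfold TreeMetric.Btw at hz3
    obtain ⟨k, hk⟩ := s.shorten a (p := y • v₀) (u := u) hqa hp'a (by omega) (by omega) (by omega)
    have := hmin' (n * ((b⁻¹ * (X⁻¹ * s.r a ^ k * X⁻¹⁻¹) * b⁻¹⁻¹)))
      (mul_mem hn (s.N_normal.conj_mem _ (s.N_normal.conj_mem _ (zpow_mem (s.r_mem_N a) k) _) _))
    have e : x * (n * (b⁻¹ * (X⁻¹ * s.r a ^ k * X⁻¹⁻¹) * b⁻¹⁻¹)) = y⁻¹ * (s.r a ^ k * (X * b)) := by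
      rw [hy, hX]; group
    rw [e, mul_smul, mul_smul, mul_smul, hb, ← hu] at this
    have e2 := s.isom y v₀ (y⁻¹ • s.r a ^ k • u)
    rw [smul_inv_smul] at e2
    omega
  · -- reflection
    obtain ⟨f, hf, hfE⟩ : ∃ f : ℤ, f = min (s.t.d v₀ z - s.t.d v₀ p) (s.t.d v₀ q - s.t.d v₀ z) ∧ s.E < f :=
      ⟨_, rfl, by omega⟩
    obtain ⟨p1, hp1, hp1'⟩ := s.exists_pos v₀ (y • v₀) (s.t.d v₀ z - f) (by omega) (by omega)
    obtain ⟨p2, hp2, hp2'⟩ := s.exists_pos v₀ (y • v₀) (s.t.d v₀ z + f) (by omega) (by omega)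
    have hp1a : p1 ∈ Set.range (s.l a) := s.mem_seg hpa hqa hpb hqb hp1 (by omega) (by omega)
    have hp2a : p2 ∈ Set.range (s.l a) := s.mem_seg hpa hqa hpb hqb hp2 (by omega) (by omega)
    have hza : z ∈ Set.range (s.l a) := s.mem_seg hpa hqa hpb hqb hz2 (by omega) (by omega)
    have d1 := s.pos_eq hp1 hz2 (by omega)
    have d2 := s.pos_eq hz2 hp2 (by omega)
    have e : y • p1 = p2 := by
      have b1 : s.t.Btw z (y • p1) (y • v₀) := by
        have : s.t.Btw z p1 v₀ := by
          unfold TreeMetric.Btw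
          have := s.t.symm z p1
          have := s.t.symm v₀ p1
          omega
        have := s.btw_smul y this
        rwa [hyz] at this
      have b2 : s.t.Btw z p2 (y • v₀) := by
        unfold TreeMetric.Btw at *
        omega
      apply s.t.btw_unique b1 b2
      have := s.isom y z p1
      rw [hyz] at this
      have := s.t.symm z p1
      omega
    have hya : y • a = a := by
      by_contra hne
      have := s.ov _ _ hne z p2 (hyz ▸ s.mem_smul y hza) hza (e ▸ s.mem_smul y hp1a) hp2a
      omega
    obtain ⟨k, hk⟩ := Subgroup.mem_zpowers_iff.1 (stab y a hya)
    obtain ⟨i, hi⟩ := hza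
    have h1 : s.l a (i + k * s.R) = s.l a i := by
      rw [← s.zpow_trans, hk, hi, hyz]
    have h2 := s.line a (i + k * s.R) i
    rw [h1, s.t.self] at h2
    have h3 : k * s.R = 0 := by omega
    have h4 : k = 0 := by
      rcases mul_eq_zero.1 h3 with h | h
      · exact h
      · omega
    rw [h4, zpow_zero] at hk
    exact hy1 hk.symm

end SC
end JG

namespace JG

/-- combinatorial tree presented by distance functions to all base points -/
structure CTree (V : Type*) where
  Adj : V → V → Prop
  sym : ∀ v w, Adj v w → Adj w v
  F : V → V → ℕ
  z : ∀ x v, F x v = 0 ↔ v = x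
  a : ∀ x v w, Adj v w → F x v = F x w + 1 ∨ F x w = F x v + 1
  l : ∀ x v, v ≠ x → ∃ w, Adj v w ∧ F x v = F x w + 1
  u : ∀ x v w w', Adj v w → Adj v w' → F x v = F x w + 1 → F x v = F x w' + 1 → w = w'

theorem level_unique {V : Type*} (Adj : V → V → Prop) (x : V) (F F' : V → ℕ)
    (hz : F x = 0) (ha : ∀ v w, Adj v w → F v = F w + 1 ∨ F w = F v + 1)
    (hz' : ∀ v, F' v = 0 → v = x) (hl : ∀ v, v ≠ x → ∃ w, Adj v w ∧ F' v = F' w + 1) (v : V) :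
    F v ≤ F' v := by
  generalize hn : F' v = n
  induction n generalizing v with
  | zero => rw [hz' v hn, hz]
  | succ n ih =>
    by_cases hv : v = x
    · rw [hv, hz]; omega
    obtain ⟨w, h1, h2⟩ := hl v hv
    have := ih w (by omega)
    have := ha v w h1
    omega

namespace CTree
variable {V : Type*} (T : CTree V)

theorem self (x : V) : T.F x x = 0 := (T.z x x).2 rfl

theorem tri (x y z : V) : T.F x z ≤ T.F x y + T.F y z := by
  generalize hn : T.F y z = n
  induction n generalizing z with
  | zero => rw [(T.z y z).1 hn]; omega
  | succ n ih =>
    have hv : z ≠ y := by rintro rfl; have := T.self z; omega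
    obtain ⟨w, h1, h2⟩ := T.l y z hv
    have := ih w (by omega)
    have := T.a x z w h1
    omega

theorem adj1 {x y : V} (h : T.Adj x y) : T.F x y = 1 := by
  have := T.a x x y h
  have := T.self x
  omega

theorem symm_le (x y : V) : T.F y x ≤ T.F x y := by
  generalize hn : T.F x y = n
  induction n generalizing y with
  | zero => rw [(T.z x y).1 hn, T.self]
  | succ n ih =>
    have hv : y ≠ x := by rintro rfl; have := T.self y; omega
    obtain ⟨w, h1, h2⟩ := T.l x y hv
    have := ih w (by omega)
    have := T.adj1 h1
    have := T.tri y w x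
    omega

theorem symm (x y : V) : T.F x y = T.F y x := le_antisymm (T.symm_le y x) (T.symm_le x y)

theorem parity (x y z : V) : (T.F x y + T.F y z + T.F x z) % 2 = 0 := by
  generalize hn : T.F y z = n
  induction n generalizing z with
  | zero => rw [(T.z y z).1 hn]; omega
  | succ n ih =>
    have hv : z ≠ y := by rintro rfl; have := T.self z; omega
    obtain ⟨w, h1, h2⟩ := T.l y z hv
    have := ih w (by omega)
    have := T.a x z w h1
    omega

theorem interp (x y : V) (k : ℕ) (h : k ≤ T.F x y) : ∃ z, T.F x z = k ∧ T.F z y = T.F x y - k := by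
  induction k with
  | zero => exact ⟨x, T.self x, by simp⟩
  | succ k ih =>
    obtain ⟨z, h1, h2⟩ := ih (by omega)
    have hv : z ≠ y := by rintro rfl; omega
    obtain ⟨w, h3, h4⟩ := T.l y z hv
    have := T.symm y z
    have := T.symm y w
    have := T.a x z w h3
    have := T.tri x w y
    exact ⟨w, by omega, by omega⟩

/-- no backtracking -/
theorem straight (z x x' y : V) (h : T.Adj x x') (h1 : T.F z x' = T.F z x + 1)
    (h2 : T.F x y = T.F x' y + 1) : T.F z y = T.F z x + T.F x y := by
  generalize hn : T.F x' y = n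
  induction n generalizing x x' with
  | zero => have := (T.z x' y).1 hn; subst this; omega
  | succ n ih =>
    have hv : x' ≠ y := by rintro rfl; have := T.self x'; omega
    obtain ⟨w, h3, h4⟩ := T.l y x' hv
    have e1 := T.symm y x'
    have e2 := T.symm y w
    rcases T.a z x' w h3 with h5 | h5
    · have : w = x := T.u z x' w x h3 (T.sym _ _ h) h5 h1
      subst this
      omega
    · have := ih x' w h3 h5 (by omega) (by omega)
      omega

theorem four (x y z w : V) :
    T.F x y + T.F z w ≤ max (T.F x z + T.F y w) (T.F x w + T.F y z) := by
  generalize hn : T.F x y = n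
  induction n generalizing x with
  | zero => have := (T.z x y).1 hn; subst this; have := T.tri z y w; have := T.symm z y; omega
  | succ n ih =>
    have hv : x ≠ y := by rintro rfl; have := T.self x; omega
    obtain ⟨x', h3, h4⟩ := T.l y x hv
    have := T.symm y x
    have := T.symm y x'
    have := T.symm z x
    have := T.symm z x'
    have := T.symm w x
    have := T.symm w x'
    have := T.symm y z
    have := T.symm y w
    have := T.symm z w
    have := ih x' (by omega)
    have t1 := T.tri z x w
    rcases T.a z x x' h3 with h5 | h5
    · rcases T.a w x x' h3 with h6 | h6
      · omega
      · have := T.straight w x x' y h3 h6 (by omega)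
        omega
    · have := T.straight z x x' y h3 h5 (by omega)
      omega

/-- the tree metric -/
def metric : TreeMetric V where
  d x y := T.F x y
  self x := by simp [T.self]
  eq_of x y h := ((T.z x y).1 (by exact_mod_cast h)).symm
  nonneg x y := by positivity
  symm x y := by rw [T.symm]
  four x y z w := by exact_mod_cast T.four x y z w
  parity x y z := by exact_mod_cast T.parity x y z
  interp x y k h0 h1 := by
    obtain ⟨k, rfl⟩ := Int.eq_ofNat_of_zero_le h0
    obtain ⟨z, h2, h3⟩ := T.interp x y k (by exact_mod_cast h1)
    exact ⟨z, by omega, by omega⟩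

end CTree

/-- Abstract amalgam : two subgroups and coset length functions. -/
structure Amalgam (P : Type*) [Group P] where
  K : Bool → Subgroup P
  n : Bool → P → ℕ
  inv : ∀ j q, ∀ g ∈ K j, n j (g * q) = n j q
  step : ∀ j q, ∃ g₀ ∈ K j, ∀ g ∈ K j,
    (g ∈ K (!j) → n (!j) (g * g₀ * q) = n j q - 1) ∧ (g ∉ K (!j) → n (!j) (g * g₀ * q) = n j q + 1)
  zero : ∀ j q, n j q = 0 ↔ q ∈ K j

namespace Amalgam
variable {P : Type*} [Group P] (M : Amalgam P)

/-- vertices -/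
def Vert (M : Amalgam P) := Σ j : Bool, P ⧸ M.K j

instance : MulAction P M.Vert where
  smul p v := ⟨v.1, p • v.2⟩
  one_smul v := by
    show (⟨v.1, (1 : P) • v.2⟩ : M.Vert) = v
    rw [one_smul]; rfl
  mul_smul p q v := by
    show (⟨v.1, (p * q) • v.2⟩ : M.Vert) = ⟨v.1, p • q • v.2⟩
    rw [mul_smul]

/-- the vertex `p K_j` -/
def vt (j : Bool) (p : P) : M.Vert := ⟨j, (p : P ⧸ M.K j)⟩

theorem smul_vt (p q : P) (j : Bool) : p • M.vt j q = M.vt j (p * q) := rfl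

theorem vt_eq {i j : Bool} {p q : P} : M.vt i p = M.vt j q ↔ i = j ∧ p⁻¹ * q ∈ M.K i := by
  constructor
  · intro h
    have h1 : i = j := congrArg Sigma.fst h
    subst h1
    have h2 := eq_of_heq (Sigma.mk.inj h).2
    exact ⟨rfl, QuotientGroup.eq.1 h2⟩
  · rintro ⟨rfl, h⟩
    unfold vt
    rw [QuotientGroup.eq.2 h]

theorem exists_vt (v : M.Vert) : ∃ j p, v = M.vt j p := by
  obtain ⟨j, c⟩ := v
  induction c using QuotientGroup.induction_on with
  | H p => exact ⟨j, p, rfl⟩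

/-- adjacency -/
def Adj (v w : M.Vert) : Prop := ∃ j p, v = M.vt j p ∧ w = M.vt (!j) p

theorem adj_symm (v w : M.Vert) (h : M.Adj v w) : M.Adj w v := by
  obtain ⟨j, p, h1, h2⟩ := h
  exact ⟨!j, p, h2, by simpa using h1⟩

theorem adj_smul (g : P) {v w : M.Vert} (h : M.Adj v w) : M.Adj (g • v) (g • w) := by
  obtain ⟨j, p, rfl, rfl⟩ := h
  exact ⟨j, g * p, rfl, rfl⟩

/-- rounding -/
def rd (i j : Bool) (n : ℕ) : ℕ := n + (n + (if i = j then 0 else 1)) % 2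

/-- level of a vertex from base `i`-/
def lev (i : Bool) (v : M.Vert) : ℕ :=
  rd i v.1 (Quotient.liftOn' v.2 (fun p => M.n v.1 p⁻¹) (by
    intro p q h
    rw [QuotientGroup.leftRel_apply] at h
    have := M.inv v.1 p⁻¹ (q⁻¹ * p) (by simpa using inv_mem h)
    rw [← this]
    simp))

theorem lev_vt (i j : Bool) (p : P) : M.lev i (M.vt j p) = rd i j (M.n j p⁻¹) := rfl

theorem lev_zero (i : Bool) (v : M.Vert) : M.lev i v = 0 ↔ v = M.vt i 1 := by
  obtain ⟨j, p, rfl⟩ := M.exists_vt v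
  rw [lev_vt, vt_eq]
  unfold rd
  have := M.zero j p⁻¹
  rw [mul_one, ← this]
  split_ifs with h
  · subst h; simp; omega
  · constructor
    · intro h'; omega
    · rintro ⟨h1, _⟩; exact absurd h1.symm h

/-- neighbours of a vertex, described -/
theorem nbrs (j : Bool) (p : P) : ∃ p₀ : P, M.vt j p = M.vt j p₀ ∧ M.n (!j) p₀⁻¹ = M.n j p⁻¹ - 1 ∧
    ∀ w, M.Adj (M.vt j p) w →
    (w = M.vt (!j) p₀ ∧ M.n (!j) p₀⁻¹ = M.n j p⁻¹ - 1) ∨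
    (∃ q, w = M.vt (!j) q ∧ M.n (!j) q⁻¹ = M.n j p⁻¹ + 1) := by
  obtain ⟨g₀, hg, hs⟩ := M.step j p⁻¹
  refine ⟨p * g₀⁻¹, ?_, ?_, ?_⟩
  · rw [vt_eq]; simpa using hg
  · have := (hs 1 (one_mem _)).1 (one_mem _)
    simpa using this
  · rintro w ⟨j', p', h1, h2⟩
    rw [vt_eq] at h1
    obtain ⟨rfl, h1⟩ := h1
    have hgm : p'⁻¹ * p * g₀⁻¹ ∈ M.K j :=
      mul_mem (by simpa using inv_mem h1) (inv_mem hg)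
    have hs' := hs (p'⁻¹ * p * g₀⁻¹) hgm
    have e : p'⁻¹ * p * g₀⁻¹ * g₀ * p⁻¹ = p'⁻¹ := by group
    rw [e] at hs'
    by_cases hA : p'⁻¹ * p * g₀⁻¹ ∈ M.K (!j)
    · left
      refine ⟨?_, ?_⟩
      · rw [h2, vt_eq]; exact ⟨rfl, by rwa [← mul_assoc]⟩
      · rw [← hs'.1 hA]
        have := M.inv (!j) p'⁻¹ _ (inv_mem hA)
        rw [← this]; congr 1; group
    · right
      exact ⟨p', h2, hs'.2 hA⟩

theorem adj_vt (j : Bool) (p : P) : M.Adj (M.vt j p) (M.vt (!j) p) := ⟨j, p, rfl, rfl⟩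

theorem rd_pred {i j : Bool} {n m : ℕ} (hm : m = n - 1) (h : ¬ (n = 0 ∧ i = j)) :
    rd i j n = rd i (!j) m + 1 := by
  unfold rd
  cases i <;> cases j <;> simp at * <;> omega

theorem rd_zero {i j : Bool} {n m : ℕ} (hm : m = n - 1) (h : n = 0 ∧ i = j) :
    rd i (!j) m = rd i j n + 1 := by
  unfold rd
  cases i <;> cases j <;> simp at * <;> omega

theorem rd_succ {i j : Bool} {n m : ℕ} (hm : m = n + 1) :
    rd i (!j) m = rd i j n + 1 := by
  unfold rd
  cases i <;> cases j <;> simp at * <;> omega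

theorem lev_adj (i : Bool) (v w : M.Vert) (h : M.Adj v w) :
    M.lev i v = M.lev i w + 1 ∨ M.lev i w = M.lev i v + 1 := by
  obtain ⟨j, p, rfl⟩ := M.exists_vt v
  obtain ⟨p₀, hp, h0, hn⟩ := M.nbrs j p
  rcases hn w h with ⟨rfl, h2⟩ | ⟨q, rfl, h2⟩
  · rw [lev_vt, lev_vt]
    by_cases h3 : M.n j p⁻¹ = 0 ∧ i = j
    · right; exact rd_zero h2 h3
    · left; exact rd_pred h2 h3
  · right
    rw [lev_vt, lev_vt]
    exact rd_succ h2

theorem lev_low (i : Bool) (v : M.Vert) (h : v ≠ M.vt i 1) :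
    ∃ w, M.Adj v w ∧ M.lev i v = M.lev i w + 1 := by
  rw [ne_eq, ← M.lev_zero i] at h
  obtain ⟨j, p, rfl⟩ := M.exists_vt v
  obtain ⟨p₀, hp, h0, hn⟩ := M.nbrs j p
  have hadj : M.Adj (M.vt j p) (M.vt (!j) p₀) := by rw [hp]; exact M.adj_vt j p₀
  refine ⟨_, hadj, ?_⟩
  rw [lev_vt] at h
  rw [lev_vt, lev_vt]
  apply rd_pred h0
  rintro ⟨h3, rfl⟩
  apply h; rw [h3]; simp [rd]

theorem lev_uniq (i : Bool) (v w w' : M.Vert) (h : M.Adj v w) (h' : M.Adj v w')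
    (e : M.lev i v = M.lev i w + 1) (e' : M.lev i v = M.lev i w' + 1) : w = w' := by
  obtain ⟨j, p, rfl⟩ := M.exists_vt v
  obtain ⟨p₀, hp, h0, hn⟩ := M.nbrs j p
  rcases hn w h with ⟨rfl, h2⟩ | ⟨q, rfl, h2⟩
  · rcases hn w' h' with ⟨rfl, h3⟩ | ⟨q, rfl, h3⟩
    · rfl
    · rw [lev_vt, lev_vt, rd_succ h3] at e'; omega
  · rw [lev_vt, lev_vt, rd_succ h2] at e; omega

theorem fst_smul (p : P) (v : M.Vert) : (p • v).1 = v.1 := rfl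

theorem exists_rep (v : M.Vert) : ∃ p : P, p • M.vt v.1 1 = v := by
  obtain ⟨j, p, rfl⟩ := M.exists_vt v
  exact ⟨p, by rw [smul_vt, mul_one]; rfl⟩

/-- a representative -/
noncomputable def rep (v : M.Vert) : P := (M.exists_rep v).choose

theorem rep_spec (v : M.Vert) : M.rep v • M.vt v.1 1 = v := (M.exists_rep v).choose_spec

theorem rep_inv (v : M.Vert) : (M.rep v)⁻¹ • v = M.vt v.1 1 := by
  rw [inv_smul_eq_iff, M.rep_spec v]

/-- the Bass-Serre tree -/
noncomputable def tree : CTree M.Vert where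
  Adj := M.Adj
  sym := M.adj_symm
  F x v := M.lev x.1 ((M.rep x)⁻¹ • v)
  z x v := by
    rw [M.lev_zero, ← M.rep_inv x, smul_left_cancel_iff]
  a x v w h := M.lev_adj _ _ _ (M.adj_smul _ h)
  l x v h := by
    obtain ⟨w, h1, h2⟩ := M.lev_low x.1 ((M.rep x)⁻¹ • v) (by
      rw [← M.rep_inv x]; intro h'; exact h (smul_left_cancel _ h'))
    have := M.adj_smul (M.rep x) h1
    rw [smul_inv_smul] at this
    exact ⟨_, this, by rw [inv_smul_smul]; exact h2⟩
  u x v w w' h h' e e' := smul_left_cancel _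
    (M.lev_uniq x.1 _ _ _ (M.adj_smul (M.rep x)⁻¹ h) (M.adj_smul (M.rep x)⁻¹ h') e e')

theorem tree_isom_le (p : P) (x v : M.Vert) : M.tree.F (p • x) (p • v) ≤ M.tree.F x v := by
  refine level_unique M.tree.Adj x (fun v => M.tree.F (p • x) (p • v)) (M.tree.F x) ?_ ?_ ?_ ?_ v
  · exact M.tree.self _
  · intro v w h
    exact M.tree.a _ _ _ (M.adj_smul p h)
  · intro v h; exact (M.tree.z x v).1 h
  · intro v h; exact M.tree.l x v h

theorem tree_isom (p : P) (x v : M.Vert) : M.tree.F (p • x) (p • v) = M.tree.F x v := by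
  apply le_antisymm (M.tree_isom_le p x v)
  have := M.tree_isom_le p⁻¹ (p • x) (p • v)
  rwa [inv_smul_smul, inv_smul_smul] at this

theorem tree_even (x v : M.Vert) (h : x.1 = v.1) : M.tree.F x v % 2 = 0 := by
  show M.lev x.1 ((M.rep x)⁻¹ • v) % 2 = 0
  obtain ⟨j, p, hp⟩ := M.exists_vt ((M.rep x)⁻¹ • v)
  have : x.1 = j := by
    have h1 := congrArg Sigma.fst hp
    rw [fst_smul] at h1
    rw [h, h1]; rfl
  rw [hp, lev_vt, this]
  unfold rd
  simp; omega

theorem stab_vt (p q : P) (j : Bool) : p • M.vt j q = M.vt j q ↔ q⁻¹ * p * q ∈ M.K j := by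
  rw [smul_vt, vt_eq]
  constructor
  · rintro ⟨-, h⟩
    have := inv_mem h
    simpa [mul_assoc] using this
  · intro h
    refine ⟨rfl, ?_⟩
    have := inv_mem h
    simpa [mul_assoc] using this

/-- the amalgamated subgroup -/
def A : Subgroup P := M.K false ⊓ M.K true

theorem mem_A (j : Bool) {g : P} : g ∈ M.A ↔ g ∈ M.K j ∧ g ∈ M.K (!j) := by
  unfold A
  cases j <;> simp [Subgroup.mem_inf, and_comm]

/-- malnormality of the edge group -/
def Mal : Prop := ∀ j, ∀ g ∈ M.K j, g ∉ M.A → ∀ a ∈ M.A, g * a * g⁻¹ ∈ M.A → a = 1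

theorem fix_two (hM : M.Mal) {u v w : M.Vert} (h1 : M.Adj v u) (h2 : M.Adj v w) (hne : u ≠ w) (p : P)
    (hu : p • u = u) (hv : p • v = v) (hw : p • w = w) : p = 1 := by
  obtain ⟨j, a, rfl, rfl⟩ := h1
  obtain ⟨j', b, e, rfl⟩ := h2
  rw [vt_eq] at e
  obtain ⟨rfl, e⟩ := e
  rw [stab_vt] at hu hv hw
  have hA : a⁻¹ * p * a ∈ M.A := (M.mem_A j).2 ⟨hv, hu⟩
  have hB : (b⁻¹ * a) * (a⁻¹ * p * a) * (b⁻¹ * a)⁻¹ ∈ M.A := by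
    have e1 : (b⁻¹ * a) * (a⁻¹ * p * a) * (b⁻¹ * a)⁻¹ = b⁻¹ * p * b := by group
    have e' : b⁻¹ * a ∈ M.K j := by simpa using inv_mem e
    rw [M.mem_A j]
    refine ⟨mul_mem (mul_mem e' hv) (inv_mem e'), ?_⟩
    rw [e1]; exact hw
  have hn : b⁻¹ * a ∉ M.A := by
    intro h
    apply hne
    rw [vt_eq]
    refine ⟨rfl, ?_⟩
    have := inv_mem ((M.mem_A j).1 h).2
    simpa using this
  have := hM j _ (by simpa using inv_mem e) hn _ hA hB
  have h3 := congrArg (fun g => a * g * a⁻¹) this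
  simpa [mul_assoc] using h3

theorem fix_vert (hM : M.Mal) {x v : M.Vert} (h : 2 ≤ M.tree.F x v) (p : P) (hx : p • x = x)
    (hv : p • v = v) : p = 1 := by
  have key : ∀ v, p • v = v → ∀ w, M.tree.Adj v w → M.tree.F x v = M.tree.F x w + 1 → p • w = w := by
    intro v hv w h1 h2
    have h3 := M.adj_smul p h1
    rw [hv] at h3
    refine M.tree.u x v _ _ h3 h1 ?_ h2
    have := M.tree_isom p x w
    rw [hx] at this
    omega
  have h0 := M.tree.self x
  obtain ⟨w, h1, h2⟩ := M.tree.l x v (by rintro rfl; omega)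
  have hw := key v hv w h1 h2
  obtain ⟨y, h3, h4⟩ := M.tree.l x w (by rintro rfl; omega)
  have hy := key w hw y h3 h4
  exact M.fix_two hM (M.adj_symm _ _ h1) h3 (by rintro rfl; omega) p hv hw hy

theorem isLine (l : ℤ → M.Vert) (h : ∀ i, M.Adj (l i) (l (i+1))) (h2 : ∀ i, l i ≠ l (i + 2)) :
    M.tree.metric.IsLine l := by
  have key : ∀ (i : ℤ) (n : ℕ), M.tree.F (l i) (l (i + n)) = n ∧
      M.tree.F (l i) (l (i + n + 1)) = n + 1 := by
    intro i n
    induction n with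
    | zero =>
      refine ⟨by simp [M.tree.self], ?_⟩
      simp only [Nat.cast_zero, add_zero, zero_add]
      exact M.tree.adj1 (h i)
    | succ n ih =>
      have e : i + ((n + 1 : ℕ) : ℤ) = i + n + 1 := by push_cast; ring
      rw [e]
      refine ⟨ih.2, ?_⟩
      rcases M.tree.a (l i) _ _ (h (i + n + 1)) with h5 | h5
      · exfalso
        apply h2 (i + n)
        have := M.tree.u (l i) (l (i + n + 1)) (l (i + n)) (l (i + n + 1 + 1))
          (M.adj_symm _ _ (h (i + n))) (h _) (by omega) h5
        rw [this]; congr 1; ring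
      · omega
  have k2 : ∀ i j : ℤ, i ≤ j → M.tree.F (l i) (l j) = j - i := by
    intro i j hij
    have := (key i (j - i).toNat).1
    rw [show i + ((j - i).toNat : ℤ) = j by omega] at this
    omega
  intro i j
  show (M.tree.F (l i) (l j) : ℤ) = _
  rcases le_total i j with hij | hij
  · rw [k2 i j hij]; omega
  · rw [M.tree.symm, k2 j i hij]; omega

end Amalgam
end JG

namespace JG
open Monoid Monoid.PushoutI Monoid.PushoutI.NormalWord
open Monoid.CoprodI (Word)

section Push
variable {G : Bool → Type*} {A : Type*} [∀ i, Group (G i)] [Group A] {φ : ∀ i, A →* G i}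
  (d : Transversal φ)

theorem prod_surj (q : PushoutI φ) : ∃ w : NormalWord d, w.prod = q := by
  classical
  exact ⟨NormalWord.equiv q, NormalWord.equiv.symm_apply_apply q⟩

/-- normal word -/
noncomputable def nw (q : PushoutI φ) : NormalWord d := (prod_surj d q).choose

theorem nw_prod (w : NormalWord d) : nw d w.prod = w :=
  prod_injective (prod_surj d w.prod).choose_spec

/-- length after removing an initial `j` letter -/
noncomputable def wl (j : Bool) (w : NormalWord d) : ℕ :=
  if w.fstIdx = some j then w.toList.length - 1 else w.toList.length

theorem wl_base (j : Bool) (a : A) (w : NormalWord d) : wl d j (nw d (base φ a * w.prod)) = wl d j w := by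
  rw [← prod_base_smul, nw_prod]
  rfl

theorem wl_of (j j' : Bool) (g : G j) (w : NormalWord d) (hw : w.fstIdx ≠ some j)
    (hg : g ∉ (φ j).range) :
    wl d j' (nw d (of j g * w.prod)) = if j = j' then w.toList.length else w.toList.length + 1 := by
  rw [← NormalWord.prod_cons g w hw hg, nw_prod]
  unfold wl
  have h1 : (NormalWord.cons g w hw hg).fstIdx = some j := by
    simp [NormalWord.cons, Word.fstIdx, Word.cons]
  have h2 : (NormalWord.cons g w hw hg).toList.length = w.toList.length + 1 := by
    simp [NormalWord.cons, Word.cons]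
  rw [h1, h2]
  simp

theorem decomp (j : Bool) (q : PushoutI φ) : ∃ (g : G j) (w : NormalWord d), w.fstIdx ≠ some j ∧
    q = of j g * w.prod := by
  classical
  obtain ⟨w, rfl⟩ := prod_surj d q
  induction w using NormalWord.consRecOn with
  | empty => exact ⟨1, NormalWord.empty, by simp [Word.fstIdx, NormalWord.empty, Word.empty], by simp⟩
  | cons i g w hmw hgn hgr hw1 ih =>
    by_cases h : i = j
    · subst h
      exact ⟨g, w, hmw, by rw [NormalWord.prod_cons]⟩
    · refine ⟨1, NormalWord.cons g w hmw hgr, ?_, by simp⟩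
      simp [NormalWord.cons, Word.fstIdx, Word.cons, h]
  | base a w hw ih =>
    obtain ⟨g, w', h1, h2⟩ := ih
    refine ⟨φ j a * g, w', h1, ?_⟩
    rw [NormalWord.prod_smul, h2, map_mul, of_apply_eq_base, mul_assoc]

theorem wl_same (j : Bool) (g : G j) (w : NormalWord d) (hw : w.fstIdx ≠ some j) :
    wl d j (nw d (of j g * w.prod)) = w.toList.length := by
  by_cases hg : g ∈ (φ j).range
  · obtain ⟨a, rfl⟩ := hg
    rw [of_apply_eq_base, wl_base]
    unfold wl
    rw [if_neg hw]
  · rw [wl_of d j j g w hw hg, if_pos rfl]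

theorem mem_other (j : Bool) (g : G j) (hφ : ∀ i, Function.Injective (φ i)) :
    (of j g : PushoutI φ) ∈ (of (φ := φ) (!j)).range ↔ g ∈ (φ j).range := by
  constructor
  · intro h
    have : (of j g : PushoutI φ) ∈ (base φ).range := by
      rw [← inf_of_range_eq_base_range hφ (show j ≠ !j by simp)]
      exact ⟨⟨g, rfl⟩, h⟩
    obtain ⟨a, ha⟩ := this
    refine ⟨a, of_injective hφ j ?_⟩
    rw [of_apply_eq_base, ha]
  · rintro ⟨a, rfl⟩
    exact ⟨φ (!j) a, by rw [of_apply_eq_base, of_apply_eq_base]⟩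

theorem wl_other (j : Bool) (w : NormalWord d) (hw : w.fstIdx ≠ some j) :
    wl d (!j) w = w.toList.length - 1 := by
  unfold wl
  split_ifs with h
  · rfl
  · have : w.fstIdx = none := by
      rcases hf : w.fstIdx with _ | i
      · rfl
      · rw [hf] at h hw
        exfalso
        cases i <;> cases j <;> simp_all
    have : w.toList = [] := by
      simpa [Word.fstIdx] using this
    simp [this]

/-- the amalgam structure on a pushout -/
noncomputable def pushAmalgam (hφ : ∀ i, Function.Injective (φ i)) : Amalgam (PushoutI φ) where
  K j := (of (φ := φ) j).range
  n j q := wl d j (nw d q)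
  inv := by
    rintro j q _ ⟨g, rfl⟩
    obtain ⟨g', w, hw, rfl⟩ := decomp d j q
    rw [← mul_assoc, ← map_mul, wl_same d j _ w hw, wl_same d j _ w hw]
  step := by
    rintro j q
    obtain ⟨g', w, hw, rfl⟩ := decomp d j q
    refine ⟨of j g'⁻¹, ⟨_, rfl⟩, ?_⟩
    rintro _ ⟨g, rfl⟩
    rw [mem_other j g hφ, wl_same d j _ w hw]
    have e : of j g * of j g'⁻¹ * (of j g' * w.prod) = of j g * w.prod := by
      rw [map_inv]; group
    rw [e]
    constructor
    · rintro ⟨a, rfl⟩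
      rw [of_apply_eq_base, wl_base, wl_other d j w hw]
    · intro hg
      rw [wl_of d j _ g w hw hg, if_neg (by simp)]
  zero := by
    intro j q
    obtain ⟨g', w, hw, rfl⟩ := decomp d j q
    rw [wl_same d j _ w hw]
    constructor
    · intro h
      have h1 : w.toList = [] := List.eq_nil_of_length_eq_zero h
      have h2 : w.prod = base φ w.head := by
        rw [NormalWord.prod, Word.prod, h1]; simp
      rw [h2, ← of_apply_eq_base φ j]
      exact mul_mem ⟨_, rfl⟩ ⟨_, rfl⟩
    · rintro ⟨g, hg⟩
      have h2 : of j (g'⁻¹ * g) * (NormalWord.empty : NormalWord d).prod = w.prod := by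
        rw [map_mul, hg]; simp
      have h3 := wl_same d j (g'⁻¹ * g) NormalWord.empty (by simp [Word.fstIdx, NormalWord.empty, Word.empty])
      rw [h2, nw_prod] at h3
      unfold wl at h3
      rw [if_neg hw] at h3
      simpa [NormalWord.empty, Word.empty] using h3

end Push
end JG

namespace JG

/-- the bits of the exponent word -/
def wordBits : ℕ := 1365970117026646891884491465353735833696016609480424787831083418216921988842446941436678305977959897796977057818606149037908783408629056999728618416694536162128058545725798075555335059931255421916419905072440117419859586147791102268247917563768784158050222508539

/-- exponent at place `i` -/
def dl (i : ℕ) : Bool := wordBits.testBit i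

/-- binary key -/
def key (f : ℕ → Bool) : ℕ → ℕ
  | 0 => 0
  | n + 1 => 2 * key f n + (f n).toNat

theorem key_inj {f g : ℕ → Bool} (n : ℕ) (h : key f n = key g n) : ∀ t < n, f t = g t := by
  induction n with
  | zero => intro t ht; omega
  | succ n ih =>
    unfold key at h
    have h1 : (f n).toNat < 2 := Bool.toNat_lt _
    have h2 : (g n).toNat < 2 := Bool.toNat_lt _
    have h3 : key f n = key g n := by omega
    have h4 : (f n).toNat = (g n).toNat := by omega
    intro t ht
    rcases Nat.lt_succ_iff_lt_or_eq.1 ht with h5 | rfl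
    · exact ih h3 t h5
    · revert h4; cases f t <;> cases g t <;> simp

/-- windows -/
def win (s r : Bool) (i t : ℕ) : Bool := xor s (dl (if r then i + 13 - t else i + t))

/-- all windows -/
def wins : List (Bool × Bool × ℕ) :=
  (List.range 856).flatMap fun i => [(false, false, i), (false, true, i), (true, false, i), (true, true, i)]

/-- distinctness test -/
def chk : List ℕ → ℕ → Bool
  | [], _ => true
  | k :: l, acc => !acc.testBit k && chk l (acc ||| (1 <<< k))

theorem chk_spec (l : List ℕ) (acc : ℕ) (h : chk l acc = true) :
    l.Nodup ∧ ∀ k ∈ l, acc.testBit k = false := by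
  induction l generalizing acc with
  | nil => simp
  | cons k l ih =>
    unfold chk at h
    rw [Bool.and_eq_true] at h
    obtain ⟨h1, h2⟩ := ih _ h.2
    have h3 : acc.testBit k = false := by simpa using h.1
    refine ⟨List.nodup_cons.2 ⟨?_, h1⟩, ?_⟩
    · intro hk
      have := h2 k hk
      simp [Nat.testBit_shiftLeft] at this
    · intro k' hk'
      rcases List.mem_cons.1 hk' with rfl | hk'
      · exact h3
      · have := h2 k' hk'
        rw [Nat.testBit_lor, Bool.or_eq_false_iff] at this
        exact this.1

theorem chk_wins : chk (wins.map fun x => key (win x.1 x.2.1 x.2.2) 14) 0 = true := by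
  decide +kernel

theorem mem_wins (s r : Bool) (i : ℕ) (h : i < 856) : (s, r, i) ∈ wins := by
  unfold wins
  rw [List.mem_flatMap]
  refine ⟨i, List.mem_range.2 h, ?_⟩
  cases s <;> cases r <;> simp

theorem key_congr {f g : ℕ → Bool} (n : ℕ) (h : ∀ t < n, f t = g t) : key f n = key g n := by
  induction n with
  | zero => rfl
  | succ n ih =>
    unfold key
    rw [ih (fun t ht => h t (by omega)), h n (by omega)]

theorem win_inj (s r s' r' : Bool) (i j : ℕ) (hi : i < 856) (hj : j < 856)
    (h : ∀ t < 14, win s r i t = win s' r' j t) : s = s' ∧ r = r' ∧ i = j := by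
  have h1 := (chk_spec _ _ chk_wins).1
  have h2 := List.inj_on_of_nodup_map h1 (mem_wins s r i hi) (mem_wins s' r' j hj) (key_congr 14 h)
  simpa using h2

/-- periodic exponent -/
def dI (k : ℤ) : Bool := dl (k % 870).toNat

theorem window (I J : ℤ) (r s : Bool)
    (h : ∀ t : ℤ, 0 ≤ t → t < 42 → (I + t) % 870 ≠ 869 → (if r then J - t else J + t) % 870 ≠ 869 →
      dI (I + t) = xor s (dI (if r then J - t else J + t))) :
    s = false ∧ r = false ∧ (I - J) % 870 = 0 := by
  obtain ⟨b, hb0, hb1, hb2⟩ : ∃ b : ℤ, 0 ≤ b ∧ b ≤ 28 ∧ ∀ t : ℤ, 0 ≤ t → t < 14 →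
      (I + (b + t)) % 870 ≠ 869 ∧ (if r then J - (b + t) else J + (b + t)) % 870 ≠ 869 := by
    by_contra hcon
    push Not at hcon
    obtain ⟨t1, a1, b1, c1⟩ := hcon 0 (by omega) (by omega)
    obtain ⟨t2, a2, b2, c2⟩ := hcon 14 (by omega) (by omega)
    obtain ⟨t3, a3, b3, c3⟩ := hcon 28 (by omega) (by omega)
    cases r <;> simp only [Bool.false_eq_true, if_false, if_true] at c1 c2 c3 <;> omega
  have hI0 := hb2 0 (by omega) (by omega)
  have hI : (I + b) % 870 < 856 := by
    by_contra hc
    have := (hb2 (869 - (I + b) % 870) (by omega) (by omega)).1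
    omega
  cases r
  · simp only [Bool.false_eq_true, if_false] at *
    have hJ : (J + b) % 870 < 856 := by
      by_contra hc
      have := (hb2 (869 - (J + b) % 870) (by omega) (by omega)).2
      omega
    have key := win_inj false false s false ((I + b) % 870).toNat ((J + b) % 870).toNat (by omega) (by omega) (by
      intro t ht
      have h1 := hb2 t (by omega) (by omega)
      have h2 := h (b + t) (by omega) (by omega) h1.1 h1.2
      unfold dI at h2
      unfold win
      simp only [Bool.false_xor, Bool.false_eq_true, if_false]
      rw [show ((I + b) % 870).toNat + t = ((I + (b + t)) % 870).toNat by omega,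
        show ((J + b) % 870).toNat + t = ((J + (b + t)) % 870).toNat by omega]
      exact h2)
    refine ⟨key.1.symm, ?_⟩
    simp only [true_and]
    omega
  · exfalso
    simp only [if_true] at *
    have hJ : (J - b - 13) % 870 < 856 := by
      by_contra hc
      have := (hb2 (13 - (869 - (J - b - 13) % 870)) (by omega) (by omega)).2
      omega
    have key := win_inj false false s true ((I + b) % 870).toNat ((J - b - 13) % 870).toNat (by omega) (by omega) (by
      intro t ht
      have h1 := hb2 t (by omega) (by omega)
      have h2 := h (b + t) (by omega) (by omega) h1.1 h1.2
      unfold dI at h2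
      unfold win
      simp only [Bool.false_xor, Bool.false_eq_true, if_false, if_true]
      rw [show ((I + b) % 870).toNat + t = ((I + (b + t)) % 870).toNat by omega,
        show ((J - b - 13) % 870).toNat + 13 - t = ((J - (b + t)) % 870).toNat by omega]
      exact h2)
    exact absurd key.2.1 (by simp)

theorem both_signs (I : ℤ) (s : Bool) : ∃ t : ℤ, 0 ≤ t ∧ t < 42 ∧ (I + t) % 870 ≠ 869 ∧ dI (I + t) = s := by
  by_contra hcon
  push Not at hcon
  have := window I (I + 41) true false (by
    intro t h0 h1 h2 h3
    simp only [if_true] at h3 ⊢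
    have a1 := hcon t h0 h1 h2
    rw [show I + 41 - t = I + (41 - t) by ring] at h3 ⊢
    have a2 := hcon (41 - t) (by omega) (by omega) h3
    revert a1 a2
    cases dI (I + t) <;> cases dI (I + (41 - t)) <;> cases s <;> simp)
  exact absurd this.2.1 (by simp)

end JG

namespace JG

section Path
variable {P Q : Type*} [Group P] [Group Q]

/-- forward products -/
def pthP (u : ℤ → P) : ℕ → P
  | 0 => 1
  | n + 1 => pthP u n * u n

/-- backward products -/
def pthM (u : ℤ → P) : ℕ → P
  | 0 => 1
  | n + 1 => pthM u n * (u (-(n + 1 : ℤ)))⁻¹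

/-- partial products along a biinfinite word -/
def pth (u : ℤ → P) (k : ℤ) : P := if 0 ≤ k then pthP u k.toNat else pthM u (-k).toNat

theorem pth_zero (u : ℤ → P) : pth u 0 = 1 := by simp [pth, pthP]

theorem pth_succ (u : ℤ → P) (k : ℤ) : pth u (k + 1) = pth u k * u k := by
  unfold pth
  rcases lt_trichotomy k (-1) with h | h | h
  · rw [if_neg (by omega), if_neg (by omega)]
    obtain ⟨n, hn⟩ : ∃ n : ℕ, -k = n + 1 := ⟨(-k - 1).toNat, by omega⟩
    rw [show (-(k+1)).toNat = n by omega, show (-k).toNat = n + 1 by omega, pthM,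
      show (-(n + 1 : ℤ)) = k by omega]
    simp
  · subst h
    simp [pthP, pthM]
  · rw [if_pos (by omega), if_pos (by omega)]
    rw [show (k + 1).toNat = k.toNat + 1 by omega, pthP, show ((k.toNat : ℕ) : ℤ) = k by omega]

theorem pth_period (u : ℤ → P) (R : ℤ) (h : ∀ k, u (k + R) = u k) (k : ℤ) :
    pth u (k + R) = pth u R * pth u k := by
  induction k using Int.induction_on with
  | zero => simp [pth_zero]
  | succ k ih =>
    rw [show (k : ℤ) + 1 + R = (k + R) + 1 by ring, pth_succ, ih, pth_succ, h, mul_assoc]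
  | pred k ih =>
    have h1 := pth_succ u (-(k : ℤ) - 1)
    have h2 := pth_succ u (-(k : ℤ) - 1 + R)
    rw [show -(k : ℤ) - 1 + R + 1 = -k + R by ring, ih, h] at h2
    rw [show -(k : ℤ) - 1 + 1 = -k by ring] at h1
    rw [h1, ← mul_assoc] at h2
    exact (mul_right_cancel h2).symm

theorem map_pth (f : P →* Q) (u : ℤ → P) (k : ℤ) : f (pth u k) = pth (fun i => f (u i)) k := by
  induction k using Int.induction_on with
  | zero => simp [pth_zero]
  | succ k ih => rw [pth_succ, pth_succ, map_mul, ih]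
  | pred k ih =>
    have h1 := pth_succ u (-(k : ℤ) - 1)
    have h2 := pth_succ (fun i => f (u i)) (-(k : ℤ) - 1)
    rw [show -(k : ℤ) - 1 + 1 = -k by ring] at h1 h2
    rw [h1, h2, map_mul] at ih
    exact mul_right_cancel ih

/-- power `±1` -/
def pw (g : P) (s : Bool) : P := if s then g else g⁻¹

theorem pw_inj {g : P} (hg : g ^ 2 ≠ 1) {a b : Bool} (h : pw g a = pw g b) : a = b := by
  rw [pow_two] at hg
  cases a <;> cases b <;> simp [pw] at * <;> apply hg
  · nth_rewrite 1 [← h]; simp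
  · nth_rewrite 1 [h]; simp

theorem pw_inv (g : P) (s : Bool) : (pw g s)⁻¹ = pw g (!s) := by
  cases s <;> simp [pw]

/-- letters -/
def letter (h g b : P) (k : ℤ) : P :=
  if k % 2 = 0 then h else if (k / 2) % 870 = 869 then b else pw g (dI (k / 2))

/-- the relator -/
def relr (h g b : P) : P := pth (letter h g b) 1740

theorem letter_even (h g b : P) {k : ℤ} (hk : k % 2 = 0) : letter h g b k = h := if_pos hk

theorem letter_odd (h g b : P) {k : ℤ} (hk : k % 2 = 1) (h2 : (k / 2) % 870 ≠ 869) :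
    letter h g b k = pw g (dI (k / 2)) := by
  unfold letter
  rw [if_neg (by omega), if_neg h2]

theorem letter_period (h g b : P) (k : ℤ) : letter h g b (k + 1740) = letter h g b k := by
  unfold letter dI
  rw [show (k + 1740) % 2 = k % 2 by omega, show (k + 1740) / 2 % 870 = k / 2 % 870 by omega]

theorem map_letter (f : P →* Q) (h g b : P) (k : ℤ) :
    f (letter h g b k) = letter (f h) (f g) (f b) k := by
  unfold letter pw
  split_ifs <;> simp

theorem map_relr (f : P →* Q) (h g b : P) : f (relr h g b) = relr (f h) (f g) (f b) := by
  unfold relr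
  rw [map_pth]
  congr 1
  funext k
  exact map_letter f h g b k

/-- the relator expresses `b` through `h,g` -/
theorem relr_mem (K : Subgroup P) (h g b : P) (hh : h ∈ K) (hg : g ∈ K) (hr : relr h g b ∈ K) : b ∈ K := by
  have key : ∀ n : ℕ, n ≤ 1739 → pth (letter h g b) n ∈ K := by
    intro n
    induction n with
    | zero => intro _; simpa [pth_zero] using K.one_mem
    | succ n ih =>
      intro hn
      push_cast
      rw [pth_succ]
      refine mul_mem (ih (by omega)) ?_
      by_cases hp : (n : ℤ) % 2 = 0
      · rw [letter_even _ _ _ hp]; exact hh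
      · rw [letter_odd _ _ _ (by omega) (by omega)]
        unfold pw
        split_ifs
        · exact hg
        · exact inv_mem hg
  have h1 := key 1739 le_rfl
  have h2 : relr h g b = pth (letter h g b) 1739 * b := by
    have := pth_succ (letter h g b) 1739
    rw [show (1739 : ℤ) + 1 = 1740 by norm_num] at this
    unfold relr
    rw [this]
    rfl
  rw [h2] at hr
  exact (mul_mem_cancel_left (by exact_mod_cast h1)).1 hr

end Path

namespace Amalgam
variable {P : Type*} [Group P] (M : Amalgam P)

/-- data for a family of relators -/
structure RelData (S : Type*) where
  h : S → P
  g : S → P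
  b : S → P
  hK : ∀ s, h s ∈ M.K true
  hA : ∀ s, h s ∉ M.A
  gK : ∀ s, g s ∈ M.K false
  gA : ∀ s, g s ∉ M.A
  bK : ∀ s, b s ∈ M.K false
  bA : ∀ s, b s ∉ M.A
  g2 : ∀ s, g s ^ 2 ≠ 1
  cj : ∀ s s', ∀ a ∈ M.A, h s = a * h s' * a⁻¹ → g s = a * g s' * a⁻¹ → s = s'
  mal : M.Mal

namespace RelData
variable {M} {S : Type*} (D : M.RelData S)

/-- letters of the relator -/
def u (s : S) (k : ℤ) : P := letter (D.h s) (D.g s) (D.b s) k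

/-- points on the axis -/
def p (s : S) (k : ℤ) : P := pth (D.u s) k

/-- relator -/
def rr (s : S) : P := relr (D.h s) (D.g s) (D.b s)

theorem p_succ (s : S) (k : ℤ) : D.p s (k + 1) = D.p s k * D.u s k := pth_succ _ _

theorem p_period (s : S) (k : ℤ) : D.p s (k + 1740) = D.rr s * D.p s k :=
  pth_period _ _ (letter_period _ _ _) k

theorem p_period' (s : S) (k m : ℤ) : D.p s (k + m * 1740) = D.rr s ^ m * D.p s k := by
  induction m using Int.induction_on with
  | zero => simp
  | succ m ih =>
    rw [show k + ((m : ℤ) + 1) * 1740 = k + m * 1740 + 1740 by ring, p_period, ih, ← mul_assoc,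
      ← zpow_one_add, add_comm 1]
  | pred m ih =>
    have := D.p_period s (k + (-(m : ℤ) - 1) * 1740)
    rw [show k + (-(m : ℤ) - 1) * 1740 + 1740 = k + -m * 1740 by ring, ih] at this
    rw [eq_inv_mul_of_mul_eq this.symm, ← mul_assoc, ← zpow_neg_one, ← zpow_add]
    congr 2; ring

/-- type of the `k`th vertex -/
def ty (k : ℤ) : Bool := decide (k % 2 = 0)

theorem ty_succ (k : ℤ) : ty (k + 1) = !ty k := by
  unfold ty
  by_cases h : k % 2 = 0
  · rw [decide_eq_true h, decide_eq_false (by omega)]; rfl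
  · rw [decide_eq_false h, decide_eq_true (by omega)]; rfl

theorem u_mem (s : S) (k : ℤ) : D.u s k ∈ M.K (ty k) := by
  unfold u letter ty pw
  have h1 := D.gK s
  split_ifs with h
  · simpa [h] using D.hK s
  · simpa [h] using D.bK s
  · simpa [h] using h1
  · simpa [h] using h1

theorem u_not (s : S) (k : ℤ) : D.u s k ∉ M.A := by
  unfold u letter pw
  split_ifs with h
  · exact D.hA s
  · exact D.bA s
  · exact D.gA s
  · rw [inv_mem_iff]; exact D.gA s

/-- the axis -/
def ax (s : S) (k : ℤ) : M.Vert := M.vt (ty k) (D.p s k)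

theorem ax_eq (s : S) (k : ℤ) : D.ax s k = M.vt (ty k) (D.p s (k + 1)) := by
  unfold ax
  rw [vt_eq, p_succ]
  exact ⟨rfl, by simpa using D.u_mem s k⟩

theorem ax_eq' (s : S) (k : ℤ) : D.ax s (k - 1) = M.vt (!ty k) (D.p s k) := by
  rw [ax_eq, show k - 1 + 1 = k by ring]
  have := ty_succ (k - 1)
  rw [show k - 1 + 1 = k by ring] at this
  rw [this]; simp

theorem ax_line (s : S) : M.tree.metric.IsLine (D.ax s) := by
  apply M.isLine
  · intro i
    rw [ax_eq]
    exact ⟨ty i, _, rfl, by rw [ax, ty_succ]⟩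
  · intro i h
    rw [ax_eq, show i + 2 = i + 1 + 1 by ring, ax, vt_eq, D.p_succ s (i + 1)] at h
    apply D.u_not s (i + 1)
    rw [M.mem_A (ty (i + 1))]
    refine ⟨D.u_mem s _, ?_⟩
    rw [ty_succ]
    simpa using h.2

theorem ax_trans (s : S) (k : ℤ) : D.rr s • D.ax s k = D.ax s (k + 1740) := by
  unfold ax
  rw [smul_vt, p_period]
  congr 1
  unfold ty; congr 2; omega

theorem gmal {P : Type*} [Group P] {M : Amalgam P} {S : Type*} (D : M.RelData S) {j : Bool} {x a : P} (hx : x ∈ M.K j) (hxA : x ∉ M.A) (ha : a ∈ M.A)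
    (h : x⁻¹ * a * x ∈ M.A) : a = 1 :=
  D.mal j x⁻¹ (inv_mem hx) (by rwa [inv_mem_iff]) a ha (by rwa [inv_inv])

/-- algebraic part of the overlap analysis -/
theorem overlap_alg (s s' : S) (i j : ℤ) (rev : Bool) (c : ℤ → P) (hij : (i - j) % 2 = 0)
    (hc : ∀ k, 1 ≤ k → k ≤ 87 → c k ∈ M.A)
    (hu : ∀ k, 1 ≤ k → k ≤ 86 → D.u s (i + k) =
      c k * (if rev then (D.u s' (j - k))⁻¹ else D.u s' (j + k)) * (c (k + 1))⁻¹) :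
    rev = false ∧ s = s' ∧ (i - j) % 1740 = 0 ∧ c 1 = 1 := by
  obtain ⟨k0, hk0, hk1, hk2⟩ : ∃ k0 : ℤ, 1 ≤ k0 ∧ k0 ≤ 2 ∧ (i + k0) % 2 = 0 := by
    rcases Int.emod_two_eq_zero_or_one i with h | h
    · exact ⟨2, by omega, by omega, by omega⟩
    · exact ⟨1, by omega, by omega, by omega⟩
  obtain ⟨H', hH'⟩ : ∃ H', H' = if rev then (D.h s')⁻¹ else D.h s' := ⟨_, rfl⟩
  have hH'K : H' ∈ M.K true := by
    rw [hH']; split_ifs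
    · exact inv_mem (D.hK s')
    · exact D.hK s'
  have hH'A : H' ∉ M.A := by
    rw [hH']; split_ifs
    · rw [inv_mem_iff]; exact D.hA s'
    · exact D.hA s'
  have hl : ∀ t : ℕ, t ≤ 42 → D.h s = c (k0 + 2 * t) * H' * (c (k0 + 2 * t + 1))⁻¹ := by
    intro t ht
    have := hu (k0 + 2 * t) (by omega) (by omega)
    unfold u at this
    rw [letter_even _ _ _ (by omega), letter_even _ _ _ (by omega), letter_even _ _ _ (by omega)] at this
    rw [hH']; exact this
  have hcc : ∀ t : ℕ, t ≤ 42 → c (k0 + 2 * t) = c k0 ∧ c (k0 + 2 * t + 1) = c (k0 + 1) := by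
    intro t
    induction t with
    | zero => intro _; simp
    | succ t ih =>
      intro ht
      obtain ⟨i1, i2⟩ := ih (by omega)
      have e0 := hl t (by omega)
      have e1 := hl (t + 1) ht
      have m1 := hc (k0 + 2 * t) (by omega) (by omega)
      have m2 := hc (k0 + 2 * t + 1) (by omega) (by omega)
      have m3 := hc (k0 + 2 * ((t + 1 : ℕ) : ℤ)) (by omega) (by omega)
      have m4 := hc (k0 + 2 * ((t + 1 : ℕ) : ℤ) + 1) (by omega) (by omega)
      rw [i1, i2] at e0
      rw [i1] at m1
      rw [i2] at m2
      generalize c (k0 + 2 * ((t + 1 : ℕ) : ℤ)) = x at *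
      generalize c (k0 + 2 * ((t + 1 : ℕ) : ℤ) + 1) = y at *
      rw [e0] at e1
      have e2 : H'⁻¹ * (x⁻¹ * c k0) * H' = y⁻¹ * c (k0 + 1) := by
        have := congrArg (fun z => H'⁻¹ * x⁻¹ * z * c (k0 + 1)) e1
        simp only [mul_assoc, inv_mul_cancel, mul_one, inv_mul_cancel_left] at this
        simpa only [mul_assoc] using this
      have e3 : x⁻¹ * c k0 = 1 := D.gmal hH'K hH'A (mul_mem (inv_mem m3) m1)
        (by rw [e2]; exact mul_mem (inv_mem m4) m2)
      rw [e3] at e2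
      have e4 : y⁻¹ * c (k0 + 1) = 1 := by rw [← e2]; simp
      exact ⟨inv_mul_eq_one.1 e3, inv_mul_eq_one.1 e4⟩
  obtain ⟨I, hI⟩ : ∃ I, I = (i + k0) / 2 := ⟨_, rfl⟩
  obtain ⟨J, hJ⟩ : ∃ J, J = if rev then (j - k0) / 2 - 1 else (j + k0) / 2 := ⟨_, rfl⟩
  have gl : ∀ t : ℤ, 0 ≤ t → t < 42 → (I + t) % 870 ≠ 869 →
      (if rev then J - t else J + t) % 870 ≠ 869 →
      pw (D.g s) (dI (I + t)) =
        c (k0 + 1) * pw (D.g s') (xor rev (dI (if rev then J - t else J + t))) * (c k0)⁻¹ := by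
    intro t h0 h1 h2 h3
    have e := hu (k0 + 2 * t + 1) (by omega) (by omega)
    have f1 := hcc t.toNat (by omega)
    have f2 := hcc (t.toNat + 1) (by omega)
    rw [show (t.toNat : ℤ) = t by omega] at f1
    rw [show (((t.toNat + 1 : ℕ)) : ℤ) = t + 1 by omega] at f2
    rw [f1.2, show k0 + 2 * t + 1 + 1 = k0 + 2 * (t + 1) by ring, f2.1] at e
    unfold u at e
    have g1 : (i + (k0 + 2 * t + 1)) / 2 = I + t := by omega
    rw [letter_odd (k := i + (k0 + 2 * t + 1)) _ _ _ (by omega) (by rw [g1]; exact h2), g1] at e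
    rw [e]
    congr 2
    cases rev
    · simp only [Bool.false_eq_true, if_false, Bool.false_xor] at *
      have g2 : (j + (k0 + 2 * t + 1)) / 2 = J + t := by omega
      rw [letter_odd _ _ _ (by omega) (by rw [g2]; exact h3), g2]
    · simp only [if_true, Bool.true_xor] at *
      have g2 : (j - (k0 + 2 * t + 1)) / 2 = J - t := by omega
      rw [letter_odd _ _ _ (by omega) (by rw [g2]; exact h3), g2, pw_inv]
  obtain ⟨s0, hs0⟩ : ∃ s0 : Bool, ∀ t : ℤ, 0 ≤ t → t < 42 → (I + t) % 870 ≠ 869 →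
      (if rev then J - t else J + t) % 870 ≠ 869 →
      dI (I + t) = xor s0 (dI (if rev then J - t else J + t)) := by
    by_cases hex : ∃ t : ℤ, 0 ≤ t ∧ t < 42 ∧ (I + t) % 870 ≠ 869 ∧
      (if rev then J - t else J + t) % 870 ≠ 869
    · obtain ⟨t0, a1, a2, a3, a4⟩ := hex
      refine ⟨xor (dI (I + t0)) (dI (if rev then J - t0 else J + t0)), ?_⟩
      intro t b1 b2 b3 b4
      have g0 := gl t0 a1 a2 a3 a4
      have g1 := gl t b1 b2 b3 b4
      generalize dI (I + t0) = x0 at *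
      generalize dI (I + t) = x1 at *
      generalize dI (if rev then J - t0 else J + t0) = y0 at *
      generalize dI (if rev then J - t else J + t) = y1 at *
      have k1 : x0 = x1 → y0 = y1 := by
        rintro rfl
        rw [g0] at g1
        have := pw_inj (D.g2 s') (mul_left_cancel (mul_right_cancel g1))
        revert this; cases rev <;> cases y0 <;> cases y1 <;> simp
      have k2 : y0 = y1 → x0 = x1 := by
        rintro rfl
        rw [← g0] at g1
        exact (pw_inj (D.g2 s) g1).symm
      revert k1 k2
      cases x0 <;> cases x1 <;> cases y0 <;> cases y1 <;> simp
    · exact ⟨false, fun t b1 b2 b3 b4 => absurd ⟨t, b1, b2, b3, b4⟩ hex⟩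
  obtain ⟨w1, w2, w3⟩ := window I J rev s0 hs0
  subst w1 w2
  simp only [Bool.false_eq_true, if_false, Bool.false_xor] at *
  have sg : ∀ b : Bool, pw (D.g s) b = c (k0 + 1) * pw (D.g s') b * (c k0)⁻¹ := by
    intro b
    obtain ⟨t, t0, t1, t2, t3⟩ := both_signs I b
    have h3 : (J + t) % 870 ≠ 869 := by omega
    have h4 := gl t t0 t1 t2 h3
    rw [← hs0 t t0 t1 t2 h3, t3] at h4
    exact h4
  have sp := sg true
  have sn := sg false
  simp only [pw, Bool.false_eq_true, if_false, if_true] at sp sn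
  have m0 := hc k0 (by omega) (by omega)
  have m1 := hc (k0 + 1) (by omega) (by omega)
  have e1 : (D.g s')⁻¹ * ((c k0)⁻¹ * c (k0 + 1)) * D.g s' = (c (k0 + 1))⁻¹ * c k0 := by
    have h5 : D.g s = c k0 * D.g s' * (c (k0 + 1))⁻¹ := by
      rw [← inv_inj, sn]; group
    rw [h5] at sp
    have := congrArg (fun z => (D.g s')⁻¹ * (c k0)⁻¹ * z * c k0) sp
    simp only [mul_assoc, inv_mul_cancel, mul_one, inv_mul_cancel_left] at this
    simp only [mul_assoc]
    exact this.symm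
  have e2 : (c k0)⁻¹ * c (k0 + 1) = 1 := D.gmal (D.gK s') (D.gA s') (mul_mem (inv_mem m0) m1)
    (by rw [e1]; exact mul_mem (inv_mem m1) m0)
  have e3 : c k0 = c (k0 + 1) := inv_mul_eq_one.1 e2
  have hh := hl 0 (by omega)
  simp only [Nat.cast_zero, mul_zero, add_zero] at hh
  rw [← e3] at hh sp
  rw [hH'] at hh
  have hss : s = s' := D.cj s s' _ m0 hh sp
  subst hss
  have e4 : (D.h s)⁻¹ * c k0 * D.h s = c k0 := by
    have := congrArg (fun z => (D.h s)⁻¹ * z * c k0) hh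
    simp only [mul_assoc, inv_mul_cancel, mul_one, inv_mul_cancel_left, one_mul] at this
    simp only [mul_assoc]
    exact this.symm
  have e5 : c k0 = 1 := D.gmal (D.hK s) (D.hA s) m0 (by rw [e4]; exact m0)
  refine ⟨trivial, rfl, by omega, ?_⟩
  rcases (by omega : k0 = 1 ∨ k0 = 2) with rfl | rfl
  · exact e5
  · have hij' : (i - j) % 1740 = 0 := by omega
    have e6 := hu 1 (by omega) (by omega)
    rw [show (1 : ℤ) + 1 = 2 by norm_num, e5] at e6
    have e7 : D.u s (i + 1) = D.u s (j + 1) := by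
      unfold u letter dI
      rw [show (i + 1) % 2 = (j + 1) % 2 by omega, show (i + 1) / 2 % 870 = (j + 1) / 2 % 870 by omega]
    rw [e7] at e6
    simpa using e6

end RelData
end Amalgam
end JG

namespace JG

theorem TreeMetric.lines_match {V : Type*} (t : TreeMetric V) {l l' : ℤ → V} (h : t.IsLine l) (h' : t.IsLine l')
    {x y : V} (hx : x ∈ Set.range l) (hx' : x ∈ Set.range l') (hy : y ∈ Set.range l)
    (hy' : y ∈ Set.range l') (n : ℤ) (hn : n ≤ t.d x y) :
    ∃ i j : ℤ, (∀ k, 0 ≤ k → k ≤ n → l (i + k) = l' (j + k)) ∨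
      (∀ k, 0 ≤ k → k ≤ n → l (i + k) = l' (j - k)) := by
  have main : ∀ x y : V, ∀ i i' j j' : ℤ, l i = x → l' j = x → l i' = y → l' j' = y → i ≤ i' → n ≤ t.d x y →
      ∃ i j : ℤ, (∀ k, 0 ≤ k → k ≤ n → l (i + k) = l' (j + k)) ∨
      (∀ k, 0 ≤ k → k ≤ n → l (i + k) = l' (j - k)) := by
    intro x y i i' j j' h1 h2 h3 h4 hle hn
    have e1 := h i i'
    have e2 := h' j j'
    rw [h1, h3] at e1
    rw [h2, h4] at e2
    refine ⟨i, j, ?_⟩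
    rcases le_total j j' with hj | hj
    · left
      intro k k0 k1
      apply t.btw_unique (x := x) (y := y)
      · unfold TreeMetric.Btw
        rw [← h1, ← h3, h, h, h]; omega
      · unfold TreeMetric.Btw
        rw [← h2, ← h4, h', h', h']; omega
      · rw [← h1, h, h1, ← h2, h']; omega
    · right
      intro k k0 k1
      apply t.btw_unique (x := x) (y := y)
      · unfold TreeMetric.Btw
        rw [← h1, ← h3, h, h, h]; omega
      · unfold TreeMetric.Btw
        rw [← h2, ← h4, h', h', h']; omega
      · rw [← h1, h, h1, ← h2, h']; omega
  obtain ⟨i, hi⟩ := hx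
  obtain ⟨j, hj⟩ := hx'
  obtain ⟨i', hi'⟩ := hy
  obtain ⟨j', hj'⟩ := hy'
  rcases le_total i i' with hle | hle
  · exact main x y i i' j j' hi hj hi' hj' hle hn
  · exact main y x i' i j' j hi' hj' hi hj hle (by rw [t.symm]; exact hn)

namespace Amalgam
namespace RelData
variable {P : Type*} [Group P] {M : Amalgam P} {S : Type*} (D : M.RelData S)

theorem ty_eq {a b : ℤ} (h : ty a = ty b) : (a - b) % 2 = 0 := by
  unfold ty at h
  have := decide_eq_decide.1 h
  omega

theorem overlap (q : P) (s s' : S) {x y : M.Vert} (hx : x ∈ Set.range (D.ax s))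
    (hx' : x ∈ Set.range (fun i => q • D.ax s' i)) (hy : y ∈ Set.range (D.ax s))
    (hy' : y ∈ Set.range (fun i => q • D.ax s' i)) (hd : 86 < M.tree.metric.d x y) :
    s = s' ∧ q ∈ Subgroup.zpowers (D.rr s) := by
  have hl : M.tree.metric.IsLine (fun i => q • D.ax s' i) := by
    intro i j
    have := D.ax_line s' i j
    rw [← this]
    exact congrArg Nat.cast (M.tree_isom q _ _)
  obtain ⟨i, j, hm⟩ := M.tree.metric.lines_match (D.ax_line s) hl hx hx' hy hy' 87 (by omega)
  have fin : ∀ c1 : P, s = s' → (i - j) % 1740 = 0 → c1 = 1 →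
      c1 = (D.p s (i + 1))⁻¹ * (q * D.p s' (j + 1)) → s = s' ∧ q ∈ Subgroup.zpowers (D.rr s) := by
    rintro c1 rfl h1 rfl h2
    refine ⟨rfl, (i - j) / 1740, ?_⟩
    have h3 := D.p_period' s (j + 1) ((i - j) / 1740)
    rw [show j + 1 + (i - j) / 1740 * 1740 = i + 1 by omega] at h3
    have h4 : D.p s (i + 1) = q * D.p s (j + 1) := inv_mul_eq_one.1 h2.symm
    rw [h4] at h3
    exact (mul_right_cancel h3).symm
  rcases hm with hm | hm
  · have hm1 := hm 0 (by omega) (by omega)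
    simp only [add_zero] at hm1
    rw [ax, ax, smul_vt, vt_eq] at hm1
    have hpar := ty_eq hm1.1
    obtain ⟨h1, h2, h3, h4⟩ := D.overlap_alg s s' i j false
      (fun k => (D.p s (i + k))⁻¹ * (q * D.p s' (j + k))) hpar (by
        intro k k1 k2
        rw [M.mem_A (ty (i + k))]
        constructor
        · have := hm k (by omega) (by omega)
          rw [ax, ax, smul_vt, vt_eq] at this
          exact this.2
        · have := hm (k - 1) (by omega) (by omega)
          simp only [← add_sub_assoc] at this
          rw [ax_eq', ax_eq', smul_vt, vt_eq] at this
          exact this.2) (by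
        intro k k1 k2
        simp only [Bool.false_eq_true, if_false]
        rw [← add_assoc, ← add_assoc, p_succ, p_succ]
        group)
    exact fin _ h2 h3 h4 rfl
  · have hm1 := hm 0 (by omega) (by omega)
    simp only [add_zero, sub_zero] at hm1
    rw [ax, ax, smul_vt, vt_eq] at hm1
    have hpar := ty_eq hm1.1
    obtain ⟨h1, h2, h3, h4⟩ := D.overlap_alg s s' i j true
      (fun k => (D.p s (i + k))⁻¹ * (q * D.p s' (j - k + 1))) hpar (by
        intro k k1 k2
        rw [M.mem_A (ty (i + k))]
        constructor
        · have := hm k (by omega) (by omega)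
          rw [ax, ax_eq, smul_vt, vt_eq] at this
          exact this.2
        · have := hm (k - 1) (by omega) (by omega)
          rw [← add_sub_assoc, show j - (k - 1) = j - k + 1 by ring] at this
          rw [ax_eq', ax, smul_vt, vt_eq] at this
          exact this.2) (by
        intro k k1 k2
        simp only [if_true]
        rw [show j - (k + 1) + 1 = j - k by ring, ← add_assoc, p_succ, p_succ]
        group)
    cases h1

theorem ax_trans' (s : S) (k m : ℤ) : D.rr s ^ m • D.ax s k = D.ax s (k + m * 1740) := by
  unfold ax
  rw [smul_vt, p_period']
  congr 1
  unfold ty; congr 2; omega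

/-- index set of lines -/
abbrev Idx (D : M.RelData S) := Σ s : S, P ⧸ Subgroup.zpowers (D.rr s)

/-- a representative -/
noncomputable def rp (a : D.Idx) : P := Quotient.out a.2

theorem rp_eq (a : D.Idx) : ((D.rp a : P) : P ⧸ Subgroup.zpowers (D.rr a.1)) = a.2 := Quotient.out_eq _

theorem rp_smul (p : P) (a : D.Idx) : ∃ m : ℤ, D.rp (p • a) = p * D.rp a * D.rr a.1 ^ m := by
  have h1 := D.rp_eq (p • a)
  have h2 : ((p * D.rp a : P) : P ⧸ Subgroup.zpowers (D.rr a.1)) = p • a.2 := by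
    rw [← D.rp_eq a]; rfl
  have h3 : ((p * D.rp a : P) : P ⧸ Subgroup.zpowers (D.rr a.1)) = (D.rp (p • a) : P) := by
    rw [h2]; exact h1.symm
  obtain ⟨m, hm⟩ := QuotientGroup.eq.1 h3
  dsimp only at hm
  exact ⟨m, by rw [hm]; group⟩

/-- the small cancellation system -/
noncomputable def sc : SC P M.Vert D.Idx where
  t := M.tree.metric
  isom p x y := congrArg Nat.cast (M.tree_isom p x y)
  r a := D.rp a * D.rr a.1 * (D.rp a)⁻¹
  l a i := D.rp a • D.ax a.1 i
  line a i j := by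
    rw [← D.ax_line a.1 i j]
    exact congrArg Nat.cast (M.tree_isom _ _ _)
  R := 1740
  E := 86
  trans a i := by
    rw [← ax_trans, smul_smul, smul_smul]; congr 1; group
  conj p a := by
    obtain ⟨m, hm⟩ := D.rp_smul p a
    rw [hm]
    change p * D.rp a * D.rr a.1 ^ m * D.rr a.1 * _ = _
    group
  mv p a i := by
    obtain ⟨m, hm⟩ := D.rp_smul p a
    refine ⟨i + (-m) * 1740, ?_⟩
    simp only []
    rw [hm]
    change _ • D.ax a.1 _ = _
    rw [← ax_trans', smul_smul, smul_smul]
    congr 1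
    group
  ov := by
    intro a b hab x y hx hx' hy hy'
    by_contra hlt
    apply hab
    have key : ∀ z, ∀ a : D.Idx, ∀ q : P, z ∈ Set.range (fun i => D.rp a • D.ax a.1 i) →
      q⁻¹ • z ∈ Set.range (fun i => (q⁻¹ * D.rp a) • D.ax a.1 i) := by
      rintro z a q ⟨i, rfl⟩
      exact ⟨i, by simp only [mul_smul]⟩
    have key' : ∀ z, z ∈ Set.range (fun i => D.rp a • D.ax a.1 i) →
      (D.rp a)⁻¹ • z ∈ Set.range (D.ax a.1) := by
      rintro z ⟨i, rfl⟩
      exact ⟨i, by simp⟩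
    have h := D.overlap ((D.rp a)⁻¹ * D.rp b) a.1 b.1 (key' x hx) (key x b _ hx') (key' y hy)
      (key y b _ hy') (by
        have : M.tree.metric.d ((D.rp a)⁻¹ • x) ((D.rp a)⁻¹ • y) = M.tree.metric.d x y :=
          congrArg Nat.cast (M.tree_isom _ _ _)
        rw [this]; omega)
    have e1 := D.rp_eq a
    have e2 := D.rp_eq b
    obtain ⟨s, a⟩ := a
    obtain ⟨s', b⟩ := b
    obtain ⟨h1, h2⟩ := h
    dsimp only at h1
    subst h1
    have h3 := QuotientGroup.eq.2 h2
    dsimp only at e1 e2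
    rw [← e1, ← e2, h3]
  hE := by norm_num
  hR := by norm_num

theorem sc_stab (p : P) (a : D.Idx) (h : p • a = a) : p ∈ Subgroup.zpowers (D.sc.r a) := by
  obtain ⟨m, hm⟩ := D.rp_smul p a
  rw [h] at hm
  refine ⟨-m, ?_⟩
  change (D.rp a * D.rr a.1 * (D.rp a)⁻¹) ^ (-m) = p
  rw [conj_zpow]
  have : p = D.rp a * (D.rp a * D.rr a.1 ^ m)⁻¹ := by
    apply eq_mul_inv_of_mul_eq
    rw [← mul_assoc]; exact hm.symm
  rw [this]; group

theorem rr_mem (s : S) : D.rr s ∈ D.sc.N := by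
  have := D.sc.r_mem_N (⟨s, ((1 : P) : P ⧸ Subgroup.zpowers (D.rr s))⟩ : D.Idx)
  have h2 := D.sc.N_normal.conj_mem _ this (D.rp ⟨s, ((1 : P) : P ⧸ Subgroup.zpowers (D.rr s))⟩)⁻¹
  change _ * (_ * D.rr s * _) * _ ∈ _ at h2
  convert h2 using 1
  group

theorem N_eq : D.sc.N = Subgroup.normalClosure (Set.range D.rr) := by
  apply le_antisymm
  · change Subgroup.closure _ ≤ _
    rw [Subgroup.closure_le]
    rintro _ ⟨a, rfl⟩
    exact Subgroup.normalClosure_normal.conj_mem _ (Subgroup.subset_normalClosure (Set.mem_range_self a.1)) _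
  · have := D.sc.N_normal
    apply Subgroup.normalClosure_le_normal
    rintro _ ⟨a, rfl⟩
    exact D.rr_mem a

end RelData
end Amalgam
end JG

namespace JG
open Monoid Monoid.PushoutI

universe u

/-- the step: amalgamated product with small cancellation relators. -/
theorem step {A : Type u} {G : Bool → Type u} [Group A] [∀ i, Group (G i)] (φ : ∀ i, A →* G i)
    (hφ : ∀ i, Function.Injective (φ i))
    (tf : ∀ i (x : G i) (m : ℕ), 0 < m → x ^ m = 1 → x = 1)
    (mal : ∀ i (x : G i), x ∉ (φ i).range → ∀ a, x * φ i a * x⁻¹ ∈ (φ i).range → a = 1)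
    {S : Type*} (h : S → G true) (g b : S → G false)
    (hA : ∀ s, h s ∉ (φ true).range) (gA : ∀ s, g s ∉ (φ false).range)
    (bA : ∀ s, b s ∉ (φ false).range)
    (cj : ∀ s s' a, h s = φ true a * h s' * (φ true a)⁻¹ → g s = φ false a * g s' * (φ false a)⁻¹ → s = s') :
    ∃ (L : Type u) (_ : Group L) (j : ∀ i, G i →* L),
      (∀ a, j false (φ false a) = j true (φ true a)) ∧
      (∀ i, Function.Injective (j i)) ∧
      (∀ i (x : G i), j i x ∈ (j (!i)).range → x ∈ (φ i).range) ∧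
      (∀ i (x : L), x ∉ (j i).range → ∀ y, x * j i y * x⁻¹ ∈ (j i).range → y = 1) ∧
      (∀ (x : L) (m : ℕ), 0 < m → x ^ m = 1 → x = 1) ∧
      (∀ s, relr (j true (h s)) (j false (g s)) (j false (b s)) = 1) ∧
      (∀ (Q : Type u) [Group Q] (ψ : ∀ i, G i →* Q),
        (∀ a, ψ false (φ false a) = ψ true (φ true a)) →
        (∀ s, relr (ψ true (h s)) (ψ false (g s)) (ψ false (b s)) = 1) →
        ∃ Ψ : L →* Q, ∀ i x, Ψ (j i x) = ψ i x) := by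
  obtain ⟨d⟩ := NormalWord.transversal_nonempty φ hφ
  let M := pushAmalgam d hφ
  have hof : ∀ i, Function.Injective (of (φ := φ) i) := of_injective hφ
  have memA : ∀ i (x : G i), (of i x : PushoutI φ) ∈ M.A ↔ x ∈ (φ i).range := by
    intro i x
    rw [M.mem_A i, ← mem_other i x hφ]
    exact ⟨fun h => h.2, fun h => ⟨⟨x, rfl⟩, h⟩⟩
  have hM : M.Mal := by
    rintro i _ ⟨x, rfl⟩ hx a ha hxa
    rw [memA] at hx
    obtain ⟨y, rfl⟩ : ∃ y, of (φ := φ) i y = a := ((M.mem_A i).1 ha).1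
    obtain ⟨z, rfl⟩ := (memA i y).1 ha
    have h2 : (of i (x * φ i z * x⁻¹) : PushoutI φ) ∈ M.A := by
      simpa only [map_mul, map_inv] using hxa
    rw [memA] at h2
    rw [mal i x hx z h2]; simp
  let D : M.RelData S :=
    { h := fun s => of true (h s)
      g := fun s => of false (g s)
      b := fun s => of false (b s)
      hK := fun s => ⟨h s, rfl⟩
      gK := fun s => ⟨g s, rfl⟩
      bK := fun s => ⟨b s, rfl⟩
      hA := fun s => by rw [memA]; exact hA s
      gA := fun s => by rw [memA]; exact gA s
      bA := fun s => by rw [memA]; exact bA s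
      g2 := fun s => by
        intro h2
        apply gA s
        rw [← map_pow] at h2
        have h3 := hof false (h2.trans (map_one _).symm)
        rw [tf false _ 2 (by norm_num) h3]
        exact one_mem _
      cj := by
        intro s s' a ha h1 h2
        obtain ⟨y, rfl⟩ : ∃ y, of (φ := φ) false y = a := ((M.mem_A false).1 ha).1
        obtain ⟨z, rfl⟩ := (memA _ y).1 ha
        apply cj s s' z
        · apply hof
          rw [of_apply_eq_base, ← of_apply_eq_base φ true] at h1
          simpa using h1
        · apply hof
          simpa using h2
      mal := hM }
  have stab : ∀ j (q : PushoutI φ), q • M.vt j 1 = M.vt j 1 ↔ q ∈ (of (φ := φ) j).range := by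
    intro j q
    rw [M.stab_vt]
    simp only [inv_one, one_mul, mul_one]
    rfl
  have hdist : ∀ x y : M.Vert, D.sc.t.d x y = (M.tree.F x y : ℤ) := fun _ _ => rfl
  have hE : D.sc.E = 86 := rfl
  have hR : D.sc.R = 1740 := rfl
  haveI := D.sc.N_normal
  refine ⟨PushoutI φ ⧸ D.sc.N, inferInstance, fun i => (QuotientGroup.mk' D.sc.N).comp (of i), ?_, ?_, ?_, ?_, ?_, ?_, ?_⟩
  · intro a
    simp [of_apply_eq_base]
  · intro i
    rw [injective_iff_map_eq_one]
    intro x hx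
    have hx1 : (of i x : PushoutI φ) ∈ D.sc.N := (QuotientGroup.eq_one_iff _).1 hx
    have := D.sc.eq_one_of_fix hx1 ((stab i _).2 ⟨x, rfl⟩)
    exact hof i (this.trans (map_one _).symm)
  · rintro i x ⟨y, hy⟩
    have hn : (of (!i) y : PushoutI φ)⁻¹ * of i x ∈ D.sc.N := QuotientGroup.eq.1 hy
    have h1 : (of (!i) y : PushoutI φ)⁻¹ * of i x = 1 := by
      apply D.sc.eq_one_of_small (v := M.vt i 1) hn
      rw [hE, hR, hdist, mul_smul, (stab i _).2 ⟨x, rfl⟩]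
      have t1 := M.tree.adj1 (M.adj_vt i 1)
      have t2 := M.tree_isom (of (!i) y : PushoutI φ)⁻¹ (M.vt (!i) 1) (M.vt i 1)
      rw [(stab (!i) _).2 ⟨y⁻¹, map_inv _ _⟩] at t2
      have t3 := M.tree.tri (M.vt i 1) (M.vt (!i) 1) ((of (!i) y : PushoutI φ)⁻¹ • M.vt i 1)
      have t4 := M.tree.symm (M.vt i 1) (M.vt (!i) 1)
      omega
    rw [← mem_other i x hφ]
    exact ⟨y, inv_mul_eq_one.1 h1⟩
  · rintro i x hx y ⟨y', hy'⟩
    by_contra hy1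
    obtain ⟨p, rfl⟩ := QuotientGroup.mk'_surjective D.sc.N x
    obtain ⟨n, hn, h2⟩ := D.sc.malnormal (M.vt i 1) (D.sc_stab) (by
      intro p x h1 h2 h3
      refine M.fix_vert hM (x := M.vt i 1) (v := x • M.vt i 1) ?_ p h1 h2
      have e1 := M.tree_even (M.vt i 1) (x • M.vt i 1) rfl
      have e2 : M.tree.F (M.vt i 1) (x • M.vt i 1) ≠ 0 := fun h => h3 ((M.tree.z _ _).1 h)
      omega) p (of i y) (of i y') ((stab i _).2 ⟨y, rfl⟩) ((stab i _).2 ⟨y', rfl⟩)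
      (fun h => hy1 (hof i (h.trans (map_one _).symm))) (by
        have := QuotientGroup.eq.1 hy'
        have h3 := D.sc.N_normal.conj_mem _ this (of i y')
        simpa [mul_assoc] using h3)
    apply hx
    obtain ⟨z, hz⟩ := (stab i _).1 h2
    refine ⟨z, ?_⟩
    change ((of i z : PushoutI φ) : PushoutI φ ⧸ D.sc.N) = (p : PushoutI φ ⧸ D.sc.N)
    rw [hz]
    apply Eq.symm
    rw [QuotientGroup.eq]
    simpa using hn
  · intro x m hm hx
    obtain ⟨p, rfl⟩ := QuotientGroup.mk'_surjective D.sc.N x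
    have hx1 : p ^ m ∈ D.sc.N := by
      rw [← map_pow] at hx
      exact (QuotientGroup.eq_one_iff _).1 hx
    haveI : Nonempty M.Vert := ⟨M.vt true 1⟩
    refine (QuotientGroup.eq_one_iff _).2 (D.sc.torsionfree ?_ D.sc_stab ?_ p m hm hx1)
    · intro p v
      have := M.tree_even v (p • v) rfl
      rw [hdist]; omega
    · intro p v hv m hm hpm
      obtain ⟨j, q, rfl⟩ := M.exists_vt v
      obtain ⟨z, hz⟩ : ∃ z, of (φ := φ) j z = q⁻¹ * p * q := (M.stab_vt _ _ _).1 hv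
      have h1 : z ^ m = 1 := by
        apply hof j
        rw [map_pow, hz, map_one]
        have := conj_pow (i := m) (a := q⁻¹) (b := p)
        rw [inv_inv] at this
        rw [this, hpm]; simp
      rw [tf j z m hm h1, map_one] at hz
      have : p = q * (q⁻¹ * p * q) * q⁻¹ := by group
      rw [this, ← hz]; simp
  · intro s
    have := D.rr_mem s
    have h1 : QuotientGroup.mk' D.sc.N (D.rr s) = 1 := (QuotientGroup.eq_one_iff _).2 this
    rw [Amalgam.RelData.rr, map_relr] at h1
    exact h1
  · intro Q _ ψ hψ hr
    let Ψ0 : PushoutI φ →* Q := PushoutI.lift ψ ((ψ true).comp (φ true)) (by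
      intro i; ext a; cases i
      · exact hψ a
      · rfl)
    have hΨ : ∀ i x, Ψ0 (of i x) = ψ i x := fun i x => by simp [Ψ0]
    refine ⟨QuotientGroup.lift D.sc.N Ψ0 ?_, ?_⟩
    · have : D.sc.N ≤ Ψ0.ker := by
        rw [D.N_eq]
        apply Subgroup.normalClosure_le_normal
        rintro _ ⟨s, rfl⟩
        change Ψ0 (D.rr s) = 1
        rw [Amalgam.RelData.rr, map_relr]
        change relr (Ψ0 (of true _)) (Ψ0 (of false _)) (Ψ0 (of false _)) = 1
        rw [hΨ, hΨ, hΨ]; exact hr s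
      exact this
    · intro i x
      exact hΨ i x

end JG

namespace JG

universe u
section Internal
variable {F : Type u} [Group F]

/-- `N` is a normal subgroup of `K` -/
structure Pr (K N : Subgroup F) : Prop where
  le : N ≤ K
  conj : ∀ k ∈ K, ∀ n ∈ N, k * n * k⁻¹ ∈ N

/-- `K/N` is torsion free -/
def TF (K N : Subgroup F) : Prop := ∀ x ∈ K, ∀ m : ℕ, 0 < m → x ^ m ∈ N → x ∈ N

/-- `K₀/N₀` embeds as malnormal subgroup of `K/N` -/
structure Nice (K0 N0 K N : Subgroup F) : Prop where
  leK : K0 ≤ K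
  leN : N0 ≤ N
  emb : ∀ x ∈ K0, x ∈ N → x ∈ N0
  mal : ∀ x ∈ K, ∀ y ∈ K0, ∀ y' ∈ K0, x * y * x⁻¹ * y'⁻¹ ∈ N → y ∈ N0 ∨ ∃ z ∈ K0, x⁻¹ * z ∈ N

theorem Pr.normal {K N : Subgroup F} (h : Pr K N) : (N.subgroupOf K).Normal := by
  constructor
  rintro ⟨n, hn⟩ hn' ⟨k, hk⟩
  rw [Subgroup.mem_subgroupOf] at *
  exact h.conj k hk n hn'

theorem mk_eq {K N : Subgroup F} (x y : K) :
    ((x : K) : K ⧸ N.subgroupOf K) = (y : K) ↔ (x : F)⁻¹ * y ∈ N := by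
  rw [QuotientGroup.eq, Subgroup.mem_subgroupOf]; rfl

theorem mk_one {K N : Subgroup F} [(N.subgroupOf K).Normal] (x : K) :
    ((x : K) : K ⧸ N.subgroupOf K) = 1 ↔ (x : F) ∈ N := by
  rw [QuotientGroup.eq_one_iff, Subgroup.mem_subgroupOf]

theorem istep (K0 N0 : Subgroup F) (K N : Bool → Subgroup F) (KL NL : Subgroup F)
    (p0 : Pr K0 N0) (p : ∀ i, Pr (K i) (N i)) (pL : Pr KL NL)
    (nice : ∀ i, Nice K0 N0 (K i) (N i)) (tf : ∀ i, TF (K i) (N i))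
    (hKL : KL = K false ⊔ K true)
    (free : ∀ (Q : Type u) [Group Q] (ψ : ∀ i, K i →* Q),
      (∀ x, ∀ hx : x ∈ K0, ψ false ⟨x, (nice false).leK hx⟩ = ψ true ⟨x, (nice true).leK hx⟩) →
      ∃ Ψ : F →* Q, ∀ i (x : K i), Ψ x = ψ i x)
    {S : Type*} (h g b : S → F) (hK : ∀ s, h s ∈ K true) (gK : ∀ s, g s ∈ K false) (bK : ∀ s, b s ∈ K false)
    (hNL : NL = Subgroup.closure {x | ∃ w ∈ KL, ∃ r, (r ∈ N false ∨ r ∈ N true ∨ ∃ s, r = relr (h s) (g s) (b s)) ∧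
      x = w * r * w⁻¹})
    (hA : ∀ s, ∀ z ∈ K0, (h s)⁻¹ * z ∉ N true)
    (gA : ∀ s, ∀ z ∈ K0, (g s)⁻¹ * z ∉ N false)
    (bA : ∀ s, ∀ z ∈ K0, (b s)⁻¹ * z ∉ N false)
    (cj : ∀ s s', ∀ a ∈ K0, (h s)⁻¹ * (a * h s' * a⁻¹) ∈ N true →
      (g s)⁻¹ * (a * g s' * a⁻¹) ∈ N false → s = s') :
    (∀ i, Nice (K i) (N i) KL NL) ∧ TF KL NL ∧
    (∀ i, ∀ x ∈ K i, ∀ y ∈ K (!i), x⁻¹ * y ∈ NL → ∃ z ∈ K0, x⁻¹ * z ∈ N i) := by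
  have i0 := p0.normal
  have ii := fun i => (p i).normal
  have iL := pL.normal
  have hKi : ∀ i, K i ≤ KL := by
    intro i; rw [hKL]; cases i
    · exact le_sup_left
    · exact le_sup_right
  have hNi : ∀ i, N i ≤ NL := by
    intro i x hx
    rw [hNL]
    apply Subgroup.subset_closure
    refine ⟨1, one_mem _, x, ?_, by simp⟩
    cases i
    · exact Or.inl hx
    · exact Or.inr (Or.inl hx)
  have hrL : ∀ s, relr (h s) (g s) (b s) ∈ NL := by
    intro s
    rw [hNL]
    exact Subgroup.subset_closure ⟨1, one_mem _, _, Or.inr (Or.inr ⟨s, rfl⟩), by simp⟩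
  let G : Bool → Type u := fun i => K i ⧸ (N i).subgroupOf (K i)
  let φ : ∀ i, (K0 ⧸ N0.subgroupOf K0) →* G i := fun i =>
    QuotientGroup.map _ _ (Subgroup.inclusion (nice i).leK) (fun x hx => by
      rw [Subgroup.mem_comap, Subgroup.mem_subgroupOf]
      exact (nice i).leN hx)
  have hφm : ∀ i (x : K0), φ i (x : K0) = ((⟨x, (nice i).leK x.2⟩ : K i) : K i ⧸ (N i).subgroupOf (K i)) :=
    fun i x => rfl
  have rng : ∀ i (x : K i), ((x : K i) : G i) ∈ (φ i).range ↔ ∃ z ∈ K0, (x : F)⁻¹ * z ∈ N i := by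
    intro i x
    constructor
    · rintro ⟨a, ha⟩
      obtain ⟨y, rfl⟩ := QuotientGroup.mk_surjective a
      rw [hφm] at ha
      exact ⟨y, y.2, (mk_eq _ _).1 ha.symm⟩
    · rintro ⟨z, hz, hm⟩
      refine ⟨((⟨z, hz⟩ : K0) : K0 ⧸ N0.subgroupOf K0), ?_⟩
      rw [hφm]
      exact ((mk_eq _ _).2 hm).symm
  obtain ⟨L, iLg, j, jA, jinj, jint, jmal, jtf, jr, juniv⟩ := step φ
    (by
      intro i
      rw [injective_iff_map_eq_one]
      intro a ha
      obtain ⟨y, rfl⟩ := QuotientGroup.mk_surjective a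
      rw [hφm, mk_one] at ha
      rw [mk_one]
      exact (nice i).emb _ y.2 ha)
    (by
      intro i x m hm hx
      obtain ⟨y, rfl⟩ := QuotientGroup.mk_surjective x
      have h1 : ((y ^ m : K i) : K i ⧸ (N i).subgroupOf (K i)) = 1 := hx
      rw [mk_one] at h1
      exact (mk_one _).2 (tf i y y.2 m hm (by simpa using h1)))
    (by
      intro i x hx a ha
      obtain ⟨y, rfl⟩ := QuotientGroup.mk_surjective a
      obtain ⟨x, rfl⟩ := QuotientGroup.mk_surjective x
      rw [rng] at hx
      rw [hφm] at ha
      obtain ⟨z, hz, hm⟩ := (rng i (x * (⟨y, (nice i).leK y.2⟩ : K i) * x⁻¹)).1 ha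
      rw [mk_one]
      refine ((nice i).mal x x.2 y y.2 z hz ?_).resolve_right hx
      have hm2 := (p i).conj z ((nice i).leK hz) _ (inv_mem hm)
      simpa [mul_assoc] using hm2)
    (S := S)
    (fun s => (((⟨h s, hK s⟩ : K true) : K true ⧸ (N true).subgroupOf (K true)) : G true))
    (fun s => (((⟨g s, gK s⟩ : K false) : K false ⧸ (N false).subgroupOf (K false)) : G false))
    (fun s => (((⟨b s, bK s⟩ : K false) : K false ⧸ (N false).subgroupOf (K false)) : G false))
    (by intro s hs; obtain ⟨z, hz, hm⟩ := (rng true _).1 hs; exact hA s z hz hm)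
    (by intro s hs; obtain ⟨z, hz, hm⟩ := (rng false _).1 hs; exact gA s z hz hm)
    (by intro s hs; obtain ⟨z, hz, hm⟩ := (rng false _).1 hs; exact bA s z hz hm)
    (by
      intro s s' a h1 h2
      obtain ⟨y, rfl⟩ := QuotientGroup.mk_surjective a
      exact cj s s' y y.2 ((mk_eq ⟨h s, hK s⟩ (⟨y, (nice true).leK y.2⟩ * ⟨h s', hK s'⟩ * ⟨y, (nice true).leK y.2⟩⁻¹)).1 h1)
        ((mk_eq ⟨g s, gK s⟩ (⟨y, (nice false).leK y.2⟩ * ⟨g s', gK s'⟩ * ⟨y, (nice false).leK y.2⟩⁻¹)).1 h2))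
  let q : ∀ i, K i →* G i := fun i => QuotientGroup.mk' _
  have q1 : ∀ i (x : K i), q i x = 1 ↔ (x : F) ∈ N i := fun i x => mk_one x
  obtain ⟨Ψ, hΨ⟩ := free L (fun i => (j i).comp (q i)) (fun x hx => jA ((⟨x, hx⟩ : K0) : K0 ⧸ N0.subgroupOf K0))
  have hΨ' : ∀ i (x : F) (hx : x ∈ K i), Ψ x = j i (q i ⟨x, hx⟩) := fun i x hx => hΨ i ⟨x, hx⟩
  -- kernel
  have ker1 : ∀ x ∈ NL, Ψ x = 1 := by
    intro x hx
    have : NL ≤ Ψ.ker := by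
      rw [hNL, Subgroup.closure_le]
      rintro _ ⟨w, hw, r, hr, rfl⟩
      have hr1 : Ψ r = 1 := by
        rcases hr with hr | hr | ⟨s, rfl⟩
        · rw [hΨ' false r ((p false).le hr), (q1 _ _).2 hr, map_one]
        · rw [hΨ' true r ((p true).le hr), (q1 _ _).2 hr, map_one]
        · rw [map_relr, hΨ' true _ (hK s), hΨ' false _ (gK s), hΨ' false _ (bK s)]
          exact jr s
      change Ψ _ = 1
      rw [map_mul, map_mul, hr1, map_inv]; simp
    exact this hx
  obtain ⟨Ψ', hΨ2⟩ := juniv (KL ⧸ NL.subgroupOf KL)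
    (fun i => QuotientGroup.map _ _ (Subgroup.inclusion (hKi i)) (fun x hx => by
      rw [Subgroup.mem_comap, Subgroup.mem_subgroupOf]
      exact hNi i hx))
    (by
      intro a
      obtain ⟨y, rfl⟩ := QuotientGroup.mk_surjective a
      rfl)
    (by
      intro s
      have := map_relr (QuotientGroup.mk' (NL.subgroupOf KL)) (⟨h s, hKi true (hK s)⟩ : KL) ⟨g s, hKi false (gK s)⟩ ⟨b s, hKi false (bK s)⟩
      refine this.symm.trans ?_
      refine (mk_one _).2 ?_
      have h2 := map_relr KL.subtype (⟨h s, hKi true (hK s)⟩ : KL) ⟨g s, hKi false (gK s)⟩ ⟨b s, hKi false (bK s)⟩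
      have h3 := hrL s
      rw [Subgroup.subtype_apply] at h2
      rw [h2]; exact h3)
  have comp : ∀ x : KL, Ψ' (Ψ x) = ((x : KL) : KL ⧸ NL.subgroupOf KL) := by
    have : KL ≤ ((Ψ'.comp (Ψ.comp KL.subtype)).eqLocus (QuotientGroup.mk' (NL.subgroupOf KL))).map KL.subtype := by
      have hi : ∀ i, K i ≤ ((Ψ'.comp (Ψ.comp KL.subtype)).eqLocus (QuotientGroup.mk' (NL.subgroupOf KL))).map KL.subtype := by
        intro i x hx
        refine ⟨⟨x, hKi i hx⟩, ?_, rfl⟩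
        change Ψ' (Ψ x) = _
        rw [hΨ' i x hx, hΨ2]
        rfl
      conv_lhs => rw [hKL]
      exact sup_le (hi false) (hi true)
    intro x
    obtain ⟨y, hy, hyx⟩ := this x.2
    have : y = x := Subtype.ext hyx
    subst this
    exact hy
  have ker2 : ∀ x ∈ KL, Ψ x = 1 → x ∈ NL := by
    intro x hx h1
    have := comp ⟨x, hx⟩
    rw [h1, map_one] at this
    exact (mk_one _).1 this.symm
  refine ⟨fun i => ⟨hKi i, hNi i, ?_, ?_⟩, ?_, ?_⟩
  · intro x hx hxL
    have h1 := ker1 x hxL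
    rw [hΨ' i x hx] at h1
    exact (q1 _ _).1 (jinj i (h1.trans (map_one _).symm))
  · intro x hx y hy y' hy' hm
    have h1 := ker1 _ hm
    rw [map_mul, map_mul, map_mul, map_inv, map_inv, hΨ' i y hy, hΨ' i y' hy'] at h1
    by_cases hr : Ψ x ∈ (j i).range
    · right
      obtain ⟨a, ha⟩ := hr
      obtain ⟨z, rfl⟩ := QuotientGroup.mk_surjective a
      refine ⟨z, z.2, ker2 _ (mul_mem (inv_mem hx) (hKi i z.2)) ?_⟩
      rw [map_mul, map_inv, hΨ i z]
      exact inv_mul_eq_one.2 ha.symm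
    · left
      have := jmal i (Ψ x) hr _ ⟨_, (mul_inv_eq_one.1 h1).symm⟩
      exact (q1 _ _).1 this
  · intro x hx m hm h1
    have h2 := ker1 _ h1
    rw [map_pow] at h2
    exact ker2 x hx (jtf _ m hm h2)
  · intro i x hx y hy hm
    have h1 := ker1 _ hm
    rw [map_mul, map_inv, hΨ' i x hx, hΨ' (!i) y hy] at h1
    exact (rng i _).1 (jint i _ ⟨_, (inv_mul_eq_one.1 h1).symm⟩)

end Internal
end JG

namespace JG
set_option linter.unusedSectionVars false

universe u v w

/-- combinatorial data for the construction -/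
structure Sys (X : Type u) (Ξ : Type v) (M : Type w) [LinearOrder X] [LinearOrder M] where
  ρ : X → X → M
  coh : ∀ γ' γ δ α, γ' < δ → γ < δ → δ < α →
    (ρ γ' δ < ρ γ δ ∨ (ρ γ' δ = ρ γ δ ∧ γ' < γ)) →
    (ρ γ' α < ρ γ α ∨ (ρ γ' α = ρ γ α ∧ γ' < γ)) ∨ (ρ γ' α < ρ δ α ∨ (ρ γ' α = ρ δ α ∧ γ' < δ))
  hw : Ξ → X → FreeGroup X
  gw : Ξ → X → FreeGroup X
  fw : Ξ → X → X → FreeGroup X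

/-- subgroup of the free group generated by `s` -/
def Fs {X : Type u} (s : Set X) : Subgroup (FreeGroup X) := Subgroup.closure (FreeGroup.of '' s)

/-- relative normal closure -/
def Nr {X : Type u} [LinearOrder X] (R : X → X → Set (FreeGroup X)) (s : Set X) : Subgroup (FreeGroup X) :=
  Subgroup.closure {x | ∃ w ∈ Fs s, ∃ γ ∈ s, ∃ δ ∈ s, γ < δ ∧ ∃ r ∈ R γ δ, x = w * r * w⁻¹}

theorem Fs_mono {X : Type u} {s t : Set X} (h : s ⊆ t) : Fs s ≤ Fs t :=
  Subgroup.closure_mono (Set.image_mono h)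

theorem of_mem {X : Type u} {s : Set X} {x : X} (h : x ∈ s) : FreeGroup.of x ∈ Fs s :=
  Subgroup.subset_closure ⟨x, h, rfl⟩

theorem Nr_mono {X : Type u} [LinearOrder X] {R : X → X → Set (FreeGroup X)} {s t : Set X} (h : s ⊆ t) :
    Nr R s ≤ Nr R t := by
  apply Subgroup.closure_mono
  rintro x ⟨w, hw, γ, hγ, δ, hδ, hlt, r, hr, rfl⟩
  exact ⟨w, Fs_mono h hw, γ, h hγ, δ, h hδ, hlt, r, hr, rfl⟩

namespace Sys
variable {X : Type u} {Ξ : Type v} {M : Type w} [LinearOrder X] [LinearOrder M] [LinearOrder Ξ]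
  (Y : Sys X Ξ M)

/-- the order below `α` -/
def lt (α β β' : X) : Prop := Y.ρ β α < Y.ρ β' α ∨ (Y.ρ β α = Y.ρ β' α ∧ β < β')

theorem lt_trans' {α a b c : X} (h : Y.lt α a b) (h' : Y.lt α b c) : Y.lt α a c := by
  unfold lt at *
  rcases h with h | ⟨h, h1⟩ <;> rcases h' with h' | ⟨h', h1'⟩
  · exact Or.inl (h.trans h')
  · exact Or.inl (h' ▸ h)
  · exact Or.inl (h ▸ h')
  · exact Or.inr ⟨h.trans h', h1.trans h1'⟩

theorem lt_irrefl' {α a : X} : ¬ Y.lt α a a := by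
  unfold lt; simp

theorem lt_tri (α a b : X) : Y.lt α a b ∨ a = b ∨ Y.lt α b a := by
  unfold lt
  rcases lt_trichotomy (Y.ρ a α) (Y.ρ b α) with h | h | h
  · exact Or.inl (Or.inl h)
  · rcases lt_trichotomy a b with h1 | h1 | h1
    · exact Or.inl (Or.inr ⟨h, h1⟩)
    · exact Or.inr (Or.inl h1)
    · exact Or.inr (Or.inr (Or.inr ⟨h.symm, h1⟩))
  · exact Or.inr (Or.inr (Or.inl h))

theorem lt_wf [WellFoundedLT X] [WellFoundedLT M] (α : X) : WellFounded (Y.lt α) := by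
  refine Subrelation.wf (r := InvImage (· < ·) (fun β => toLex (Y.ρ β α, β))) ?_ (InvImage.wf _ wellFounded_lt)
  intro a b h
  unfold InvImage
  beta_reduce
  rw [Prod.Lex.toLex_lt_toLex]
  exact h

/-- proper initial segments -/
def seg (α β : X) : Set X := {γ | γ < α ∧ Y.lt α γ β}

/-- pairs order -/
def pr (p q : X × X) : Prop := p.2 < q.2 ∨ (p.2 = q.2 ∧ Y.lt q.2 p.1 q.1)

theorem pr_wf [WellFoundedLT X] [WellFoundedLT M] : WellFounded Y.pr := by
  refine Subrelation.wf (r := InvImage (· < ·) (fun p : X × X => toLex (p.2, toLex (Y.ρ p.1 p.2, p.1)))) ?_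
    (InvImage.wf _ wellFounded_lt)
  rintro ⟨a, b⟩ ⟨c, d⟩ h
  unfold InvImage
  beta_reduce
  rw [Prod.Lex.toLex_lt_toLex]
  rcases h with h | ⟨h, h1⟩
  · exact Or.inl h
  · refine Or.inr ⟨h, ?_⟩
    rw [Prod.Lex.toLex_lt_toLex]
    dsimp only at h
    subst h
    exact h1

/-- the side groups -/
def side (β α : X) (i : Bool) : Set X := insert (if i then α else β) (Y.seg α β)

/-- eligible -/
def El (R : X → X → Set (FreeGroup X)) (β α : X) (ξ : Ξ) : Prop :=
  Y.hw ξ α ∈ Fs (Y.side β α true) ∧ Y.gw ξ β ∈ Fs (Y.side β α false) ∧ Y.fw ξ β α ∈ Fs (Y.side β α false) ∧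
  (∀ z ∈ Fs (Y.seg α β), (Y.hw ξ α)⁻¹ * z ∉ Nr R (Y.side β α true)) ∧
  (∀ z ∈ Fs (Y.seg α β), (Y.gw ξ β)⁻¹ * z ∉ Nr R (Y.side β α false))

/-- simultaneous conjugacy -/
def Cj (R : X → X → Set (FreeGroup X)) (β α : X) (ξ ξ' : Ξ) : Prop :=
  ∃ a ∈ Fs (Y.seg α β), (Y.hw ξ α)⁻¹ * (a * Y.hw ξ' α * a⁻¹) ∈ Nr R (Y.side β α true) ∧
    (Y.gw ξ β)⁻¹ * (a * Y.gw ξ' β * a⁻¹) ∈ Nr R (Y.side β α false)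

/-- kept -/
def Kp (R : X → X → Set (FreeGroup X)) (β α : X) (ξ : Ξ) : Prop :=
  Y.El R β α ξ ∧ ∀ ξ' < ξ, Y.El R β α ξ' → ¬ Y.Cj R β α ξ ξ'

open Classical in
/-- the last letter -/
noncomputable def bw (R : X → X → Set (FreeGroup X)) (β α : X) (ξ : Ξ) : FreeGroup X :=
  pw (Y.gw ξ β) (decide (∀ z ∈ Fs (Y.seg α β), (Y.gw ξ β * (Y.fw ξ β α)⁻¹)⁻¹ * z ∉ Nr R (Y.side β α false)))
    * (Y.fw ξ β α)⁻¹

/-- relators of a pair -/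
def relStep (R : X → X → Set (FreeGroup X)) (β α : X) : Set (FreeGroup X) :=
  {r | ∃ ξ, Y.Kp R β α ξ ∧ r = relr (Y.hw ξ α) (Y.gw ξ β) (Y.bw R β α ξ)}

open Classical in
/-- the relators, by recursion -/
noncomputable def Rel' [WellFoundedLT X] [WellFoundedLT M] : X × X → Set (FreeGroup X) :=
  Y.pr_wf.fix fun p ih => Y.relStep (fun γ δ => if h : Y.pr (γ, δ) p then ih (γ, δ) h else ∅) p.1 p.2

/-- the relators -/
noncomputable def Rel [WellFoundedLT X] [WellFoundedLT M] (β α : X) : Set (FreeGroup X) := Y.Rel' (β, α)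

theorem Nr_congr {R R' : X → X → Set (FreeGroup X)} {s : Set X}
    (h : ∀ γ ∈ s, ∀ δ ∈ s, γ < δ → R γ δ = R' γ δ) : Nr R s = Nr R' s := by
  unfold Nr
  congr 1
  ext x
  constructor
  · rintro ⟨w, hw, γ, hγ, δ, hδ, hlt, r, hr, rfl⟩
    exact ⟨w, hw, γ, hγ, δ, hδ, hlt, r, h γ hγ δ hδ hlt ▸ hr, rfl⟩
  · rintro ⟨w, hw, γ, hγ, δ, hδ, hlt, r, hr, rfl⟩
    exact ⟨w, hw, γ, hγ, δ, hδ, hlt, r, (h γ hγ δ hδ hlt).symm ▸ hr, rfl⟩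

theorem relStep_congr {R R' : X → X → Set (FreeGroup X)} {β α : X}
    (h : ∀ i, Nr R (Y.side β α i) = Nr R' (Y.side β α i)) : Y.relStep R β α = Y.relStep R' β α := by
  unfold relStep Kp bw El Cj
  rw [h true, h false]

theorem rel_eq [WellFoundedLT X] [WellFoundedLT M] {β α : X} (hβ : β < α) :
    Y.Rel β α = Y.relStep Y.Rel β α := by
  unfold Rel
  conv_lhs => unfold Rel'
  rw [WellFounded.fix_eq]
  apply Y.relStep_congr
  intro i
  apply Nr_congr
  intro γ hγ δ hδ hlt
  rw [dif_pos]
  · rfl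
  · have key : ∀ x ∈ Y.side β α i, x = (if i then α else β) ∨ (x < α ∧ Y.lt α x β) := fun x hx => hx
    unfold pr
    dsimp only
    have h1 := key γ hγ
    have h2 := key δ hδ
    cases i
    · left
      rcases h2 with h2 | h2
      · rw [h2]; exact hβ
      · exact h2.1
    · simp only [if_true] at h1 h2
      rcases h2 with h2 | h2
      · right
        refine ⟨h2, ?_⟩
        rcases h1 with h1 | h1
        · rw [h1, h2] at hlt; exact absurd hlt (lt_irrefl _)
        · exact h1.2
      · exact Or.inl h2.1

/-- initial segments -/
def Init (α : X) (J : Set X) : Prop :=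
  (∀ γ ∈ J, γ < α) ∧ ∀ γ ∈ J, ∀ γ' < α, Y.lt α γ' γ → γ' ∈ J

/-- closed sets -/
def Cl (t : Set X) : Prop := ∀ δ ∈ t, ∀ γ ∈ t, γ < δ → ∀ γ' < δ, Y.lt δ γ' γ → γ' ∈ t

theorem Cl.init {Y : Sys X Ξ M} {t : Set X} (h : Y.Cl t) {α : X} (hα : α ∈ t) : Y.Init α (t ∩ Set.Iio α) :=
  ⟨fun _ h => h.2, fun γ hγ γ' hγ' hl => ⟨h α hα γ hγ.1 hγ.2 γ' hγ' hl, hγ'⟩⟩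

theorem Init.cl {Y : Sys X Ξ M} {α : X} {J : Set X} (h : Y.Init α J) : Y.Cl J := by
  intro δ hδ γ hγ hlt γ' hγ' hl
  have hδα := h.1 δ hδ
  rcases Y.coh γ' γ δ α hγ' hlt hδα hl with h1 | h1
  · exact h.2 γ hγ γ' (hγ'.trans hδα) h1
  · exact h.2 δ hδ γ' (hγ'.trans hδα) h1

theorem Init.cl_insert {Y : Sys X Ξ M} {α : X} {J : Set X} (h : Y.Init α J) : Y.Cl (insert α J) := by
  rintro δ (rfl | hδ) γ hγ hlt γ' hγ' hl
  · rcases hγ with rfl | hγ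
    · exact absurd hlt (lt_irrefl _)
    · exact Or.inr (h.2 γ hγ γ' hγ' hl)
  · rcases hγ with rfl | hγ
    · exact absurd hlt (not_lt.2 (h.1 δ hδ).le)
    · exact Or.inr (h.cl δ hδ γ hγ hlt γ' hγ' hl)

theorem seg_init (α β : X) : Y.Init α (Y.seg α β) :=
  ⟨fun _ h => h.1, fun _ hγ _ hγ' hl => ⟨hγ', Y.lt_trans' hl hγ.2⟩⟩

theorem seg_init' {α β : X} (hβ : β < α) : Y.Init α (insert β (Y.seg α β)) := by
  refine ⟨?_, ?_⟩
  · rintro γ (rfl | h)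
    · exact hβ
    · exact h.1
  · rintro γ (rfl | h) γ' hγ' hl
    · exact Or.inr ⟨hγ', hl⟩
    · exact Or.inr ⟨hγ', Y.lt_trans' hl h.2⟩

theorem Cl.inter_Iic {Y : Sys X Ξ M} {t : Set X} (h : Y.Cl t) (δ : X) : Y.Cl (t ∩ Set.Iic δ) := by
  rintro a ⟨ha, ha'⟩ b ⟨hb, hb'⟩ hlt c hc hl
  exact ⟨h a ha b hb hlt c hc hl, hc.le.trans ha'⟩

end Sys
end JG

namespace JG
set_option linter.unusedSectionVars false
universe u v w

section Dir
variable {X : Type u} [LinearOrder X]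

theorem Fs_dir {ι : Type*} [Nonempty ι] (S : ι → Set X) (hd : Directed (· ⊆ ·) S) {x : FreeGroup X}
    (hx : x ∈ Fs (⋃ i, S i)) : ∃ i, x ∈ Fs (S i) := by
  unfold Fs at hx
  rw [Set.image_iUnion, Subgroup.closure_iUnion] at hx
  refine (Subgroup.mem_iSup_of_directed ?_).1 hx
  intro i j
  obtain ⟨k, h1, h2⟩ := hd i j
  exact ⟨k, Fs_mono h1, Fs_mono h2⟩

theorem Nr_dir {ι : Type*} [Nonempty ι] (R : X → X → Set (FreeGroup X)) (S : ι → Set X)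
    (hd : Directed (· ⊆ ·) S) {x : FreeGroup X}
    (hx : x ∈ Nr R (⋃ i, S i)) : ∃ i, x ∈ Nr R (S i) := by
  have : Nr R (⋃ i, S i) ≤ ⨆ i, Nr R (S i) := by
    conv_lhs => unfold Nr
    rw [Subgroup.closure_le]
    rintro _ ⟨w, hw, γ, hγ, δ, hδ, hlt, r, hr, rfl⟩
    obtain ⟨i, hi⟩ := Fs_dir S hd hw
    obtain ⟨j, hj⟩ := Set.mem_iUnion.1 hγ
    obtain ⟨k, hk⟩ := Set.mem_iUnion.1 hδ
    obtain ⟨a, h1, h2⟩ := hd i j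
    obtain ⟨b, h3, h4⟩ := hd a k
    exact Subgroup.mem_iSup_of_mem b (Subgroup.subset_closure
      ⟨w, Fs_mono (h1.trans h3) hi, γ, h3 (h2 hj), δ, h4 hk, hlt, r, hr, rfl⟩)
  refine (Subgroup.mem_iSup_of_directed ?_).1 (this hx)
  intro i j
  obtain ⟨k, h1, h2⟩ := hd i j
  exact ⟨k, Nr_mono h1, Nr_mono h2⟩

/-- niceness passes to directed unions -/
theorem nice_dir {ι : Type*} [Nonempty ι] (R : X → X → Set (FreeGroup X)) (S T : ι → Set X)
    (hd : ∀ i j, ∃ k, S i ⊆ S k ∧ S j ⊆ S k ∧ T i ⊆ T k ∧ T j ⊆ T k)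
    (h : ∀ i, Nice (Fs (S i)) (Nr R (S i)) (Fs (T i)) (Nr R (T i))) (hST : ∀ i, S i ⊆ T i) :
    Nice (Fs (⋃ i, S i)) (Nr R (⋃ i, S i)) (Fs (⋃ i, T i)) (Nr R (⋃ i, T i)) := by
  have dS : Directed (· ⊆ ·) S := fun i j => by
    obtain ⟨k, h1, h2, h3, h4⟩ := hd i j; exact ⟨k, h1, h2⟩
  have dT : Directed (· ⊆ ·) T := fun i j => by
    obtain ⟨k, h1, h2, h3, h4⟩ := hd i j; exact ⟨k, h3, h4⟩
  have hsub : (⋃ i, S i) ⊆ ⋃ i, T i := Set.iUnion_mono hST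
  refine ⟨Fs_mono hsub, Nr_mono hsub, ?_, ?_⟩
  · intro x hx hx'
    obtain ⟨i, hi⟩ := Fs_dir S dS hx
    obtain ⟨j, hj⟩ := Nr_dir R T dT hx'
    obtain ⟨k, h1, h2, h3, h4⟩ := hd i j
    exact Nr_mono (Set.subset_iUnion S k) ((h k).emb x (Fs_mono h1 hi) (Nr_mono h4 hj))
  · intro x hx y hy y' hy' hm
    obtain ⟨i, hi⟩ := Fs_dir T dT hx
    obtain ⟨j, hj⟩ := Nr_dir R T dT hm
    obtain ⟨i', hi'⟩ := Fs_dir S dS hy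
    obtain ⟨j', hj'⟩ := Fs_dir S dS hy'
    obtain ⟨k, h1, h2, h3, h4⟩ := hd i j
    obtain ⟨k', h1', h2', h3', h4'⟩ := hd i' j'
    obtain ⟨l, l1, l2, l3, l4⟩ := hd k k'
    rcases (h l).mal x (Fs_mono (h3.trans l3) hi) y (Fs_mono (h1'.trans l2) hi') y' (Fs_mono (h2'.trans l2) hj')
      (Nr_mono (h4.trans l3) hj) with h' | ⟨z, hz, hz'⟩
    · exact Or.inl (Nr_mono (Set.subset_iUnion S l) h')
    · exact Or.inr ⟨z, Fs_mono (Set.subset_iUnion S l) hz, Nr_mono (Set.subset_iUnion T l) hz'⟩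

theorem tf_dir {ι : Type*} [Nonempty ι] (R : X → X → Set (FreeGroup X)) (T : ι → Set X)
    (dT : Directed (· ⊆ ·) T) (h : ∀ i, TF (Fs (T i)) (Nr R (T i))) :
    TF (Fs (⋃ i, T i)) (Nr R (⋃ i, T i)) := by
  intro x hx m hm hxm
  obtain ⟨i, hi⟩ := Fs_dir T dT hx
  obtain ⟨j, hj⟩ := Nr_dir R T dT hxm
  obtain ⟨k, h1, h2⟩ := dT i j
  exact Nr_mono (Set.subset_iUnion T k) (h k x (Fs_mono h1 hi) m hm (Nr_mono h2 hj))

open Classical in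
theorem Fs_free (s0 : Set X) (s : Bool → Set X) (h0 : s false ∩ s true ⊆ s0) (hs : ∀ i, s0 ⊆ s i) (Q : Type u) [Group Q]
    (ψ : ∀ i, Fs (s i) →* Q)
    (hψ : ∀ x, ∀ hx : x ∈ Fs s0, ψ false ⟨x, Fs_mono (hs false) hx⟩ = ψ true ⟨x, Fs_mono (hs true) hx⟩) :
    ∃ Ψ : FreeGroup X →* Q, ∀ i (x : Fs (s i)), Ψ x = ψ i x := by
  let Ψ : FreeGroup X →* Q := FreeGroup.lift fun x =>
    if h : x ∈ s true then ψ true ⟨FreeGroup.of x, of_mem h⟩ else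
    if h : x ∈ s false then ψ false ⟨FreeGroup.of x, of_mem h⟩ else 1
  refine ⟨Ψ, ?_⟩
  have key : ∀ i x, ∀ hx : x ∈ s i, Ψ (FreeGroup.of x) = ψ i ⟨FreeGroup.of x, of_mem hx⟩ := by
    intro i x hx
    simp only [Ψ, FreeGroup.lift_apply_of]
    cases i
    · by_cases h : x ∈ s true
      · rw [dif_pos h]
        exact (hψ _ (of_mem (h0 ⟨hx, h⟩))).symm
      · rw [dif_neg h, dif_pos hx]
    · rw [dif_pos hx]
  intro i x
  have : Fs (s i) ≤ ((Ψ.comp (Fs (s i)).subtype).eqLocus (ψ i)).map (Fs (s i)).subtype := by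
    conv_lhs => unfold Fs
    rw [Subgroup.closure_le]
    rintro _ ⟨y, hy, rfl⟩
    exact ⟨⟨_, of_mem hy⟩, key i y hy, rfl⟩
  obtain ⟨y, hy, hyx⟩ := this x.2
  have : y = x := Subtype.ext hyx
  subst this
  exact hy

theorem Fs_insert_sup (a b : X) (s : Set X) : Fs (insert a (insert b s)) = Fs (insert b s) ⊔ Fs (insert a s) := by
  unfold Fs
  rw [← Subgroup.closure_union, ← Set.image_union]
  congr 2
  ext x; simp
  try tauto

end Dir

namespace Sys
variable {X : Type u} {Ξ : Type v} {M : Type w} [LinearOrder X] [LinearOrder M] [LinearOrder Ξ]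
  [WellFoundedLT X] [WellFoundedLT M] (Y : Sys X Ξ M)

/-- relator subgroup -/
noncomputable def N (s : Set X) : Subgroup (FreeGroup X) := Nr Y.Rel s

theorem N_mono {s t : Set X} (h : s ⊆ t) : Y.N s ≤ Y.N t := Nr_mono h

theorem rel_mem {β α : X} (hβ : β < α) {r : FreeGroup X} (hr : r ∈ Y.Rel β α) :
    r ∈ Fs (insert α (insert β (Y.seg α β))) := by
  rw [Y.rel_eq hβ] at hr
  obtain ⟨ξ, hk, hreq⟩ := hr
  rw [hreq]
  have h1 := hk.1.1
  have h2 := hk.1.2.1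
  have h3 := hk.1.2.2.1
  have e1 : Y.side β α true ⊆ insert α (insert β (Y.seg α β)) := by
    rintro x (hx | hx)
    · exact Or.inl hx
    · exact Or.inr (Or.inr hx)
  have e2 : Y.side β α false ⊆ insert α (insert β (Y.seg α β)) := by
    rintro x (hx | hx)
    · exact Or.inr (Or.inl hx)
    · exact Or.inr (Or.inr hx)
  have h1 := Fs_mono e1 h1
  have h2 := Fs_mono e2 h2
  have h3 := Fs_mono e2 h3
  generalize Fs (insert α (insert β (Y.seg α β))) = K at *
  have h4 : Y.bw Y.Rel β α ξ ∈ K := by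
    unfold bw pw
    refine mul_mem ?_ (inv_mem h3)
    split_ifs
    · exact h2
    · exact inv_mem h2
  have := map_relr K.subtype ⟨_, h1⟩ ⟨_, h2⟩ ⟨_, h4⟩
  simp only [Subgroup.subtype_apply] at this
  rw [← this]
  exact Subtype.prop _

theorem Cl.pr {Y : Sys X Ξ M} {t : Set X} (h : Y.Cl t) : Pr (Fs t) (Y.N t) := by
  constructor
  · unfold N Nr
    rw [Subgroup.closure_le]
    rintro _ ⟨w, hw, γ, hγ, δ, hδ, hlt, r, hr, rfl⟩
    refine mul_mem (mul_mem hw (Fs_mono ?_ (Y.rel_mem hlt hr))) (inv_mem hw)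
    rintro x (rfl | rfl | hx)
    · exact hδ
    · exact hγ
    · exact h δ hδ γ hγ hlt x hx.1 hx.2
  · intro k hk n hn
    unfold N Nr at hn ⊢
    induction hn using Subgroup.closure_induction with
    | mem x hx =>
      obtain ⟨w, hw, γ, hγ, δ, hδ, hlt, r, hr, rfl⟩ := hx
      exact Subgroup.subset_closure ⟨k * w, mul_mem hk hw, γ, hγ, δ, hδ, hlt, r, hr, by group⟩
    | one => simp
    | mul x y _ _ hx hy =>
      have : k * (x * y) * k⁻¹ = (k * x * k⁻¹) * (k * y * k⁻¹) := by group
      rw [this]; exact mul_mem hx hy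
    | inv x _ hx =>
      have : k * x⁻¹ * k⁻¹ = (k * x * k⁻¹)⁻¹ := by group
      rw [this]; exact inv_mem hx

/-- the inductive package -/
structure Good (t : Set X) : Prop where
  tf : TF (Fs t) (Y.N t)
  nice : ∀ β ∈ t, Y.Cl (t \ {β}) → Nice (Fs (t \ {β})) (Y.N (t \ {β})) (Fs t) (Y.N t)
  inter : ∀ β ∈ t, Y.Cl (t \ {β}) → ∀ x ∈ Fs (t ∩ Set.Iic β), ∀ y ∈ Fs (t \ {β}), x⁻¹ * y ∈ Y.N t →
    ∃ z ∈ Fs (t ∩ Set.Iio β), x⁻¹ * z ∈ Y.N t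
  xx : ∀ β ∈ t, (∀ γ ∈ t, γ ≤ β) → ∀ z ∈ Fs (t \ {β}), (FreeGroup.of β)⁻¹ * z ∉ Y.N t

/-- sub-package for initial segments -/
structure Wd (α : X) (J : Set X) : Prop where
  tf : TF (Fs (insert α J)) (Y.N (insert α J))
  nice : Nice (Fs J) (Y.N J) (Fs (insert α J)) (Y.N (insert α J))
  xx : ∀ z ∈ Fs J, (FreeGroup.of α)⁻¹ * z ∉ Y.N (insert α J)

theorem good_step {β α : X} (hβ : β < α) (hg : Y.Good (insert β (Y.seg α β))) (hw : Y.Wd α (Y.seg α β)) :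
    (∀ i, Nice (Fs (Y.side β α i)) (Y.N (Y.side β α i)) (Fs (insert α (insert β (Y.seg α β))))
      (Y.N (insert α (insert β (Y.seg α β))))) ∧
    TF (Fs (insert α (insert β (Y.seg α β)))) (Y.N (insert α (insert β (Y.seg α β)))) ∧
    (∀ i, ∀ x ∈ Fs (Y.side β α i), ∀ y ∈ Fs (Y.side β α (!i)),
      x⁻¹ * y ∈ Y.N (insert α (insert β (Y.seg α β))) → ∃ z ∈ Fs (Y.seg α β), x⁻¹ * z ∈ Y.N (Y.side β α i)) := by
  have hi := Y.seg_init α β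
  have hi' := Y.seg_init' hβ
  have clside : ∀ i, Y.Cl (Y.side β α i) := by
    intro i; cases i
    · exact hi'.cl
    · exact hi.cl_insert
  have hsd : insert β (Y.seg α β) \ {β} = Y.seg α β := by
    ext x; simp only [Set.mem_sdiff, Set.mem_insert_iff, Set.mem_singleton_iff]
    constructor
    · rintro ⟨h1 | h1, h2⟩
      · exact absurd h1 h2
      · exact h1
    · intro h1
      exact ⟨Or.inr h1, fun h => Y.lt_irrefl' (h ▸ h1.2)⟩
  have nice : ∀ i, Nice (Fs (Y.seg α β)) (Y.N (Y.seg α β)) (Fs (Y.side β α i)) (Y.N (Y.side β α i)) := by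
    intro i; cases i
    · have := hg.nice β (Set.mem_insert _ _) (by rw [hsd]; exact hi.cl)
      rw [hsd] at this
      exact this
    · exact hw.nice
  have tf : ∀ i, TF (Fs (Y.side β α i)) (Y.N (Y.side β α i)) := by
    intro i; cases i
    · exact hg.tf
    · exact hw.tf
  have pside := fun i => (clside i).pr
  have hsub : ∀ i, Y.side β α i ⊆ insert α (insert β (Y.seg α β)) := by
    intro i x hx
    cases i
    · rcases hx with hx | hx
      · exact Or.inr (Or.inl hx)
      · exact Or.inr (Or.inr hx)
    · rcases hx with hx | hx
      · exact Or.inl hx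
      · exact Or.inr (Or.inr hx)
  have hb : ∀ ξ, Y.El Y.Rel β α ξ → ∀ z ∈ Fs (Y.seg α β), (Y.bw Y.Rel β α ξ)⁻¹ * z ∉ Nr Y.Rel (Y.side β α false) := by
    intro ξ hξ z hz hzN
    classical
    obtain ⟨h1, h2, h3, h4, h5⟩ := hξ
    unfold bw at hzN
    by_cases hall : ∀ z ∈ Fs (Y.seg α β), (Y.gw ξ β * (Y.fw ξ β α)⁻¹)⁻¹ * z ∉ Nr Y.Rel (Y.side β α false)
    · rw [decide_eq_true hall] at hzN
      exact hall z hz hzN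
    · rw [decide_eq_false hall] at hzN
      push Not at hall
      obtain ⟨z', hz', hzN'⟩ := hall
      simp only [pw, Bool.false_eq_true, if_false] at hzN
      generalize Y.gw ξ β = g at *
      generalize Y.fw ξ β α = f at *
      have pN := (pside false)
      have nN := (nice false)
      have tN := tf false
      unfold N at pN nN tN
      generalize Nr Y.Rel (Y.side β α false) = NB at *
      generalize Fs (Y.side β α false) = KB at *
      -- g^2 ≡ z' z⁻¹
      have e1 : (g ^ 2)⁻¹ * (z' * z⁻¹) ∈ NB := by
        have i1 := pN.conj z' (nN.leK hz') _ (inv_mem hzN)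
        have i2 := pN.conj (z' * z⁻¹) (mul_mem (nN.leK hz') (inv_mem (nN.leK hz))) _
          (pN.conj (f⁻¹ * g)⁻¹ (inv_mem (mul_mem (inv_mem h3) h2)) _ (inv_mem hzN))
        have i3 := pN.conj (g⁻¹ * f⁻¹ * g) (by exact mul_mem (mul_mem (inv_mem h2) (inv_mem h3)) h2)
        have a1 : f * g⁻¹ * z' ∈ NB := by simpa [mul_assoc] using hzN'
        have a2 : f * g * z ∈ NB := by simpa [mul_assoc] using hzN
        have a3 : f * g⁻¹ * z' * (f * g * z)⁻¹ ∈ NB := mul_mem a1 (inv_mem a2)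
        have a4 := pN.conj (g⁻¹ * f⁻¹) (mul_mem (inv_mem h2) (inv_mem h3)) _ a3
        have : (g ^ 2)⁻¹ * (z' * z⁻¹) = g⁻¹ * f⁻¹ * (f * g⁻¹ * z' * (f * g * z)⁻¹) * (g⁻¹ * f⁻¹)⁻¹ := by
          rw [pow_two]; group
        rw [this]; exact a4
      have hc : z' * z⁻¹ ∈ Fs (Y.seg α β) := mul_mem hz' (inv_mem hz)
      generalize z' * z⁻¹ = c at *
      have e2 : g * c * g⁻¹ * c⁻¹ ∈ NB := by
        have b1 := pN.conj (g * g ^ 2) (mul_mem h2 (pow_mem h2 2)) _ e1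
        have b2 := pN.conj (g ^ 2) (pow_mem h2 2) _ e1
        have : g * c * g⁻¹ * c⁻¹ = g * g ^ 2 * ((g ^ 2)⁻¹ * c) * (g * g ^ 2)⁻¹ * (g ^ 2 * ((g ^ 2)⁻¹ * c) * (g ^ 2)⁻¹)⁻¹ := by
          rw [pow_two]; group
        rw [this]; exact mul_mem b1 (inv_mem b2)
      rcases nN.mal g h2 c hc c hc e2 with hcN | ⟨y, hy, hyN⟩
      · have hg2 : g ^ 2 ∈ NB := by
          have := mul_mem (nN.leN hcN) (inv_mem e1)
          simpa using this
        have hg1 := tN g h2 2 (by norm_num) hg2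
        exact h5 1 (one_mem _) (by simpa using hg1)
      · exact h5 y hy hyN
  refine istep (Fs (Y.seg α β)) (Y.N (Y.seg α β)) (fun i => Fs (Y.side β α i)) (fun i => Y.N (Y.side β α i))
    _ _ hi.cl.pr pside hi'.cl_insert.pr nice tf (Fs_insert_sup _ _ _) ?_
    (S := {ξ : Ξ // Y.Kp Y.Rel β α ξ}) (fun ξ => Y.hw ξ α) (fun ξ => Y.gw ξ β) (fun ξ => Y.bw Y.Rel β α ξ)
    (fun ξ => ξ.2.1.1) (fun ξ => ξ.2.1.2.1) ?_ ?_ ?_ ?_ ?_ ?_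
  · intro Q _ ψ hψ
    refine Fs_free (Y.seg α β) (Y.side β α) ?_ (fun i x hx => Or.inr hx) Q ψ hψ
    rintro x ⟨h1 | h1, h2 | h2⟩
    · simp at h1 h2; rw [h1] at h2; exact absurd h2 hβ.ne
    · exact h2
    · exact h1
    · exact h1
  · rintro ⟨ξ, ⟨h1, h2, h3, -⟩, -⟩
    dsimp only
    unfold bw pw
    refine mul_mem ?_ (inv_mem h3)
    split_ifs
    · exact h2
    · exact inv_mem h2
  · apply le_antisymm
    · conv_lhs => unfold N Nr
      apply Subgroup.closure_mono
      rintro x ⟨w, hw, γ, hγ, δ, hδ, hlt, r, hr, rfl⟩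
      refine ⟨w, hw, r, ?_, rfl⟩
      have hr1 : ∀ s : Set X, γ ∈ s → δ ∈ s → r ∈ Y.N s := fun s h1 h2 =>
        Subgroup.subset_closure ⟨1, one_mem _, γ, h1, δ, h2, hlt, r, hr, by simp⟩
      have hle : ∀ x ∈ insert β (Y.seg α β), x < α := hi'.1
      rcases hδ with rfl | hδ
      · rcases hγ with rfl | rfl | hγ
        · exact absurd hlt (lt_irrefl _)
        · right; right
          rw [Y.rel_eq hβ] at hr
          obtain ⟨ξ, h1, h2⟩ := hr
          exact ⟨⟨ξ, h1⟩, h2⟩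
        · right; left
          exact hr1 (Y.side β δ true) (Set.mem_insert_of_mem _ hγ) (Set.mem_insert _ _)
      · left
        refine hr1 _ ?_ hδ
        rcases hγ with rfl | hγ
        · exact absurd hlt (not_lt.2 (hle δ hδ).le)
        · exact hγ
    · rw [Subgroup.closure_le]
      rintro _ ⟨w, hw, r, hr, rfl⟩
      refine hi'.cl_insert.pr.conj w hw r ?_
      rcases hr with hr | hr | ⟨⟨ξ, hξ⟩, hreq⟩
      · exact Y.N_mono (hsub false) hr
      · exact Y.N_mono (hsub true) hr
      · have hrR : r ∈ Y.Rel β α := by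
          rw [Y.rel_eq hβ]
          exact ⟨ξ, hξ, hreq⟩
        exact Subgroup.subset_closure ⟨1, one_mem _, β, Or.inr (Or.inl rfl), α, Or.inl rfl, hβ, r, hrR,
          by simp⟩
  · exact fun ξ => ξ.2.1.2.2.2.1
  · exact fun ξ => ξ.2.1.2.2.2.2
  · exact fun ξ => hb ξ.1 ξ.2.1
  · rintro ⟨ξ, hξ⟩ ⟨ξ', hξ'⟩ a ha h1 h2
    apply Subtype.ext
    dsimp only at *
    rcases lt_trichotomy ξ ξ' with h | h | h
    · exfalso
      refine hξ'.2 ξ h hξ.1 ⟨a⁻¹, inv_mem ha, ?_, ?_⟩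
      · have := (pside true).conj a⁻¹ ((nice true).leK (inv_mem ha)) _ (inv_mem h1)
        change _ ∈ Y.N _
        simpa [mul_assoc] using this
      · have := (pside false).conj a⁻¹ ((nice false).leK (inv_mem ha)) _ (inv_mem h2)
        change _ ∈ Y.N _
        simpa [mul_assoc] using this
    · exact h
    · exact absurd ⟨a, ha, h1, h2⟩ (hξ.2 ξ' h hξ'.1)

end Sys
end JG

namespace JG
set_option linter.unusedSectionVars false
universe u v w

theorem Fs_empty {X : Type u} : Fs (∅ : Set X) = ⊥ := by
  unfold Fs; simp

theorem free_tf {X : Type u} (x : FreeGroup X) (m : ℕ) (hm : 0 < m) (h : x ^ m = 1) : x = 1 := by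
  by_contra hx
  exact hx ((pow_eq_one_iff_left hm.ne').1 h)

namespace Sys
variable {X : Type u} {Ξ : Type v} {M : Type w} [LinearOrder X] [LinearOrder M] [LinearOrder Ξ]
  [WellFoundedLT X] [WellFoundedLT M] (Y : Sys X Ξ M)

theorem N_sub (s : Set X) (h : ∀ x ∈ s, ∀ y ∈ s, x = y) : Y.N s = ⊥ := by
  unfold N Nr
  rw [Subgroup.closure_eq_bot_iff]
  rintro x ⟨w, hw, γ, hγ, δ, hδ, hlt, r, hr, rfl⟩
  exact absurd (h γ hγ δ hδ) hlt.ne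

theorem wd_base (α : X) : Y.Wd α ∅ := by
  have h1 : Y.N (insert α ∅) = ⊥ := Y.N_sub _ (by simp)
  have h2 : Y.N ∅ = ⊥ := Y.N_sub _ (by simp)
  constructor
  · intro x hx m hm h
    rw [h1, Subgroup.mem_bot] at *
    exact free_tf x m hm h
  · rw [h1, h2, Fs_empty]
    refine ⟨bot_le, le_rfl, fun x hx _ => hx, fun x _ y hy _ _ _ => Or.inl hy⟩
  · intro z hz
    rw [Fs_empty, Subgroup.mem_bot] at hz
    rw [h1, Subgroup.mem_bot, hz]
    simp [FreeGroup.of_ne_one]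

theorem seg_sub {α γ γ' : X} (hγ : γ < α) (h : Y.lt α γ γ') : insert γ (Y.seg α γ) ⊆ Y.seg α γ' := by
  rintro x (rfl | hx)
  · exact ⟨hγ, h⟩
  · exact ⟨hx.1, Y.lt_trans' hx.2 h⟩

theorem Init.eq_iUnion {Y : Sys X Ξ M} {α : X} {J : Set X} (hJ : Y.Init α J) :
    J = ⋃ γ : J, insert γ.1 (Y.seg α γ.1) := by
  ext x
  simp only [Set.mem_iUnion]
  constructor
  · intro hx
    exact ⟨⟨x, hx⟩, Set.mem_insert _ _⟩
  · rintro ⟨⟨γ, hγ⟩, h | h⟩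
    · exact h ▸ hγ
    · exact hJ.2 γ hγ x h.1 h.2

theorem Init.dir {Y : Sys X Ξ M} {α : X} {J : Set X} (hJ : Y.Init α J) (i j : J) :
    ∃ k : J, insert i.1 (Y.seg α i.1) ⊆ insert k.1 (Y.seg α k.1) ∧
      insert j.1 (Y.seg α j.1) ⊆ insert k.1 (Y.seg α k.1) := by
  rcases Y.lt_tri α i.1 j.1 with h | h | h
  · exact ⟨j, (Y.seg_sub (hJ.1 _ i.2) h).trans (Set.subset_insert _ _), le_rfl⟩
  · exact ⟨j, by rw [h], le_rfl⟩
  · exact ⟨i, le_rfl, (Y.seg_sub (hJ.1 _ j.2) h).trans (Set.subset_insert _ _)⟩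

theorem wd_dir {α : X} {J : Set X} (hJ : Y.Init α J) (hne : J.Nonempty)
    (h : ∀ γ ∈ J, Y.Wd α (insert γ (Y.seg α γ))) : Y.Wd α J := by
  have hn : Nonempty J := hne.to_subtype
  have e1 := hJ.eq_iUnion
  have e2 : insert α J = ⋃ γ : J, insert α (insert γ.1 (Y.seg α γ.1)) := by
    rw [← Set.insert_iUnion, ← e1]
  have d1 : Directed (· ⊆ ·) fun γ : J => insert α (insert γ.1 (Y.seg α γ.1)) := by
    intro i j
    obtain ⟨k, h1, h2⟩ := hJ.dir i j
    exact ⟨k, Set.insert_subset_insert h1, Set.insert_subset_insert h2⟩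
  have d2 : Directed (· ⊆ ·) fun γ : J => (insert γ.1 (Y.seg α γ.1)) := hJ.dir
  constructor
  · rw [e2]
    exact tf_dir _ _ d1 (fun i => (h i.1 i.2).tf)
  · rw [e2]
    conv in (Fs J) => rw [e1]
    conv in (Y.N J) => rw [e1]
    refine nice_dir _ _ _ ?_ (fun i => (h i.1 i.2).nice) (fun i => Set.subset_insert _ _)
    intro i j
    obtain ⟨k, h1, h2⟩ := hJ.dir i j
    exact ⟨k, h1, h2, Set.insert_subset_insert h1, Set.insert_subset_insert h2⟩
  · intro z hz hzN
    rw [e2] at hzN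
    rw [e1] at hz
    obtain ⟨i, hi⟩ := Fs_dir _ d2 hz
    obtain ⟨j, hj⟩ := Nr_dir _ _ d1 hzN
    obtain ⟨k, h1, h2⟩ := hJ.dir i j
    exact (h k.1 k.2).xx z (Fs_mono h1 hi) (Nr_mono (Set.insert_subset_insert h2) hj)

theorem wd_insert {β α : X} (hβ : β < α) (hg : Y.Good (insert β (Y.seg α β))) (hw : Y.Wd α (Y.seg α β)) :
    Y.Wd α (insert β (Y.seg α β)) := by
  obtain ⟨h1, h2, h3⟩ := Y.good_step hβ hg hw
  refine ⟨h2, h1 false, ?_⟩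
  intro z hz hzN
  obtain ⟨z', hz', hzN'⟩ := h3 true (FreeGroup.of α) (of_mem (Set.mem_insert _ _)) z hz hzN
  exact hw.xx z' hz' hzN'

theorem wd_all {α : X} (hα : ∀ t, Y.Cl t → (∀ x ∈ t, x < α) → Y.Good t) {J : Set X} (hJ : Y.Init α J) :
    Y.Wd α J := by
  have key : ∀ γ, γ < α → Y.Wd α (Y.seg α γ) := by
    intro γ
    induction γ using (Y.lt_wf α).induction with
    | _ γ ih =>
      intro hγ
      rcases (Y.seg α γ).eq_empty_or_nonempty with h | h
      · rw [h]; exact Y.wd_base α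
      · refine Y.wd_dir (Y.seg_init α γ) h ?_
        intro γ' hγ'
        exact Y.wd_insert hγ'.1 (hα _ (Y.seg_init' hγ'.1).cl (Y.seg_init' hγ'.1).1) (ih γ' hγ'.2 hγ'.1)
  rcases J.eq_empty_or_nonempty with h | h
  · rw [h]; exact Y.wd_base α
  · refine Y.wd_dir hJ h ?_
    intro γ hγ
    have hγ' := hJ.1 γ hγ
    exact Y.wd_insert hγ' (hα _ (Y.seg_init' hγ').cl (Y.seg_init' hγ').1) (key γ hγ')

theorem good_max {α : X} (hα : ∀ t, Y.Cl t → (∀ x ∈ t, x < α) → Y.Good t) {t : Set X} (ht : Y.Cl t)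
    (hαt : α ∈ t) (hmax : ∀ x ∈ t, x ≤ α) : Y.Good t := by
  have hI := ht.init hαt
  have e0 : t \ {α} = t ∩ Set.Iio α := by
    ext x
    constructor
    · rintro ⟨h1, h2⟩; exact ⟨h1, lt_of_le_of_ne (hmax x h1) h2⟩
    · rintro ⟨h1, h2⟩; exact ⟨h1, ne_of_lt h2⟩
  have e1 : insert α (t ∩ Set.Iio α) = t := by
    rw [← e0, Set.insert_sdiff_singleton, Set.insert_eq_of_mem hαt]
  have hwd := Y.wd_all hα hI
  have htf := hwd.tf
  have hni := hwd.nice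
  have hxx := hwd.xx
  rw [e1] at htf hni hxx
  have low : ∀ β ∈ t, β ≠ α → Y.Cl (t \ {β}) → β < α ∧ t ∩ Set.Iio α = insert β (Y.seg α β) := by
    intro β hβ hne hcl
    have hlt : β < α := lt_of_le_of_ne (hmax β hβ) hne
    refine ⟨hlt, ?_⟩
    ext γ
    constructor
    · intro hγ
      rcases Y.lt_tri α γ β with h | h | h
      · exact Or.inr ⟨hγ.2, h⟩
      · exact Or.inl h
      · exfalso
        have hγβ : γ ≠ β := fun h' => Y.lt_irrefl' (h' ▸ h)
        exact (hcl α ⟨hαt, hne.symm⟩ γ ⟨hγ.1, hγβ⟩ hγ.2 β hlt h).2 rfl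
    · rintro (rfl | h)
      · exact ⟨hβ, hlt⟩
      · exact hI.2 β ⟨hβ, hlt⟩ γ h.1 h.2
  have dsd : ∀ β, insert β (Y.seg α β) \ {β} = Y.seg α β := by
    intro β
    ext x; simp only [Set.mem_sdiff, Set.mem_insert_iff, Set.mem_singleton_iff]
    constructor
    · rintro ⟨h1 | h1, h2⟩
      · exact absurd h1 h2
      · exact h1
    · intro h1
      exact ⟨Or.inr h1, fun h => Y.lt_irrefl' (h ▸ h1.2)⟩
  have e3 : ∀ β, β < α → t ∩ Set.Iio α = insert β (Y.seg α β) → t \ {β} = insert α (Y.seg α β) := by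
    intro β hlt he
    rw [← e1, he, Set.insert_sdiff_of_notMem _ (by simpa using hlt.ne'), dsd]
  refine ⟨htf, ?_, ?_, ?_⟩
  · intro β hβ hcl
    by_cases hne : β = α
    · subst hne; rw [e0]; exact hni
    · obtain ⟨hlt, he⟩ := low β hβ hne hcl
      have hcl' := (Y.seg_init' hlt)
      obtain ⟨h1, h2, h3⟩ := Y.good_step hlt (hα _ hcl'.cl hcl'.1) (Y.wd_all hα (Y.seg_init α β))
      have := h1 true
      rw [← he, e1] at this
      rw [e3 β hlt he]
      exact this
  · intro β hβ hcl x hx y hy hxy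
    by_cases hne : β = α
    · subst hne
      rw [← e0]
      exact ⟨y, hy, hxy⟩
    · obtain ⟨hlt, he⟩ := low β hβ hne hcl
      have hcl' := (Y.seg_init' hlt)
      have hgd := hα _ hcl'.cl hcl'.1
      obtain ⟨h1, h2, h3⟩ := Y.good_step hlt hgd (Y.wd_all hα (Y.seg_init α β))
      have s1 : t ∩ Set.Iic β ⊆ insert β (Y.seg α β) := by
        rw [← he]; exact fun z hz => ⟨hz.1, lt_of_le_of_lt hz.2 hlt⟩
      rw [e3 β hlt he] at hy
      rw [← e1, he] at hxy
      obtain ⟨z, hz, hzN⟩ := h3 false x (Fs_mono s1 hx) y hy hxy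
      obtain ⟨z', hz', hzN'⟩ := hgd.inter β (Set.mem_insert _ _) (by rw [dsd]; exact (Y.seg_init α β).cl)
        x (Fs_mono (show t ∩ Set.Iic β ⊆ insert β (Y.seg α β) ∩ Set.Iic β from fun z hz => ⟨s1 hz, hz.2⟩) hx) z (by rw [dsd]; exact hz) hzN
      have s2 : insert β (Y.seg α β) ⊆ t := by
        rw [← he]; exact Set.inter_subset_left
      exact ⟨z', Fs_mono (Set.inter_subset_inter_left _ s2) hz', Y.N_mono s2 hzN'⟩
  · intro β hβ hm
    have : β = α := le_antisymm (hmax β hβ) (hm α hαt)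
    subst this
    rw [e0]; exact hxx

theorem good_union {t : Set X} (ht : Y.Cl t) (h : ∀ δ ∈ t, Y.Good (t ∩ Set.Iic δ)) : Y.Good t := by
  rcases t.eq_empty_or_nonempty with he | hne
  · subst he
    refine ⟨?_, ?_, ?_, ?_⟩
    · intro x hx m hm hxm
      rw [Fs_empty, Subgroup.mem_bot] at hx
      rw [hx]; exact one_mem _
    all_goals exact fun β hβ => absurd hβ (Set.notMem_empty _)
  have hn : Nonempty t := hne.to_subtype
  have sd : ∀ s : Set X, ∀ i j : t, ∃ k : t, i ≤ k ∧ j ≤ k ∧ s ∩ Set.Iic i.1 ⊆ s ∩ Set.Iic k.1 ∧ s ∩ Set.Iic j.1 ⊆ s ∩ Set.Iic k.1 := by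
    intro s i j
    exact ⟨max i j, le_max_left _ _, le_max_right _ _, Set.inter_subset_inter_right _ (Set.Iic_subset_Iic.2 (le_max_left i j)),
      Set.inter_subset_inter_right _ (Set.Iic_subset_Iic.2 (le_max_right i j))⟩
  have e1 : t = ⋃ δ : t, t ∩ Set.Iic δ.1 := by
    ext x
    simp only [Set.mem_iUnion]
    exact ⟨fun hx => ⟨⟨x, hx⟩, hx, le_rfl⟩, fun ⟨_, h⟩ => h.1⟩
  have d1 : Directed (· ⊆ ·) fun δ : t => t ∩ Set.Iic δ.1 := fun i j => by
    obtain ⟨k, _, _, h1, h2⟩ := sd t i j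
    exact ⟨k, h1, h2⟩
  have hcl2 : ∀ β δ, Y.Cl (t \ {β}) → Y.Cl ((t ∩ Set.Iic δ) \ {β}) := by
    intro β δ hc
    have := hc.inter_Iic δ
    rwa [show (t ∩ Set.Iic δ) \ {β} = (t \ {β}) ∩ Set.Iic δ by ext x; simp; tauto]
  refine ⟨?_, ?_, ?_, ?_⟩
  · rw [e1]
    exact tf_dir _ _ d1 fun i => h i.1 i.2
      |>.tf
  · intro β hβ hcl
    let ι := {δ : t // β ≤ δ.1}
    have : Nonempty ι := ⟨⟨⟨β, hβ⟩, le_rfl⟩⟩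
    have e2 : t = ⋃ δ : ι, t ∩ Set.Iic δ.1.1 := by
      ext x
      simp only [Set.mem_iUnion]
      refine ⟨fun hx => ⟨⟨max ⟨x, hx⟩ ⟨β, hβ⟩, ?_⟩, hx, ?_⟩, fun ⟨_, h⟩ => h.1⟩
      · exact le_max_right (⟨x, hx⟩ : t) ⟨β, hβ⟩
      · exact le_max_left (⟨x, hx⟩ : t) ⟨β, hβ⟩
    have e3 : t \ {β} = ⋃ δ : ι, (t ∩ Set.Iic δ.1.1) \ {β} := by
      rw [← Set.iUnion_sdiff, ← e2]
    have := nice_dir Y.Rel (fun δ : ι => (t ∩ Set.Iic δ.1.1) \ {β}) (fun δ : ι => t ∩ Set.Iic δ.1.1) ?_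
      (fun i => (h i.1.1 i.1.2).nice β ⟨hβ, i.2⟩ (hcl2 _ _ hcl)) (fun i => Set.sdiff_subset)
    · rw [← e2, ← e3] at this
      exact this
    · intro i j
      obtain ⟨k, k1, _, h1, h2⟩ := sd t i.1 j.1
      exact ⟨⟨k, i.2.trans k1⟩, Set.sdiff_subset_sdiff_left h1, Set.sdiff_subset_sdiff_left h2, h1, h2⟩
  · intro β hβ hcl x hx y hy hxy
    have e3 : t \ {β} = ⋃ δ : t, (t ∩ Set.Iic δ.1) \ {β} := by
      rw [← Set.iUnion_sdiff, ← e1]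
    have d2 : Directed (· ⊆ ·) fun δ : t => (t ∩ Set.Iic δ.1) \ {β} := fun i j => by
      obtain ⟨k, h1, h2⟩ := d1 i j
      exact ⟨k, Set.sdiff_subset_sdiff_left h1, Set.sdiff_subset_sdiff_left h2⟩
    rw [e3] at hy
    rw [e1] at hxy
    obtain ⟨i, hi⟩ := Fs_dir _ d2 hy
    obtain ⟨j, hj⟩ := Nr_dir _ _ d1 hxy
    obtain ⟨k, k1, k2, h1, h2⟩ := sd t i j
    obtain ⟨l, l1, l2, h3, h4⟩ := sd t k ⟨β, hβ⟩
    have hβl : β ≤ l.1 := l2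
    obtain ⟨z, hz, hzN⟩ := (h l.1 l.2).inter β ⟨hβ, hβl⟩ (hcl2 _ _ hcl) x
      (Fs_mono (show t ∩ Set.Iic β ⊆ t ∩ Set.Iic l.1 ∩ Set.Iic β from fun w hw => ⟨⟨hw.1, le_trans hw.2 hβl⟩, hw.2⟩) hx) y
      (Fs_mono (Set.sdiff_subset_sdiff_left (h1.trans h3)) hi) (Nr_mono (h2.trans h3) hj)
    exact ⟨z, Fs_mono (show t ∩ Set.Iic l.1 ∩ Set.Iio β ⊆ t ∩ Set.Iio β from fun w hw => ⟨hw.1.1, hw.2⟩) hz, Y.N_mono Set.inter_subset_left hzN⟩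
  · intro β hβ hm
    have e : t ∩ Set.Iic β = t := Set.inter_eq_left.2 hm
    have := h β hβ
    rw [e] at this
    exact this.xx β hβ hm

theorem good_all {t : Set X} (ht : Y.Cl t) : Y.Good t := by
  have key : ∀ α : X, ∀ t, Y.Cl t → α ∈ t → (∀ x ∈ t, x ≤ α) → Y.Good t := by
    intro α
    induction α using WellFoundedLT.induction with
    | _ α ih =>
      intro t ht hαt hmax
      refine Y.good_max ?_ ht hαt hmax
      intro t' ht' hlt
      refine Y.good_union ht' ?_
      intro δ hδ
      exact ih δ (hlt δ hδ) _ (ht'.inter_Iic δ) ⟨hδ, le_rfl⟩ fun x hx => hx.2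
  refine Y.good_union ht fun δ hδ => key δ _ (ht.inter_Iic δ) ⟨hδ, le_rfl⟩ fun x hx => hx.2

end Sys
end JG

namespace JG
set_option linter.unusedSectionVars false
universe u
open Cardinal

/-- cardinal environment -/
structure Env (μ : Cardinal.{u}) (X M : Type u) [LinearOrder X] [LinearOrder M] : Prop where
  reg : μ.IsRegular
  cX : #X = Order.succ μ
  cM : #M = μ
  Ms : ∀ m : M, #(Set.Iic m) < μ
  Mb : ∀ s : Set M, #s < μ → ∃ b, ∀ x ∈ s, x < b
  Xs : ∀ a : X, #(Set.Iio a) ≤ μ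
  Xb : ∀ s : Set X, #s ≤ μ → ∃ b, ∀ x ∈ s, x < b

theorem bdd_toType {c : Cardinal.{u}} (hc : c.IsRegular) (s : Set c.ord.ToType) (hs : #s < c) :
    ∃ b, ∀ x ∈ s, x < b := by
  have h : c = Order.cof c.ord.ToType := by
    rw [← Ordinal.cof_type, Ordinal.type_toType, hc.cof_ord]
  by_contra! hcon
  have : IsCofinal s := fun b => by
    obtain ⟨x, hx, hb⟩ := hcon b
    exact ⟨x, hx, hb⟩
  have := Order.cof_le this
  rw [← h] at this
  exact absurd hs (not_lt.2 this)

theorem env {μ : Cardinal.{u}} (hμ : μ.IsRegular) :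
    Env μ (Order.succ μ).ord.ToType μ.ord.ToType := by
  refine ⟨hμ, by simp, by simp, ?_, bdd_toType hμ, ?_, ?_⟩
  · intro m
    have h1 : #(Set.Iio m) < μ := by simpa using mk_Iio_toType_ord_lt m
    rw [← Set.Iio_insert]
    refine lt_of_le_of_lt mk_insert_le ?_
    exact add_lt_of_lt hμ.1 h1 (one_lt_aleph0.trans_le hμ.1)
  · intro a
    have h1 := mk_Iio_toType_ord_lt a
    exact Order.lt_succ_iff.1 h1
  · intro s hs
    exact bdd_toType (isRegular_succ hμ.1) s (Order.lt_succ_iff.2 hs)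

variable {μ : Cardinal.{u}} {X M : Type u} [LinearOrder X] [LinearOrder M] [WellFoundedLT X] [WellFoundedLT M]

/-- unbounded sets -/
def Ub (T : Set X) : Prop := ∀ d, ∃ t ∈ T, d < t

namespace Env

theorem Xf (E : Env μ X M) {ι : Type u} (hι : #ι ≤ μ) (f : ι → X) : ∃ b, ∀ i, f i < b := by
  obtain ⟨b, hb⟩ := E.Xb (Set.range f) (mk_range_le.trans hι)
  exact ⟨b, fun i => hb _ ⟨i, rfl⟩⟩

theorem Mf (E : Env μ X M) {ι : Type u} (hι : #ι < μ) (f : ι → M) : ∃ b, ∀ i, f i < b := by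
  obtain ⟨b, hb⟩ := E.Mb (Set.range f) (mk_range_le.trans_lt hι)
  exact ⟨b, fun i => hb _ ⟨i, rfl⟩⟩

theorem pig (E : Env μ X M) {ι : Type u} (hι : #ι ≤ μ) (T : Set X) (hT : Ub T) (P : ι → X → Prop) (h : ∀ t ∈ T, ∃ i, P i t) :
    ∃ i, Ub {t | t ∈ T ∧ P i t} := by
  by_contra! hcon
  unfold Ub at hcon
  push Not at hcon
  choose d hd using hcon
  obtain ⟨b, hb⟩ := E.Xf hι d
  obtain ⟨t, ht, hbt⟩ := hT b
  obtain ⟨i, hi⟩ := h t ht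
  exact absurd (hd i t ⟨ht, hi⟩) (not_le.2 ((hb i).trans hbt))

theorem ub_card (E : Env μ X M) {T : Set X} (hT : Ub T) : #T = Order.succ μ := by
  refine le_antisymm ((mk_set_le T).trans_eq E.cX) (Order.succ_le_of_lt ?_)
  by_contra! h
  obtain ⟨b, hb⟩ := E.Xb T h
  obtain ⟨t, ht, hbt⟩ := hT b
  exact absurd (hb t ht) hbt.asymm

theorem exists_inj (E : Env μ X M) (a : X) : ∃ r : X → M, Set.InjOn r (Set.Iio a) := by
  have h := E.Xs a
  rw [← E.cM] at h
  obtain ⟨f⟩ := h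
  have hne : Nonempty M := by
    rw [← mk_ne_zero_iff, E.cM]; exact E.reg.pos.ne'
  classical
  refine ⟨fun x => if h : x < a then f ⟨x, h⟩ else hne.some, ?_⟩
  intro x hx y hy hxy
  have hx : x < a := hx
  have hy : y < a := hy
  simp only [hx, hy, dif_pos] at hxy
  exact congrArg Subtype.val (f.injective hxy)

end Env

/-- records -/
def Rc (r : X → X → M) (a : X) : Set X := {c | c < a ∧ ∀ c' < a, r a c' < r a c → c' < c}

theorem Rc_cof (r : X → X → M) {a d : X} (hd : d < a) : ∃ c ∈ Rc r a, d ≤ c := by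
  obtain ⟨c, ⟨hc, hc'⟩, hmin⟩ := (InvImage.wf (r a) wellFounded_lt).has_min {c | d ≤ c ∧ c < a} ⟨d, le_rfl, hd⟩
  refine ⟨c, ⟨hc', ?_⟩, hc⟩
  intro c' hc'a hlt
  by_contra! hle
  exact hmin c' ⟨hc.trans hle, hc'a⟩ hlt

theorem Rc_small (E : Env μ X M) (r : X → X → M) (hr : ∀ a, Set.InjOn (r a) (Set.Iio a)) {a d : X} (hd : d < a) :
    #(Rc r a ∩ Set.Iio d : Set X) < μ := by
  refine lt_of_le_of_lt ?_ (E.Ms (r a d))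
  refine mk_le_of_injective (f := fun c => ⟨r a c.1, ?_⟩) ?_
  · by_contra! h
    exact absurd (c.2.1.2 d hd (not_le.1 h)) (not_lt.2 (le_of_lt c.2.2))
  · intro c c' hcc
    simp only [Subtype.mk.injEq] at hcc
    exact Subtype.ext (hr a c.2.1.1 c'.2.1.1 hcc)

end JG

namespace JG
set_option linter.unusedSectionVars false
universe u
open Cardinal

variable {μ : Cardinal.{u}} {X M : Type u} [LinearOrder X] [LinearOrder M] [WellFoundedLT X] [WellFoundedLT M]

/-- good records -/
def Gd (r : X → X → M) (R : X → X → M) (a : X) (i : M) (c : X) : Prop :=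
  c ∈ Rc r a ∧ r a c ≤ i ∧ ∀ c' ∈ Rc r a, ∀ c'' ∈ Rc r a, c'' < c' → c' ≤ c → R c' c'' ≤ i

/-- membership predicate -/
def Qp (R : X → X → M) (x c : X) (i : M) : Prop := x = c ∨ (x < c ∧ R c x ≤ i)

open Classical in
/-- the minimum of a predicate -/
noncomputable def mn [Nonempty M] (P : M → Prop) : M :=
  if h : ∃ i, P i then (wellFounded_lt (α := M)).min {i | P i} h else Classical.arbitrary M

theorem mn_le [Nonempty M] {P : M → Prop} (hP : ∃ i, P i) (hmono : ∀ i j, i ≤ j → P i → P j) (i : M) :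
    mn P ≤ i ↔ P i := by
  unfold mn
  rw [dif_pos hP]
  constructor
  · intro h
    exact hmono _ _ h (WellFounded.min_mem (wellFounded_lt (α := M)) {i | P i} hP)
  · intro h
    exact not_lt.1 (WellFounded.not_lt_min (wellFounded_lt (α := M)) {i | P i} h)

open Classical in
/-- the function ρ, arguments reversed -/
noncomputable def Rh [Nonempty M] (r : X → X → M) : X → X → M :=
  (wellFounded_lt (α := X)).fix fun a ih γ =>
    mn fun i => ∃ c, Gd r (fun c x => if h : c < a then ih c h x else Classical.arbitrary M) a i c ∧
      Qp (fun c x => if h : c < a then ih c h x else Classical.arbitrary M) γ c i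

theorem GQ_congr {r R R' : X → X → M} {a : X} (h : ∀ c < a, ∀ x, R c x = R' c x) {i : M} {γ c : X}
    (h0 : Gd r R a i c ∧ Qp R γ c i) : Gd r R' a i c ∧ Qp R' γ c i := by
  obtain ⟨⟨h1, h2, h3⟩, h4⟩ := h0
  refine ⟨⟨h1, h2, fun c' hc' c'' hc'' hl hle => ?_⟩, ?_⟩
  · rw [← h c' hc'.1]
    exact h3 c' hc' c'' hc'' hl hle
  · unfold Qp at *
    rw [← h c h1.1]
    exact h4

theorem Rh_eq [Nonempty M] (r : X → X → M) (a γ : X) :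
    Rh r a γ = mn fun i => ∃ c, Gd r (Rh r) a i c ∧ Qp (Rh r) γ c i := by
  conv_lhs => unfold Rh
  rw [WellFounded.fix_eq]
  congr 1
  funext i
  apply propext
  apply exists_congr
  intro c
  constructor
  · intro h
    refine GQ_congr ?_ h
    intro c hc x
    dsimp only
    rw [dif_pos hc]
    rfl
  · intro h
    refine GQ_congr ?_ h
    intro c hc x
    dsimp only
    rw [dif_pos hc]
    rfl

theorem Rh_le [Nonempty M] (E : Env μ X M) (r : X → X → M) (hr : ∀ a, Set.InjOn (r a) (Set.Iio a))
    {a γ : X} (hγ : γ < a) (i : M) : Rh r a γ ≤ i ↔ ∃ c, Gd r (Rh r) a i c ∧ Qp (Rh r) γ c i := by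
  rw [Rh_eq]
  refine mn_le (P := fun i => ∃ c, Gd r (Rh r) a i c ∧ Qp (Rh r) γ c i) ?_ ?_ i
  · obtain ⟨c, hc, hγc⟩ := Rc_cof r hγ
    have h1 : #(Rc r a ∩ Set.Iic c : Set X) < μ := by
      have : (Rc r a ∩ Set.Iic c : Set X) ⊆ insert c (Rc r a ∩ Set.Iio c) := by
        rintro x ⟨hx, hx'⟩
        rcases eq_or_lt_of_le (show x ≤ c from hx') with h | h
        · exact Or.inl h
        · exact Or.inr ⟨hx, h⟩
      refine (mk_le_mk_of_subset this).trans_lt (mk_insert_le.trans_lt ?_)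
      exact add_lt_of_lt E.reg.1 (Rc_small E r hr hc.1) (one_lt_aleph0.trans_le E.reg.1)
    have h2 : #((Rc r a ∩ Set.Iic c : Set X) × (Rc r a ∩ Set.Iic c : Set X)) < μ := by
      rw [mk_prod, lift_id]
      exact mul_lt_of_lt E.reg.1 h1 h1
    obtain ⟨b, hb⟩ := E.Mf h2 fun p => Rh r p.1.1 p.2.1
    refine ⟨max b (max (r a c) (Rh r c γ)), c, ⟨hc, (le_max_left _ _).trans (le_max_right _ _), ?_⟩, ?_⟩
    · intro c' hc' c'' hc'' hlt hle
      exact (hb ⟨⟨c', hc', hle⟩, ⟨c'', hc'', hlt.le.trans hle⟩⟩).le.trans (le_max_left _ _)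
    · rcases eq_or_lt_of_le hγc with h | h
      · exact Or.inl h
      · exact Or.inr ⟨h, (le_max_right _ _).trans (le_max_right _ _)⟩
  · rintro i j hij ⟨c, ⟨h1, h2, h3⟩, h4⟩
    refine ⟨c, ⟨h1, h2.trans hij, fun c' hc' c'' hc'' hl hle => (h3 c' hc' c'' hc'' hl hle).trans hij⟩, ?_⟩
    rcases h4 with h | h
    · exact Or.inl h
    · exact Or.inr ⟨h.1, h.2.trans hij⟩

theorem Rh_small [Nonempty M] (E : Env μ X M) (r : X → X → M) (hr : ∀ a, Set.InjOn (r a) (Set.Iio a))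
    (a : X) (i : M) : #{γ | γ < a ∧ Rh r a γ ≤ i} < μ := by
  induction a using WellFoundedLT.induction with
  | _ a ih =>
    have hsub : {γ | γ < a ∧ Rh r a γ ≤ i} ⊆ ⋃ c : {c | c ∈ Rc r a ∧ r a c ≤ i},
        insert c.1 {γ | γ < c.1 ∧ Rh r c.1 γ ≤ i} := by
      rintro γ ⟨hγ, hle⟩
      rw [Rh_le E r hr hγ] at hle
      obtain ⟨c, ⟨h1, h2, h3⟩, h4⟩ := hle
      exact Set.mem_iUnion.2 ⟨⟨c, h1, h2⟩, h4⟩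
    refine (mk_le_mk_of_subset hsub).trans_lt ?_
    rw [card_iUnion_lt_iff_forall_of_isRegular E.reg]
    · intro c
      refine mk_insert_le.trans_lt ?_
      exact add_lt_of_lt E.reg.1 (ih c.1 c.2.1.1) (one_lt_aleph0.trans_le E.reg.1)
    · refine lt_of_le_of_lt ?_ (E.Ms i)
      refine mk_le_of_injective (f := fun c => ⟨r a c.1, c.2.2⟩) ?_
      intro c c' hcc
      exact Subtype.ext (hr a c.2.1.1 c'.2.1.1 (congrArg Subtype.val hcc))

theorem Rh_coh [Nonempty M] (E : Env μ X M) (r : X → X → M) (hr : ∀ a, Set.InjOn (r a) (Set.Iio a))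
    (a : X) (i : M) : ∀ β < a, ∀ γ < β, Rh r a β ≤ i → (Rh r β γ ≤ i ↔ Rh r a γ ≤ i) := by
  induction a using WellFoundedLT.induction with
  | _ a ih =>
    intro β hβ γ hγ hle
    have lift : ∀ x c m, Gd r (Rh r) a i c → Gd r (Rh r) a i m → c ≤ m → Qp (Rh r) x c i → Qp (Rh r) x m i := by
      intro x c m hc hm hcm hx
      rcases eq_or_lt_of_le hcm with rfl | hlt
      · exact hx
      · have hmc := hm.2.2 m hm.1 c hc.1 hlt le_rfl
        rcases hx with rfl | ⟨h1, h2⟩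
        · exact Or.inr ⟨hlt, hmc⟩
        · exact Or.inr ⟨h1.trans hlt, (ih m hm.1.1 c hlt x h1 hmc).1 h2⟩
    rw [Rh_le E r hr hβ] at hle
    rw [Rh_le E r hr (hγ.trans hβ)]
    obtain ⟨c, hc, hq⟩ := hle
    constructor
    · intro h
      refine ⟨c, hc, ?_⟩
      rcases hq with rfl | ⟨h1, h2⟩
      · exact Or.inr ⟨hγ, h⟩
      · exact Or.inr ⟨hγ.trans h1, (ih c hc.1.1 β h1 γ hγ h2).1 h⟩
    · rintro ⟨c2, hc2, hq2⟩
      obtain ⟨m, hm, q1, q2⟩ : ∃ m, Gd r (Rh r) a i m ∧ Qp (Rh r) β m i ∧ Qp (Rh r) γ m i := by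
        rcases le_total c c2 with h | h
        · exact ⟨c2, hc2, lift _ _ _ hc hc2 h hq, hq2⟩
        · exact ⟨c, hc, hq, lift _ _ _ hc2 hc h hq2⟩
      rcases q1 with rfl | ⟨h1, h2⟩
      · rcases q2 with rfl | ⟨h3, h4⟩
        · exact absurd hγ (lt_irrefl _)
        · exact h4
      · rcases q2 with rfl | ⟨h3, h4⟩
        · exact absurd hγ h1.asymm
        · exact (ih m hm.1.1 β h1 γ hγ h2).2 h4

/-- the distance function package -/
structure Rho (μ : Cardinal.{u}) (ρ : X → X → M) : Prop where
  small : ∀ a i, #{γ | γ < a ∧ ρ γ a ≤ i} < μ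
  tri : ∀ γ β α, γ < β → β < α → ρ γ α ≤ max (ρ γ β) (ρ β α)
  tri' : ∀ γ β α, γ < β → β < α → ρ γ β ≤ max (ρ γ α) (ρ β α)

theorem exists_rho (E : Env μ X M) : ∃ ρ : X → X → M, Rho μ ρ := by
  have hne : Nonempty M := by
    rw [← mk_ne_zero_iff, E.cM]; exact E.reg.pos.ne'
  choose r hr using E.exists_inj
  refine ⟨fun x a => Rh r a x, fun a i => Rh_small E r hr a i, ?_, ?_⟩
  · intro γ β α h1 h2
    exact (Rh_coh E r hr α _ β h2 γ h1 (le_max_right _ _)).1 (le_max_left _ _)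
  · intro γ β α h1 h2
    exact (Rh_coh E r hr α _ β h2 γ h1 (le_max_right _ _)).2 (le_max_left _ _)

theorem thin (E : Env μ X M) {ρ : X → X → M} (hρ : Rho μ ρ) (T : Set X) (hT : Ub T) (j : M) :
    ∃ T' ⊆ T, Ub T' ∧ ∀ β ∈ T', ∀ α ∈ T', β < α → j < ρ β α := by
  have hex : ∃ rk : X → M, ∀ β α, β < α → ρ β α ≤ j → rk β < rk α := by
    have hb : ∀ (a : X) (f : ∀ b, b < a → M), ∃ m, ∀ b (hb : b < a), ρ b a ≤ j → f b hb < m := by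
      intro a f
      obtain ⟨m, hm⟩ := E.Mf (hρ.small a j) fun x => f x.1 x.2.1
      exact ⟨m, fun b hb hj => hm ⟨b, hb, hj⟩⟩
    choose g hg using hb
    refine ⟨(wellFounded_lt (α := X)).fix g, ?_⟩
    intro β α hlt hj
    conv_rhs => rw [WellFounded.fix_eq]
    exact hg α (fun y _ => (wellFounded_lt (α := X)).fix g y) β hlt hj
  obtain ⟨rk, hrk⟩ := hex
  obtain ⟨m, hm⟩ := E.pig (ι := M) E.cM.le T hT (fun m t => rk t = m) fun t _ => ⟨_, rfl⟩
  refine ⟨_, fun t ht => ht.1, hm, ?_⟩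
  rintro β ⟨h1, h2⟩ α ⟨h3, h4⟩ hlt
  by_contra! h
  exact absurd (hrk β α hlt h) (by rw [h2, h4]; exact lt_irrefl _)

end JG

namespace JG
set_option linter.unusedSectionVars false
universe u
open Cardinal

variable {μ : Cardinal.{u}} {X M : Type u} [LinearOrder X] [LinearOrder M] [WellFoundedLT X] [WellFoundedLT M]

/-- points of large cofinality -/
def Sc (μ : Cardinal.{u}) (d : X) : Prop := ∀ C : Set X, (∀ c ∈ C, c < d) → #C < μ → ∃ b < d, ∀ c ∈ C, c < b

/-- stationary -/
def St (A : Set X) : Prop := ∀ f : X → X, ∃ d ∈ A, ∀ a < d, f a < d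

theorem st_Sc (E : Env μ X M) : St {d : X | Sc μ d} := by
  intro f
  -- a function bounding `f` below a point
  have hf : ∀ a, ∃ b, ∀ x ≤ a, f x < b := by
    intro a
    obtain ⟨a', ha'⟩ := E.Xb {a} (by simpa using one_le_aleph0.trans E.reg.1)
    obtain ⟨b, hb⟩ := E.Xf (E.Xs a') fun x => f x.1
    exact ⟨b, fun x hx => hb ⟨x, lt_of_le_of_lt hx (ha' a rfl)⟩⟩
  choose f' hf' using hf
  have hb : ∀ (m : M) (y : ∀ n, n < m → X), ∃ b, ∀ n (hn : n < m), y n hn < b ∧ f' (y n hn) < b := by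
    intro m y
    have hc : #(Set.Iio m) ≤ μ := (mk_set_le _).trans E.cM.le
    obtain ⟨b, hb⟩ := E.Xf hc fun n => y n.1 n.2
    obtain ⟨b', hb'⟩ := E.Xf hc fun n => f' (y n.1 n.2)
    exact ⟨max b b', fun n hn => ⟨lt_max_of_lt_left (hb ⟨n, hn⟩), lt_max_of_lt_right (hb' ⟨n, hn⟩)⟩⟩
  choose g hg using hb
  let y : M → X := (wellFounded_lt (α := M)).fix g
  have hy : ∀ n m, n < m → y n < y m ∧ f' (y n) < y m := by
    intro n m hnm
    have : y m = g m fun n _ => y n := WellFounded.fix_eq _ _ _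
    rw [this]
    exact hg m (fun n _ => y n) n hnm
  have hMn : ∀ m : M, ∃ m', m < m' := by
    intro m
    obtain ⟨b, hb⟩ := E.Mb {m} (by simpa using one_lt_aleph0.trans_le E.reg.1)
    exact ⟨b, hb m rfl⟩
  let d := (wellFounded_lt (α := X)).min {b | ∀ m, y m < b} (E.Xf E.cM.le y)
  have hd : ∀ m, y m < d := WellFounded.min_mem (wellFounded_lt (α := X)) {b | ∀ m, y m < b} (E.Xf E.cM.le y)
  have hd' : ∀ a < d, ∃ m, a < y m := by
    intro a ha
    by_contra! hcon
    have : ∀ m, y m < a := by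
      intro m
      obtain ⟨m', hm'⟩ := hMn m
      exact (hy m m' hm').1.trans_le (hcon m')
    exact WellFounded.not_lt_min (wellFounded_lt (α := X)) {b | ∀ m, y m < b} this ha
  refine ⟨d, ?_, ?_⟩
  · intro C hC hCμ
    choose m hm using fun c : C => hd' c.1 (hC c.1 c.2)
    obtain ⟨b, hb⟩ := E.Mf hCμ m
    exact ⟨y b, hd b, fun c hc => (hm ⟨c, hc⟩).trans (hy _ _ (hb ⟨c, hc⟩)).1⟩
  · intro a ha
    obtain ⟨m, hm⟩ := hd' a ha
    obtain ⟨m', hm'⟩ := hMn m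
    exact (hf' (y m) a hm.le).trans ((hy m m' hm').2.trans (hd m'))

theorem st_split (E : Env μ X M) : ∃ i : X → X, ∀ x, St {d : X | Sc μ d ∧ i d = x} := by
  choose r hr using E.exists_inj
  let A : X → M → Set X := fun t ξ => {d | Sc μ d ∧ t < d ∧ r d t = ξ}
  have h1 : ∀ t, ∃ ξ, St (A t ξ) := by
    intro t
    by_contra! hcon
    unfold St at hcon
    push Not at hcon
    choose f hf using hcon
    choose f' hf' using fun a => E.Xf E.cM.le fun ξ => f ξ a
    obtain ⟨d, hd, hcl⟩ := st_Sc E fun a => max (f' a) t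
    obtain ⟨b, hb, -⟩ := hd ∅ (by simp) (by simpa using E.reg.pos)
    have htd : t < d := (le_max_right _ _).trans_lt (hcl b hb)
    obtain ⟨a, ha, hda⟩ := hf (r d t) d ⟨hd, htd, rfl⟩
    exact absurd (((hf' a (r d t)).trans_le (le_max_left _ _)).trans (hcl a ha)) (not_lt.2 hda)
  have hub : Ub (Set.univ : Set X) := by
    intro a
    obtain ⟨a', ha'⟩ := E.Xb {a} (by simpa using one_le_aleph0.trans E.reg.1)
    exact ⟨a', trivial, ha' a rfl⟩
  obtain ⟨ξ, hξ⟩ := E.pig E.cM.le Set.univ hub (fun ξ t => St (A t ξ)) fun t _ => h1 t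
  have hcard : #X ≤ #{t | t ∈ Set.univ ∧ St (A t ξ)} := by
    rw [E.ub_card hξ, E.cX]
  obtain ⟨g⟩ := hcard
  classical
  refine ⟨fun d => if h : ∃ x, (g x).1 < d ∧ r d (g x).1 = ξ then h.choose else d, ?_⟩
  intro x f
  obtain ⟨d, ⟨hd1, hd2, hd3⟩, hcl⟩ := (g x).2.2 f
  refine ⟨d, ⟨hd1, ?_⟩, hcl⟩
  have h : ∃ x, (g x).1 < d ∧ r d (g x).1 = ξ := ⟨x, hd2, hd3⟩
  show (if h : ∃ x, (g x).1 < d ∧ r d (g x).1 = ξ then h.choose else d) = x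
  rw [dif_pos h]
  have hs := h.choose_spec
  have := hr d hs.1 hd2 (hs.2.trans hd3.symm)
  exact g.injective (Subtype.ext this)

theorem jonsson (E : Env μ X M) {ρ : X → X → M} (hρ : Rho μ ρ) : ∃ (F : X → X → X) (i : X → X), ∀ Y : Set X, Ub Y →
    (∀ β ∈ Y, ∀ α ∈ Y, β < α → F β α < α → ρ (F β α) α < ρ β α → F β α ∈ Y) →
    (∀ β ∈ Y, ∀ α ∈ Y, β < α → i α < α → ρ (i α) α < ρ β α → i α ∈ Y) → Y = Set.univ := by
  obtain ⟨i, hi⟩ := st_split E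
  choose r hr using E.exists_inj
  have hF : ∀ β α, ∃ γ, (∃ c ∈ Rc r α, β ≤ c) → γ ∈ Rc r α ∧ β ≤ γ ∧ ∀ c ∈ Rc r α, β ≤ c → γ ≤ c := by
    intro β α
    by_cases h : ∃ c ∈ Rc r α, β ≤ c
    · obtain ⟨γ, ⟨h1, h2⟩, h3⟩ := (wellFounded_lt (α := X)).has_min {c | c ∈ Rc r α ∧ β ≤ c} h
      exact ⟨γ, fun _ => ⟨h1, h2, fun c hc hc' => not_lt.1 (h3 c ⟨hc, hc'⟩)⟩⟩
    · exact ⟨β, fun h' => absurd h' h⟩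
  choose F hF using hF
  refine ⟨F, i, ?_⟩
  intro Y hY hYF hYi
  choose f hfY hf using hY
  have key : ∀ d, Sc μ d → (∀ a < d, f a < d) → d ∈ Y := by
    intro d hd hcl
    by_contra hdY
    obtain ⟨α, ⟨hα, hdα⟩, hmin⟩ := (wellFounded_lt (α := X)).has_min {a | a ∈ Y ∧ d < a} ⟨f d, hfY d, hf d⟩
    have hdα : d < α := hdα
    have hno : ∀ y ∈ Y, d ≤ y → ¬ y < α := by
      intro y hy hdy hyα
      rcases eq_or_lt_of_le hdy with h | h
      · exact hdY (h ▸ hy)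
      · exact hmin y ⟨hy, h⟩ hyα
    obtain ⟨h1, h2, h3⟩ := hF d α (Rc_cof r hdα)
    obtain ⟨b, hb, hbC⟩ := hd ((Rc r α ∩ Set.Iio d) ∪ ({γ | γ < α ∧ ρ γ α ≤ ρ (F d α) α} ∩ Set.Iio d))
      (by rintro c (h | h); exacts [h.2, h.2])
      ((mk_union_le _ _).trans_lt (add_lt_of_lt E.reg.1 (Rc_small E r hr hdα)
        ((mk_le_mk_of_subset Set.inter_subset_left).trans_lt (hρ.small α _))))
    have hβY := hfY b
    have hbβ := hf b
    have hβd := hcl b hb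
    generalize f b = β at *
    have hβα := hβd.trans hdα
    obtain ⟨g1, g2, g3⟩ := hF β α (Rc_cof r hβα)
    have hge : d ≤ F β α := by
      by_contra! hlt
      exact absurd ((hbC _ (Or.inl ⟨g1, hlt⟩)).trans hbβ) (not_lt.2 g2)
    have heq : F β α = F d α := le_antisymm (g3 _ h1 (hβd.le.trans h2)) (h3 _ g1 hge)
    have hρ' : ρ (F d α) α < ρ β α := by
      by_contra! hle
      exact absurd (hbC β (Or.inr ⟨⟨hβα, hle⟩, hβd⟩)) hbβ.asymm
    have := hYF β hβY α hα hβα (heq ▸ h1.1) (heq ▸ hρ')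
    exact hno _ this hge g1.1
  ext x
  simp only [Set.mem_univ, iff_true]
  obtain ⟨d, ⟨hd, hdx⟩, hcl⟩ := hi x fun a => max (f a) x
  obtain ⟨b0, hb0, -⟩ := hd ∅ (by simp) (by simpa using E.reg.pos)
  have hxd : x < d := (le_max_right _ _).trans_lt (hcl b0 hb0)
  have hcl' : ∀ a < d, f a < d := fun a ha => (le_max_left _ _).trans_lt (hcl a ha)
  have hdY := key d hd hcl'
  obtain ⟨b, hb, hbC⟩ := hd {γ | γ < d ∧ ρ γ d ≤ ρ x d} (fun c hc => hc.1) (hρ.small d _)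
  have hlt : ρ x d < ρ (f b) d := by
    by_contra! hle
    exact absurd (hbC (f b) ⟨hcl' b hb, hle⟩) (hf b).asymm
  have := hYi (f b) (hfY b) d hdY (hcl' b hb)
  rw [hdx] at this
  exact this hxd hlt

end JG

namespace JG
set_option linter.unusedSectionVars false
universe u v w

theorem Nice.trans {F : Type u} [Group F] {K0 N0 K1 N1 K2 N2 : Subgroup F} (h : Nice K0 N0 K1 N1)
    (h' : Nice K1 N1 K2 N2) (hp : Pr K2 N2) : Nice K0 N0 K2 N2 := by
  refine ⟨h.leK.trans h'.leK, h.leN.trans h'.leN, fun x hx hx' => h.emb x hx (h'.emb x (h.leK hx) hx'), ?_⟩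
  intro x hx y hy y' hy' hm
  rcases h'.mal x hx y (h.leK hy) y' (h.leK hy') hm with h1 | ⟨z, hz, hz'⟩
  · exact Or.inl (h.emb y hy h1)
  · -- replace `x` by `z`
    have hzK := h'.leK hz
    have hn := hp.le hz'
    have e : z * y * z⁻¹ * y'⁻¹ ∈ N2 := by
      have e1 : z * y * z⁻¹ * y'⁻¹ = (x * ((x⁻¹ * z) * (y * (x⁻¹ * z)⁻¹ * y⁻¹)) * x⁻¹) * (x * y * x⁻¹ * y'⁻¹) := by group
      rw [e1]
      refine mul_mem (hp.conj _ hx _ (mul_mem hz' (hp.conj _ (h'.leK (h.leK hy)) _ (inv_mem hz')))) hm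
    have e' := h'.emb _ (mul_mem (mul_mem (mul_mem hz (h.leK hy)) (inv_mem hz)) (inv_mem (h.leK hy'))) e
    rcases h.mal z hz y hy y' hy' e' with h2 | ⟨w, hw, hw'⟩
    · exact Or.inl h2
    · refine Or.inr ⟨w, hw, ?_⟩
      have : x⁻¹ * w = (x⁻¹ * z) * (z⁻¹ * w) := by group
      rw [this]
      exact mul_mem hz' (h'.leN hw')

namespace Sys
variable {X : Type u} {Ξ : Type v} {M : Type w} [LinearOrder X] [LinearOrder M] [LinearOrder Ξ]
  [WellFoundedLT X] [WellFoundedLT M] (Y : Sys X Ξ M)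

theorem cl_univ : Y.Cl Set.univ := fun _ _ _ _ _ _ _ _ => trivial

theorem cl_Iic (δ : X) : Y.Cl (Set.Iic δ) := by
  have := Y.cl_univ.inter_Iic δ
  rwa [Set.univ_inter] at this

theorem cl_Iio (δ : X) : Y.Cl (Set.Iio δ) := fun _ hd _ _ _ _ h _ => h.trans hd

theorem nice_Iio (α : X) : Nice (Fs (Set.Iio α)) (Y.N (Set.Iio α)) (Fs (Set.Iic α)) (Y.N (Set.Iic α)) := by
  have e : Set.Iic α \ {α} = Set.Iio α := by
    ext x; simp [lt_iff_le_and_ne]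
  have := (Y.good_all (Y.cl_Iic α)).nice α le_rfl (by rw [e]; exact Y.cl_Iio α)
  rwa [e] at this

theorem Iio_eq {β δ : X} (h : β < δ) : Set.Iio δ = ⋃ i : {i // β ≤ i ∧ i < δ}, Set.Iic i.1 := by
  ext x
  simp only [Set.mem_Iio, Set.mem_iUnion, Set.mem_Iic]
  constructor
  · intro hx
    exact ⟨⟨max β x, le_max_left _ _, max_lt h hx⟩, le_max_right _ _⟩
  · rintro ⟨i, hi⟩
    exact hi.trans_lt i.2.2

theorem nice_Iic {β δ : X} (h : β ≤ δ) : Nice (Fs (Set.Iic β)) (Y.N (Set.Iic β)) (Fs (Set.Iic δ)) (Y.N (Set.Iic δ)) := by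
  induction δ using WellFoundedLT.induction with
  | _ δ ih =>
    rcases h.eq_or_lt with rfl | h
    · exact ⟨le_rfl, le_rfl, fun x _ h => h, fun x hx y _ y' _ _ => Or.inr ⟨x, hx, by simp⟩⟩
    refine Nice.trans ?_ (Y.nice_Iio δ) (Y.cl_Iic δ).pr
    have : Nonempty {i // β ≤ i ∧ i < δ} := ⟨⟨β, le_rfl, h⟩⟩
    have := nice_dir Y.Rel (fun _ : {i // β ≤ i ∧ i < δ} => Set.Iic β) (fun i => Set.Iic i.1) ?_
      (fun i => ih i.1 i.2.2 i.2.1) (fun i => Set.Iic_subset_Iic.2 i.2.1)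
    · rw [Set.iUnion_const, ← Iio_eq h] at this
      exact this
    · intro i j
      rcases le_total i.1 j.1 with h1 | h1
      · exact ⟨j, le_rfl, le_rfl, Set.Iic_subset_Iic.2 h1, le_rfl⟩
      · exact ⟨i, le_rfl, le_rfl, le_rfl, Set.Iic_subset_Iic.2 h1⟩

theorem nice_univ (β : X) : Nice (Fs (Set.Iic β)) (Y.N (Set.Iic β)) (Fs Set.univ) (Y.N Set.univ) := by
  have : Nonempty {i // β ≤ i} := ⟨⟨β, le_rfl⟩⟩
  have := nice_dir Y.Rel (fun _ : {i // β ≤ i} => Set.Iic β) (fun i => Set.Iic i.1) ?_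
      (fun i => Y.nice_Iic i.2) (fun i => Set.Iic_subset_Iic.2 i.2)
  · have e : (⋃ i : {i // β ≤ i}, Set.Iic i.1) = Set.univ := by
      ext x
      simp only [Set.mem_iUnion, Set.mem_Iic, Set.mem_univ, iff_true]
      exact ⟨⟨max β x, le_max_left _ _⟩, le_max_right _ _⟩
    rw [Set.iUnion_const, e] at this
    exact this
  · intro i j
    rcases le_total i.1 j.1 with h1 | h1
    · exact ⟨j, le_rfl, le_rfl, Set.Iic_subset_Iic.2 h1, le_rfl⟩
    · exact ⟨i, le_rfl, le_rfl, le_rfl, Set.Iic_subset_Iic.2 h1⟩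

theorem Fs_univ : Fs (Set.univ : Set X) = ⊤ := by
  unfold Fs
  rw [Set.image_univ]
  exact FreeGroup.closure_range_of X

instance N_normal : (Y.N Set.univ).Normal :=
  ⟨fun n hn g => Y.cl_univ.pr.conj g (by rw [Fs_univ]; trivial) n hn⟩

/-- the group -/
abbrev Gp : Type u := FreeGroup X ⧸ Y.N Set.univ

/-- the projection -/
noncomputable abbrev q : FreeGroup X →* Y.Gp := QuotientGroup.mk' (Y.N Set.univ)

theorem q_eq {x y : FreeGroup X} : Y.q x = Y.q y ↔ x⁻¹ * y ∈ Y.N Set.univ := QuotientGroup.eq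

/-- subgroups -/
noncomputable def Gs (s : Set X) : Subgroup Y.Gp := (Fs s).map Y.q

theorem Gs_mono {s t : Set X} (h : s ⊆ t) : Y.Gs s ≤ Y.Gs t := Subgroup.map_mono (Fs_mono h)

theorem q_mem {s : Set X} {x : FreeGroup X} (h : x ∈ Fs s) : Y.q x ∈ Y.Gs s := Subgroup.mem_map_of_mem _ h

theorem tfG (x : Y.Gp) (m : ℕ) (hm : 0 < m) (h : x ^ m = 1) : x = 1 := by
  obtain ⟨y, rfl⟩ := QuotientGroup.mk'_surjective _ x
  rw [← map_pow] at h
  have h' : y ^ m ∈ Y.N Set.univ := (QuotientGroup.eq_one_iff _).1 h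
  exact (QuotientGroup.eq_one_iff _).2 ((Y.good_all Y.cl_univ).tf y (by rw [Fs_univ]; trivial) m hm h')

theorem mal_of {s : Set X} (h : Nice (Fs s) (Y.N s) (Fs Set.univ) (Y.N Set.univ)) {x y : Y.Gp} (hy : y ∈ Y.Gs s)
    (hxy : x * y * x⁻¹ ∈ Y.Gs s) : y = 1 ∨ x ∈ Y.Gs s := by
  obtain ⟨x, rfl⟩ := QuotientGroup.mk'_surjective _ x
  obtain ⟨y, hy, rfl⟩ := hy
  obtain ⟨y', hy', he⟩ := hxy
  rw [← map_inv, ← map_mul, ← map_mul, eq_comm] at he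
  have : x * y * x⁻¹ * y'⁻¹ ∈ Y.N Set.univ := by
    have : Y.q (x * y * x⁻¹ * y'⁻¹) = 1 := by
      rw [map_mul, map_inv, mul_inv_eq_one]
      exact he
    exact (QuotientGroup.eq_one_iff _).1 this
  rcases h.mal x (by rw [Fs_univ]; trivial) y hy y' hy' this with h1 | ⟨z, hz, hz'⟩
  · exact Or.inl ((QuotientGroup.eq_one_iff _).2 (h.leN h1))
  · right
    have := Y.q_eq.2 hz'
    show Y.q x ∈ _
    rw [this]
    exact Y.q_mem hz

theorem mal_Iic {β : X} {x y : Y.Gp} (hy : y ∈ Y.Gs (Set.Iic β))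
    (hxy : x * y * x⁻¹ ∈ Y.Gs (Set.Iic β)) : y = 1 ∨ x ∈ Y.Gs (Set.Iic β) := Y.mal_of (Y.nice_univ β) hy hxy

theorem mal_Iio {β : X} {x y : Y.Gp} (hy : y ∈ Y.Gs (Set.Iio β))
    (hxy : x * y * x⁻¹ ∈ Y.Gs (Set.Iio β)) : y = 1 ∨ x ∈ Y.Gs (Set.Iio β) :=
  Y.mal_of ((Y.nice_Iio β).trans (Y.nice_univ β) Y.cl_univ.pr) hy hxy

theorem of_not (α : X) : Y.q (FreeGroup.of α) ∉ Y.Gs (Set.Iio α) := by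
  rintro ⟨z, hz, he⟩
  have h1 := Y.q_eq.1 he.symm
  have h2 := (Y.nice_univ α).emb _ (mul_mem (inv_mem (of_mem le_rfl)) (Fs_mono Set.Iio_subset_Iic_self hz)) h1
  have e : Set.Iic α \ {α} = Set.Iio α := by
    ext x; simp [lt_iff_le_and_ne]
  exact (Y.good_all (Y.cl_Iic α)).xx α le_rfl (fun _ h => h) z (by rw [e]; exact hz) h2

theorem of_ne (α : X) : Y.q (FreeGroup.of α) ≠ 1 := fun h => Y.of_not α (h ▸ one_mem _)

theorem of_sq_not (α : X) : Y.q (FreeGroup.of α ^ 2) ∉ Y.Gs (Set.Iio α) := by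
  intro h
  rw [map_pow] at h
  have : Y.q (FreeGroup.of α) * Y.q (FreeGroup.of α) ^ 2 * (Y.q (FreeGroup.of α))⁻¹ = Y.q (FreeGroup.of α) ^ 2 := by
    group
  rcases Y.mal_Iio (x := Y.q (FreeGroup.of α)) h (by rw [this]; exact h) with h1 | h1
  · exact Y.of_ne α (Y.tfG _ 2 two_pos h1)
  · exact Y.of_not α h1

theorem kp_mem {β α : X} (hβ : β < α) {ξ : Ξ} (hk : Y.Kp Y.Rel β α ξ) (K : Subgroup Y.Gp)
    (hh : Y.q (Y.hw ξ α) ∈ K) (hg : Y.q (Y.gw ξ β) ∈ K) : Y.q (Y.fw ξ β α) ∈ K := by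
  have hr : relr (Y.hw ξ α) (Y.gw ξ β) (Y.bw Y.Rel β α ξ) ∈ Y.Rel β α := by
    rw [Y.rel_eq hβ]
    exact ⟨ξ, hk, rfl⟩
  have hr' : relr (Y.hw ξ α) (Y.gw ξ β) (Y.bw Y.Rel β α ξ) ∈ Y.N Set.univ :=
    Subgroup.subset_closure ⟨1, one_mem _, β, trivial, α, trivial, hβ, _, hr, by simp⟩
  have hb := relr_mem (K.comap Y.q) _ _ _ hh hg (by
    show Y.q _ ∈ K
    have : Y.q (relr (Y.hw ξ α) (Y.gw ξ β) (Y.bw Y.Rel β α ξ)) = 1 := (QuotientGroup.eq_one_iff _).2 hr'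
    rw [this]; exact one_mem _)
  show Y.fw ξ β α ∈ K.comap Y.q
  have hg : Y.gw ξ β ∈ K.comap Y.q := hg
  generalize K.comap Y.q = L at *
  unfold bw at hb
  have : ∀ s, pw (Y.gw ξ β) s ∈ L := by
    intro s
    unfold pw
    split_ifs
    · exact hg
    · exact inv_mem hg
  rw [Subgroup.mul_mem_cancel_left _ (this _)] at hb
  exact inv_mem_iff.1 hb

theorem el_of {β α : X} (hβ : β < α) {ξ : Ξ} {S T : Set X} (hS : S ⊆ Y.seg α β) (hT : T ⊆ Y.seg α β ∩ Set.Iio β)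
    (hh : Y.hw ξ α ∈ Fs (insert α S)) (hg : Y.gw ξ β ∈ Fs (insert β T)) (hf : Y.fw ξ β α ∈ Fs (insert β (Y.seg α β)))
    (hh' : Y.q (Y.hw ξ α) ∉ Y.Gs (Set.Iio α)) (hg' : Y.q (Y.gw ξ β) ∉ Y.Gs (Set.Iio β)) : Y.El Y.Rel β α ξ := by
  refine ⟨Fs_mono (Set.insert_subset_insert hS) hh, Fs_mono (Set.insert_subset_insert fun x hx => (hT hx).1) hg, hf, ?_, ?_⟩
  · intro z hz hm
    apply hh'
    rw [Y.q_eq.2 (Y.N_mono (Set.subset_univ _) hm)]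
    exact Y.q_mem (Fs_mono (fun x hx => hx.1) hz)
  · intro z hz hm
    have hb : β ∉ Y.seg α β := fun h => Y.lt_irrefl' h.2
    have e1 : Y.side β α false \ {β} = Y.seg α β := by
      show insert β (Y.seg α β) \ {β} = _
      simp [hb]
    obtain ⟨w, hw, hw'⟩ := (Y.good_all (Y.seg_init' hβ).cl).inter β (Or.inl rfl)
      (by rw [show insert β (Y.seg α β) \ {β} = Y.seg α β from e1]; exact (Y.seg_init α β).cl) (Y.gw ξ β)
      (Fs_mono (by
        rintro x (rfl | hx)
        · exact ⟨Or.inl rfl, le_rfl⟩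
        · exact ⟨Or.inr (hT hx).1, (hT hx).2.le⟩) hg) z
      (by rw [show insert β (Y.seg α β) \ {β} = Y.seg α β from e1]; exact hz) hm
    apply hg'
    rw [Y.q_eq.2 (Y.N_mono (Set.subset_univ _) hw')]
    exact Y.q_mem (Fs_mono (fun x hx => hx.2) hw)

theorem cj_eq {β α : X} {ξ ξ' : Ξ} (h : Y.Cj Y.Rel β α ξ ξ') : ∃ a ∈ Y.Gs (Set.Iio α),
    Y.q (Y.hw ξ α) = a * Y.q (Y.hw ξ' α) * a⁻¹ ∧ Y.q (Y.gw ξ β) = a * Y.q (Y.gw ξ' β) * a⁻¹ := by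
  obtain ⟨a, ha, h1, h2⟩ := h
  refine ⟨Y.q a, Y.q_mem (Fs_mono (fun x hx => hx.1) ha), ?_, ?_⟩
  · rw [Y.q_eq.2 (Y.N_mono (Set.subset_univ _) h1)]; simp
  · rw [Y.q_eq.2 (Y.N_mono (Set.subset_univ _) h2)]; simp

end Sys
end JG

namespace JG
set_option linter.unusedSectionVars false
universe u
open Cardinal

theorem card_Fs {X : Type u} {c : Cardinal.{u}} (hc : ℵ₀ ≤ c) (s : Set X) (hs : #s ≤ c) : #(Fs s) ≤ c := by
  have h1 : (Fs s : Set (FreeGroup X)) ⊆ Set.range (FreeGroup.map (Subtype.val : s → X)) := by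
    have : Fs s ≤ (FreeGroup.map (Subtype.val : s → X)).range := by
      unfold Fs
      rw [Subgroup.closure_le]
      rintro _ ⟨x, hx, rfl⟩
      exact ⟨FreeGroup.of ⟨x, hx⟩, by simp⟩
    exact this
  refine (mk_le_mk_of_subset h1).trans (mk_range_le.trans ?_)
  rcases isEmpty_or_nonempty s with h | h
  · haveI : Finite (FreeGroup s) := inferInstance
    exact (lt_aleph0_of_finite _).le.trans hc
  · rw [mk_freeGroup]; exact max_le hs hc

variable {μ : Cardinal.{u}} {X M : Type u} [LinearOrder X] [LinearOrder M] [WellFoundedLT X] [WellFoundedLT M]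

theorem Env.card_Iic (E : Env μ X M) (a : X) : #(Set.Iic a) ≤ μ := by
  rw [← Set.Iio_insert]
  refine mk_insert_le.trans ?_
  exact add_le_of_le E.reg.1 (E.Xs a) (one_lt_aleph0.le.trans E.reg.1)

theorem Env.enum (E : Env μ X M) (a : X) : ∃ e : M → FreeGroup X, Set.range e = (Fs (Set.Iic a) : Set (FreeGroup X)) := by
  have h := card_Fs E.reg.1 _ (E.card_Iic a)
  rw [← E.cM] at h
  obtain ⟨f⟩ := h
  obtain ⟨g, hg⟩ := (Function.Embedding.trans f (Function.Embedding.refl M)).injective.hasLeftInverse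
  refine ⟨fun m => (g m).1, ?_⟩
  ext x
  constructor
  · rintro ⟨m, rfl⟩
    exact (g m).2
  · intro hx
    exact ⟨f ⟨x, hx⟩, congrArg Subtype.val (hg ⟨x, hx⟩)⟩

theorem Rho.coh {ρ : X → X → M} (h : Rho μ ρ) (γ' γ δ α : X) (h1 : γ' < δ) (h2 : γ < δ) (h3 : δ < α)
    (h4 : ρ γ' δ < ρ γ δ ∨ (ρ γ' δ = ρ γ δ ∧ γ' < γ)) :
    (ρ γ' α < ρ γ α ∨ (ρ γ' α = ρ γ α ∧ γ' < γ)) ∨ (ρ γ' α < ρ δ α ∨ (ρ γ' α = ρ δ α ∧ γ' < δ)) := by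
  rcases lt_trichotomy (ρ γ' α) (ρ δ α) with h5 | h5 | h5
  · exact Or.inr (Or.inl h5)
  · exact Or.inr (Or.inr ⟨h5, h1⟩)
  left
  have a1 : ρ γ' α ≤ ρ γ' δ := by
    rcases le_max_iff.1 (h.tri γ' δ α h1 h3) with h6 | h6
    · exact h6
    · exact absurd h5 (not_lt.2 h6)
  have a2 : ρ γ' δ ≤ ρ γ δ := by
    rcases h4 with h4 | h4
    · exact h4.le
    · exact h4.1.le
  have a3 : ρ γ δ ≤ ρ γ α := by
    rcases le_max_iff.1 (h.tri' γ δ α h2 h3) with h6 | h6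
    · exact h6
    · exact absurd (h5.trans_le (a1.trans a2)) (not_lt.2 h6)
  rcases h4 with h4 | h4
  · exact Or.inl (a1.trans_lt (h4.trans_le a3))
  · rcases (a1.trans (a2.trans a3)).eq_or_lt with h6 | h6
    · exact Or.inr ⟨h6, h4.2⟩
    · exact Or.inl h6

/-- index set -/
abbrev Ix (M : Type u) := WithBot (WithBot M)

open Classical in
/-- the system -/
noncomputable def mkSys (ρ : X → X → M) (h : Rho μ ρ) (F : X → X → X) (i : X → X) (e : X → M → FreeGroup X) : Sys X (Ix M) M where
  ρ := ρ
  coh := h.coh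
  hw := fun ξ α => match ξ with
    | ⊥ => FreeGroup.of α
    | ((⊥ : WithBot M) : Ix M) => FreeGroup.of α
    | (((m : M) : WithBot M) : Ix M) => e α m
  gw := fun ξ α => match ξ with
    | ⊥ => FreeGroup.of α
    | ((⊥ : WithBot M) : Ix M) => FreeGroup.of α ^ 2
    | (((m : M) : WithBot M) : Ix M) => e α m
  fw := fun ξ β α => match ξ with
    | ⊥ => if F β α < α ∧ ρ (F β α) α < ρ β α then FreeGroup.of (F β α) else FreeGroup.of β
    | ((⊥ : WithBot M) : Ix M) => if i α < α ∧ ρ (i α) α < ρ β α then FreeGroup.of (i α) else FreeGroup.of β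
    | (((m : M) : WithBot M) : Ix M) => FreeGroup.of β

section
variable (ρ : X → X → M) (h : Rho μ ρ) (F : X → X → X) (i : X → X) (e : X → M → FreeGroup X)

theorem kp0 {β α : X} (hβ : β < α) : (mkSys ρ h F i e).Kp (mkSys ρ h F i e).Rel β α ⊥ := by
  refine ⟨?_, fun ξ' h => absurd h not_lt_bot⟩
  refine (mkSys ρ h F i e).el_of hβ (S := ∅) (T := ∅) (Set.empty_subset _) (Set.empty_subset _)
    (of_mem (Or.inl rfl)) (of_mem (Or.inl rfl)) ?_ (Sys.of_not _ _) (Sys.of_not _ _)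
  show (if F β α < α ∧ ρ (F β α) α < ρ β α then FreeGroup.of (F β α) else FreeGroup.of β) ∈ _
  split_ifs with hc
  · exact of_mem (Or.inr ⟨hc.1, Or.inl hc.2⟩)
  · exact of_mem (Or.inl rfl)

theorem lt1 {ξ : Ix M} (h : ξ < ((⊥ : WithBot M) : Ix M)) : ξ = ⊥ := by
  rcases ξ with _ | a
  · rfl
  · exact absurd (WithBot.coe_lt_coe.1 h) not_lt_bot

theorem kp1 {β α : X} (hβ : β < α) : (mkSys ρ h F i e).Kp (mkSys ρ h F i e).Rel β α ((⊥ : WithBot M) : Ix M) := by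
  refine ⟨?_, ?_⟩
  · refine (mkSys ρ h F i e).el_of hβ (S := ∅) (T := ∅) (Set.empty_subset _) (Set.empty_subset _)
      (of_mem (Or.inl rfl)) (show FreeGroup.of β ^ 2 ∈ Fs (insert β ∅) from pow_mem (of_mem (Set.mem_insert _ _)) 2) ?_ (Sys.of_not _ _) (Sys.of_sq_not _ _)
    show (if i α < α ∧ ρ (i α) α < ρ β α then FreeGroup.of (i α) else FreeGroup.of β) ∈ _
    split_ifs with hc
    · exact of_mem (Or.inr ⟨hc.1, Or.inl hc.2⟩)
    · exact of_mem (Or.inl rfl)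
  · intro ξ' hξ' _ hcj
    rw [lt1 hξ'] at hcj
    obtain ⟨a, ha, h1, h2⟩ := Sys.cj_eq _ hcj
    generalize hY : mkSys ρ h F i e = Y at *
    have h1 : Y.q (FreeGroup.of α) = a * Y.q (FreeGroup.of α) * a⁻¹ := by
      subst hY; exact h1
    have h2 : Y.q (FreeGroup.of β ^ 2) = a * Y.q (FreeGroup.of β) * a⁻¹ := by
      subst hY; exact h2
    have h3 : Y.q (FreeGroup.of α) * a * (Y.q (FreeGroup.of α))⁻¹ = a := by
      rw [mul_inv_eq_iff_eq_mul]
      rw [eq_mul_inv_iff_mul_eq] at h1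
      exact h1
    rcases Y.mal_Iio (x := Y.q (FreeGroup.of α)) ha (by rw [h3]; exact ha) with h4 | h4
    · subst h4
      rw [map_pow] at h2
      simp only [one_mul, inv_one, mul_one, pow_two] at h2
      exact Y.of_ne β (mul_eq_left.1 h2)
    · exact Y.of_not α h4

variable {ρ h F i e}
/-- second half of the argument: enough generators -/
theorem fin (hJ : ∀ Y : Set X, Ub Y →
    (∀ β ∈ Y, ∀ α ∈ Y, β < α → F β α < α → ρ (F β α) α < ρ β α → F β α ∈ Y) →
    (∀ β ∈ Y, ∀ α ∈ Y, β < α → i α < α → ρ (i α) α < ρ β α → i α ∈ Y) → Y = Set.univ)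
    (K : Subgroup (mkSys ρ h F i e).Gp) (hK : Ub {β | (mkSys ρ h F i e).q (FreeGroup.of β) ∈ K}) : K = ⊤ := by
  have h1 := hJ _ hK ?_ ?_
  · have h2 : Fs (Set.univ : Set X) ≤ K.comap (mkSys ρ h F i e).q := by
      unfold Fs
      rw [Subgroup.closure_le]
      rintro _ ⟨x, _, rfl⟩
      have : x ∈ {β | (mkSys ρ h F i e).q (FreeGroup.of β) ∈ K} := by rw [h1]; trivial
      exact this
    rw [eq_top_iff]
    intro g _
    obtain ⟨y, rfl⟩ := QuotientGroup.mk'_surjective _ g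
    exact h2 (by rw [Sys.Fs_univ]; trivial)
  · intro β hβ α hα hlt hF hr
    have := (mkSys ρ h F i e).kp_mem hlt (kp0 ρ h F i e hlt) K hα hβ
    have e1 : (mkSys ρ h F i e).fw ⊥ β α = FreeGroup.of (F β α) := if_pos ⟨hF, hr⟩
    rw [e1] at this
    exact this
  · intro β hβ α hα hlt hF hr
    have := (mkSys ρ h F i e).kp_mem hlt (kp1 ρ h F i e hlt) K hα (by
      show (mkSys ρ h F i e).q (FreeGroup.of β ^ 2) ∈ K
      rw [map_pow]
      exact pow_mem hβ 2)
    have e1 : (mkSys ρ h F i e).fw ((⊥ : WithBot M) : Ix M) β α = FreeGroup.of (i α) := if_pos ⟨hF, hr⟩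
    rw [e1] at this
    exact this

theorem card_Ix (E : Env μ X M) : #(Ix M) ≤ μ := by
  have : ∀ (A : Type u), #A ≤ μ → #(WithBot A) ≤ μ := by
    intro A hA
    have : #(WithBot A) = #A + 1 := mk_option
    rw [this]
    exact add_le_of_le E.reg.1 hA (one_lt_aleph0.le.trans E.reg.1)
  exact this _ (this _ E.cM.le)

theorem card_Gs (E : Env μ X M) (Y : Sys X (Ix M) M) (a : X) : #(Y.Gs (Set.Iic a)) ≤ μ := by
  refine le_trans ?_ (card_Fs E.reg.1 _ (E.card_Iic a))
  have : (Y.Gs (Set.Iic a) : Set Y.Gp) = Y.q '' (Fs (Set.Iic a) : Set (FreeGroup X)) := rfl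
  show #((Y.Gs (Set.Iic a) : Set Y.Gp)) ≤ _
  rw [this]
  exact mk_image_le

theorem Fs_rank (ρ : X → X → M) (E : Env μ X M) {α : X} {x : FreeGroup X} (hx : x ∈ Fs (Set.Iic α)) :
    ∃ j, x ∈ Fs (insert α {γ | γ < α ∧ ρ γ α ≤ j}) := by
  have hne : Nonempty M := by
    rw [← mk_ne_zero_iff, E.cM]; exact E.reg.pos.ne'
  refine Fs_dir (fun j => insert α {γ | γ < α ∧ ρ γ α ≤ j}) ?_ (Fs_mono ?_ hx)
  · refine Monotone.directed_le (f := fun j => insert α {γ | γ < α ∧ ρ γ α ≤ j}) ?_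
    intro j j' hj
    exact Set.insert_subset_insert fun γ hγ => ⟨hγ.1, hγ.2.trans hj⟩
  · intro γ hγ
    rw [Set.mem_iUnion]
    rcases (show γ ≤ α from hγ).eq_or_lt with rfl | hlt
    · exact ⟨hne.some, Or.inl rfl⟩
    · exact ⟨ρ γ α, Or.inr ⟨hlt, le_rfl⟩⟩

theorem main (E : Env μ X M) (he : ∀ a, Set.range (e a) = (Fs (Set.Iic a) : Set (FreeGroup X)))
    (hJ : ∀ Y : Set X, Ub Y →
    (∀ β ∈ Y, ∀ α ∈ Y, β < α → F β α < α → ρ (F β α) α < ρ β α → F β α ∈ Y) →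
    (∀ β ∈ Y, ∀ α ∈ Y, β < α → i α < α → ρ (i α) α < ρ β α → i α ∈ Y) → Y = Set.univ) (ξ : Ix M)
    (K : Subgroup (mkSys ρ h F i e).Gp)
    (hK : Ub {α | (mkSys ρ h F i e).q ((mkSys ρ h F i e).hw ξ α) ∈ K ∧
      (mkSys ρ h F i e).q ((mkSys ρ h F i e).hw ξ α) ∉ (mkSys ρ h F i e).Gs (Set.Iio α)}) : K = ⊤ := by
  induction ξ using WellFoundedLT.induction generalizing K with
  | _ ξ ih =>
    rcases ξ with _ | ξ
    · refine fin hJ K fun d => ?_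
      obtain ⟨t, ht, hd⟩ := hK d
      exact ⟨t, ht.1, hd⟩
    rcases ξ with _ | m
    · refine fin hJ K fun d => ?_
      obtain ⟨t, ht, hd⟩ := hK d
      exact ⟨t, ht.1, hd⟩
    by_cases hub : Ub {β | (mkSys ρ h F i e).q (FreeGroup.of β) ∈ K}
    · exact fin hJ K hub
    unfold Ub at hub
    push Not at hub
    obtain ⟨d, hd⟩ := hub
    have hem : ∀ a, e a m ∈ Fs (Set.Iic a) := fun a => by
      have : e a m ∈ Set.range (e a) := ⟨m, rfl⟩
      rw [he] at this
      exact this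
    obtain ⟨j, hj⟩ := E.pig E.cM.le _ hK (fun j α => e α m ∈ Fs (insert α {γ | γ < α ∧ ρ γ α ≤ j}))
      fun t _ => Fs_rank ρ E (hem t)
    have hT : Ub ({t | t ∈ {α | (mkSys ρ h F i e).q (e α m) ∈ K ∧
      (mkSys ρ h F i e).q (e α m) ∉ (mkSys ρ h F i e).Gs (Set.Iio α)} ∧ e t m ∈ Fs (insert t {γ | γ < t ∧ ρ γ t ≤ j})} ∩ Set.Ioi d) := by
      intro d'
      obtain ⟨t, ht, hd'⟩ := hj (max d d')
      exact ⟨t, ⟨ht, (le_max_left _ _).trans_lt hd'⟩, (le_max_right _ _).trans_lt hd'⟩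
    obtain ⟨T, hTs, hT, hTj⟩ := thin E h _ hT j
    obtain ⟨β, hβ, -⟩ := hT d
    have hT' : Ub (T ∩ Set.Ioi β) := by
      intro d'
      obtain ⟨t, ht, hd'⟩ := hT (max β d')
      exact ⟨t, ⟨ht, (le_max_left _ _).trans_lt hd'⟩, (le_max_right _ _).trans_lt hd'⟩
    have key : ∀ α ∈ T ∩ Set.Ioi β, ∃ p : Ix M × (mkSys ρ h F i e).Gs (Set.Iic β), p.1 < ((m : WithBot M) : Ix M) ∧
        (mkSys ρ h F i e).q (e α m) = p.2.1 * (mkSys ρ h F i e).q ((mkSys ρ h F i e).hw p.1 α) * p.2.1⁻¹ := by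
      rintro α ⟨hα, hlt⟩
      have hlt : β < α := hlt
      have hr := hTj β hβ α hα hlt
      have hα' := hTs hα
      have hβ' := hTs hβ
      have hel : (mkSys ρ h F i e).El (mkSys ρ h F i e).Rel β α ((m : WithBot M) : Ix M) := by
        refine (mkSys ρ h F i e).el_of hlt (S := {γ | γ < α ∧ ρ γ α ≤ j}) (T := {γ | γ < β ∧ ρ γ β ≤ j})
          ?_ ?_ hα'.1.2 hβ'.1.2 (of_mem (Or.inl rfl)) hα'.1.1.2 hβ'.1.1.2
        · rintro γ ⟨h1, h2⟩
          exact ⟨h1, Or.inl (h2.trans_lt hr)⟩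
        · rintro γ ⟨h1, h2⟩
          refine ⟨⟨h1.trans hlt, ?_⟩, h1⟩
          have h3 : ρ γ α ≤ ρ β α := (h.tri γ β α h1 hlt).trans (max_le (h2.trans hr.le) le_rfl)
          rcases h3.eq_or_lt with h4 | h4
          · exact Or.inr ⟨h4, h1⟩
          · exact Or.inl h4
      have hnk : ¬ (mkSys ρ h F i e).Kp (mkSys ρ h F i e).Rel β α ((m : WithBot M) : Ix M) := by
        intro hk
        have := (mkSys ρ h F i e).kp_mem hlt hk K hα'.1.1.1 hβ'.1.1.1
        exact absurd (hd β this) (not_le.2 hβ'.2)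
      unfold Sys.Kp at hnk
      push Not at hnk
      obtain ⟨ξ', hξ', hel', hcj⟩ := hnk hel
      obtain ⟨a, ha, h1, h2⟩ := Sys.cj_eq _ hcj
      have hgI : ∀ ξ : Ix M, (mkSys ρ h F i e).gw ξ β ∈ Fs (Set.Iic β) := by
        intro ξ
        rcases ξ with _ | ξ
        · exact of_mem (le_refl β)
        rcases ξ with _ | m'
        · exact (show FreeGroup.of β ^ 2 ∈ Fs (Set.Iic β) from pow_mem (of_mem Set.self_mem_Iic) 2)
        · show e β m' ∈ _
          have : e β m' ∈ Set.range (e β) := ⟨m', rfl⟩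
          rw [he] at this
          exact this
      have hg1 : (mkSys ρ h F i e).q (e β m) ∉ (mkSys ρ h F i e).Gs (Set.Iio β) := hβ'.1.1.2
      rcases (mkSys ρ h F i e).mal_Iic (x := a) (Sys.q_mem _ (hgI ξ')) (by
        rw [← h2]; exact Sys.q_mem _ (hgI _)) with h3 | h3
      · exfalso
        rw [h3, mul_one, mul_inv_cancel] at h2
        exact hg1 ((show (mkSys ρ h F i e).q (e β m) = 1 from h2) ▸ one_mem _)
      · exact ⟨(ξ', ⟨a, h3⟩), hξ', h1⟩
    have hcard : #(Ix M × (mkSys ρ h F i e).Gs (Set.Iic β)) ≤ μ := by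
      rw [mk_prod, lift_id, lift_id]
      exact (mul_le_mul' (card_Ix E) (card_Gs E _ β)).trans_eq (mul_eq_self E.reg.1)
    obtain ⟨⟨ξ', a⟩, hp⟩ := E.pig hcard _ hT' _ key
    obtain ⟨t0, ht0, -⟩ := hp d
    have hlt : ξ' < ((m : WithBot M) : Ix M) := ht0.2.1
    have hfin := ih ξ' hlt (K.comap (MulAut.conj a.1).toMonoidHom) ?_
    · rw [eq_top_iff]
      intro g _
      have : a.1⁻¹ * g * a.1 ∈ K.comap (MulAut.conj a.1).toMonoidHom := by rw [hfin]; trivial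
      have h5 : (MulAut.conj a.1) (a.1⁻¹ * g * a.1) ∈ K := this
      rw [MulAut.conj_apply] at h5
      have e5 : a.1 * (a.1⁻¹ * g * a.1) * a.1⁻¹ = g := by group
      rwa [e5] at h5
    · intro d'
      obtain ⟨α, ⟨⟨hα, hβα⟩, hα2⟩, hd'⟩ := hp d'
      refine ⟨α, ⟨?_, ?_⟩, hd'⟩
      · show (MulAut.conj a.1) _ ∈ K
        rw [MulAut.conj_apply, ← hα2.2]
        exact (hTs hα).1.1.1
      · intro hmem
        have ha : a.1 ∈ (mkSys ρ h F i e).Gs (Set.Iio α) :=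
          Sys.Gs_mono _ (fun x hx => lt_of_le_of_lt hx hβα) a.2
        apply (hTs hα).1.1.2
        rw [hα2.2]
        exact mul_mem (mul_mem ha hmem) (inv_mem ha)

end

theorem group_of (E : Env μ X M) :
    ∃ (G : Type u) (_ : Group G), #G = Order.succ μ ∧
      (∀ g : G, g ≠ 1 → ¬ IsOfFinOrder g) ∧
      (∀ K : Subgroup G, K ≠ ⊤ → #K < #G) := by
  obtain ⟨ρ, h⟩ := exists_rho E
  obtain ⟨F, i, hJ⟩ := jonsson E h
  choose e he using E.enum
  have hinf : ℵ₀ ≤ #X := by rw [E.cX]; exact E.reg.1.trans (Order.le_succ μ)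
  have hXne : Nonempty X := by
    rw [← mk_ne_zero_iff]; exact (aleph0_pos.trans_le hinf).ne'
  have hcard : #(mkSys ρ h F i e).Gp = Order.succ μ := by
    apply le_antisymm
    · refine (mk_le_of_surjective (QuotientGroup.mk'_surjective _)).trans ?_
      rw [mk_freeGroup, max_eq_left hinf, E.cX]
    · rw [← E.cX]
      refine mk_le_of_injective (f := fun x => (mkSys ρ h F i e).q (FreeGroup.of x)) ?_
      have key : ∀ x y : X, x < y → (mkSys ρ h F i e).q (FreeGroup.of x) ≠ (mkSys ρ h F i e).q (FreeGroup.of y) := by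
        intro x y hxy heq
        apply (mkSys ρ h F i e).of_not y
        rw [← heq]
        exact Sys.q_mem _ (of_mem hxy)
      intro x y hxy
      by_contra hne
      rcases lt_or_gt_of_ne hne with h1 | h1
      · exact key x y h1 hxy
      · exact key y x h1 hxy.symm
  refine ⟨(mkSys ρ h F i e).Gp, inferInstance, hcard, ?_, ?_⟩
  · intro g hg hfin
    obtain ⟨n, hn, hn'⟩ := isOfFinOrder_iff_pow_eq_one.1 hfin
    exact hg (Sys.tfG _ g n hn hn')
  · intro K hK
    by_contra hle
    rw [not_lt, hcard] at hle
    apply hK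
    have hT : Ub {α | ∃ k ∈ K, k ∈ (mkSys ρ h F i e).Gs (Set.Iic α) ∧ k ∉ (mkSys ρ h F i e).Gs (Set.Iio α)} := by
      by_contra hub
      unfold Ub at hub
      push Not at hub
      obtain ⟨d, hd⟩ := hub
      have h1 : ∀ δ, ∀ k ∈ K, k ∈ (mkSys ρ h F i e).Gs (Set.Iic δ) → k ∈ (mkSys ρ h F i e).Gs (Set.Iic d) := by
        intro δ
        induction δ using WellFoundedLT.induction with
        | _ δ ih =>
          intro k hk hkδ
          rcases le_or_gt δ d with hle | hlt
          · exact Sys.Gs_mono _ (Set.Iic_subset_Iic.2 hle) hkδ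
          · have h2 : k ∈ (mkSys ρ h F i e).Gs (Set.Iio δ) := by
              by_contra h3
              exact absurd (hd δ ⟨k, hk, hkδ, h3⟩) (not_le.2 hlt)
            obtain ⟨x, hx, hxk⟩ := h2
            have : Nonempty {i // d ≤ i ∧ i < δ} := ⟨⟨d, le_rfl, hlt⟩⟩
            have hx' : x ∈ Fs (Set.Iio δ) := hx
            rw [Sys.Iio_eq hlt] at hx'
            obtain ⟨δ', hδ'⟩ := Fs_dir (fun i : {i // d ≤ i ∧ i < δ} => Set.Iic i.1) (Monotone.directed_le
              fun a b hab => Set.Iic_subset_Iic.2 hab) hx'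
            exact ih δ'.1 δ'.2.2 k hk (hxk ▸ Sys.q_mem _ hδ')
      have h2 : ∀ k ∈ K, k ∈ (mkSys ρ h F i e).Gs (Set.Iic d) := by
        intro k hk
        obtain ⟨x, rfl⟩ := QuotientGroup.mk'_surjective _ k
        have hx : x ∈ Fs (⋃ i : X, Set.Iic i) := by
          rw [Set.iUnion_Iic, Sys.Fs_univ]; trivial
        obtain ⟨δ, hδ⟩ := Fs_dir (fun i : X => Set.Iic i) (Monotone.directed_le
              fun a b hab => Set.Iic_subset_Iic.2 hab) hx
        exact h1 δ _ hk (Sys.q_mem _ hδ)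
      have h3 : #K ≤ #((mkSys ρ h F i e).Gs (Set.Iic d)) := mk_le_mk_of_subset h2
      exact absurd (hle.trans (h3.trans (card_Gs E _ d))) (not_le.2 (Order.lt_succ μ))
    obtain ⟨m, hm⟩ := E.pig E.cM.le _ hT (fun m α => (mkSys ρ h F i e).q (e α m) ∈ K ∧
      (mkSys ρ h F i e).q (e α m) ∉ (mkSys ρ h F i e).Gs (Set.Iio α)) (by
        rintro α ⟨k, hk, ⟨x, hx, rfl⟩, hk2⟩
        rw [← he α] at hx
        obtain ⟨m, rfl⟩ := hx
        exact ⟨m, hk, hk2⟩)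
    refine main E he hJ ((m : WithBot M) : Ix M) K ?_
    intro d
    obtain ⟨t, ht, hd⟩ := hm d
    exact ⟨t, ht.2, hd⟩

theorem exists_group {μ : Cardinal.{u}} (hμ : μ.IsRegular) :
    ∃ (G : Type u) (_ : Group G), #G = Order.succ μ ∧
      (∀ g : G, g ≠ 1 → ¬ IsOfFinOrder g) ∧
      (∀ K : Subgroup G, K ≠ ⊤ → #K < #G) := group_of (env hμ)
end JG

open Cardinal

/-- If `κ` is the successor cardinal of a regular (infinite) cardinal, then there exists
a torsion-free Jónsson group of cardinality `κ`. -/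
theorem exists_torsionfree_jonsson_group (μ : Cardinal.{u}) (hμ : μ.IsRegular)
    (κ : Cardinal.{u}) (hκ : κ = Order.succ μ) :
    ∃ (G : Type u) (_ : Group G), #G = κ ∧
      (∀ g : G, g ≠ 1 → ¬ IsOfFinOrder g) ∧
      (∀ K : Subgroup G, K ≠ ⊤ → #K < #G) := by
  subst hκ
  exact JG.exists_group hμ
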